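/- Let Λ be a cyclic Nakayama algebra with φ-dimension φdim Λ ≥ 3. Then del Λ = del ε(Λ) + 2, where ε(Λ) is the syzygy filtered algebra of Λ. -/

import Mathlib

open Function DirectSum
open scoped Classical

noncomputable section

section Preamble

variable (A : Type) [Ring A]

/-- A submodule is small (superfluous) if it has no proper supplement. -/
def IsSmallSubmodule {M : Type} [AddCommGroup M] [Module A M] (N : Submodule A M) : Prop :=
  ∀ K : Submodule A M, N ⊔ K = ⊤ → K = ⊤

/-- `P` is a projective cover of `M`: `P` is projective, finitely generated, and there is a
surjection `P → M` with small (superfluous) kernel. -/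
def IsProjCoverOf (P M : ModuleCat.{0} A) : Prop :=
  Module.Projective A ↥P ∧ Module.Finite A ↥P ∧
    ∃ f : ↥P →ₗ[A] ↥M, Function.Surjective f ∧ IsSmallSubmodule A (LinearMap.ker f)

/-- `N` is (isomorphic to) the syzygy `Ω(M)`, i.e. the kernel of a projective cover of `M`. -/
def IsSyzygyOf (N M : ModuleCat.{0} A) : Prop :=
  ∃ (P : ModuleCat.{0} A) (f : ↥P →ₗ[A] ↥M),
    Module.Projective A ↥P ∧ Module.Finite A ↥P ∧ Function.Surjective f ∧
      IsSmallSubmodule A (LinearMap.ker f) ∧ Nonempty (↥N ≃ₗ[A] ↥(LinearMap.ker f))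

/-- `N` is (isomorphic to) the `n`-th syzygy `Ω^n(M)`. -/
def IsNthSyzygyOf : ℕ → ModuleCat.{0} A → ModuleCat.{0} A → Prop
  | 0 => fun N M => Nonempty (↥N ≃ₗ[A] ↥M)
  | n + 1 => fun N M => ∃ K : ModuleCat.{0} A, IsNthSyzygyOf n K M ∧ IsSyzygyOf A N K

/-- An indecomposable module: nontrivial, with no nontrivial direct sum decomposition. -/
def IndecomposableModule (M : ModuleCat.{0} A) : Prop :=
  Nontrivial ↥M ∧ ∀ N N' : Submodule A ↥M, IsCompl N N' → N = ⊥ ∨ N = ⊤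

/-- A uniserial module: the submodules form a chain. -/
def IsUniserialModule (M : ModuleCat.{0} A) : Prop :=
  ∀ N N' : Submodule A ↥M, N ≤ N' ∨ N' ≤ N

/-- A (one-sided) Nakayama condition: an Artinian ring all of whose finitely generated
indecomposable modules are uniserial. -/
def IsNakayamaRing : Prop :=
  IsArtinianRing A ∧
    ∀ M : ModuleCat.{0} A, Module.Finite A ↥M → IndecomposableModule A M → IsUniserialModule A M

/-- A Nakayama algebra: all indecomposable finitely generated (left and right) modules
are uniserial. -/
def IsNakayamaAlgebra : Prop := IsNakayamaRing A ∧ IsNakayamaRing Aᵐᵒᵖ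

/-- Connectedness: the only central idempotents are `0` and `1`. -/
def IsConnectedRing : Prop :=
  ∀ e : A, IsIdempotentElem e → e ∈ Set.center A → e = 0 ∨ e = 1

/-- A cyclic Nakayama algebra: a connected Nakayama algebra whose quiver is a cyclically
oriented cycle, equivalently with no simple projective module. -/
def IsCyclicNakayama : Prop :=
  IsNakayamaAlgebra A ∧ IsConnectedRing A ∧
    ∀ M : ModuleCat.{0} A, IsSimpleModule A ↥M → ¬ Module.Projective A ↥M

/-- The projective dimension of a module, computed via minimal projective resolutions:
the least `n` such that `Ω^n(M)` is projective (`⊤ = ∞` if there is none). -/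
def projDim (M : ModuleCat.{0} A) : ℕ∞ :=
  sInf ((fun n : ℕ => (n : ℕ∞)) ''
    {n : ℕ | ∃ N : ModuleCat.{0} A, IsNthSyzygyOf A n N M ∧ Module.Projective A ↥N})

/-- The finitistic dimension: the supremum of the (finite) projective dimensions of
finitely generated modules of finite projective dimension. -/
def finDim : ℕ∞ :=
  sSup {d : ℕ∞ | d ≠ ⊤ ∧ ∃ M : ModuleCat.{0} A, Module.Finite A ↥M ∧ projDim A M = d}

/-- The global dimension: the supremum of the projective dimensions of all finitely
generated modules. -/
def globalDim : ℕ∞ :=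
  sSup {d : ℕ∞ | ∃ M : ModuleCat.{0} A, Module.Finite A ↥M ∧ projDim A M = d}

/-- `N` is a direct summand of `M`. -/
def IsDirectSummandOf (N M : ModuleCat.{0} A) : Prop :=
  ∃ C : ModuleCat.{0} A, Nonempty (↥M ≃ₗ[A] (↥N × ↥C))

/-- The delooping level of a module `M`:
`del M = min { d | Ω^d(M) is a direct summand of A ⊕ Ω^{d+1}(M') for some f.g. M' }`. -/
def delMod (M : ModuleCat.{0} A) : ℕ∞ :=
  sInf ((fun n : ℕ => (n : ℕ∞)) ''
    {d : ℕ | ∃ (M' N N' : ModuleCat.{0} A), Module.Finite A ↥M' ∧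
      IsNthSyzygyOf A d N M ∧ IsNthSyzygyOf A (d + 1) N' M' ∧
      IsDirectSummandOf A N (ModuleCat.of A (A × ↥N'))})

/-- The delooping level of the algebra: the supremum over simple modules. -/
def delAlg : ℕ∞ :=
  sSup {d : ℕ∞ | ∃ S : ModuleCat.{0} A, IsSimpleModule A ↥S ∧ delMod A S = d}

/-- A periodic module: `Ω^t(M) ≅ M` for some `t ≥ 1`. -/
def IsPeriodicModule (M : ModuleCat.{0} A) : Prop :=
  ∃ t : ℕ, 1 ≤ t ∧ IsNthSyzygyOf A t M M

/-- Selfinjectivity: the regular module is injective. -/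
def IsSelfinjectiveRing : Prop := Module.Injective A A

/-- The socle of a module: the sum of all simple submodules. -/
def socleOf (M : ModuleCat.{0} A) : Submodule A ↥M :=
  sSup {N : Submodule A ↥M | IsSimpleModule A ↥N}

/-- The radical of a module: `rad M = J(A)·M`. -/
def radOf (M : Type) [AddCommGroup M] [Module A M] : Submodule A M :=
  (Ideal.jacobson (⊥ : Ideal A)) • (⊤ : Submodule A M)

/-- The top of a module: `M / rad M`. -/
abbrev topOf (M : Type) [AddCommGroup M] [Module A M] :=
  M ⧸ radOf A M

end Preamble

section Phi

variable (A : Type) [Ring A]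

/-- Finitely generated indecomposable modules. -/
def FGIndec := {M : ModuleCat.{0} A // Module.Finite A ↥M ∧ IndecomposableModule A M}

/-- Isomorphism as a setoid on finitely generated indecomposable modules. -/
def indecSetoid : Setoid (FGIndec A) where
  r X Y := Nonempty (↥X.1 ≃ₗ[A] ↥Y.1)
  iseqv := ⟨fun _ => ⟨LinearEquiv.refl A _⟩,
            fun h => h.elim fun e => ⟨e.symm⟩,
            fun h h' => h.elim fun e => h'.elim fun e' => ⟨e.trans e'⟩⟩

/-- Isomorphism classes of finitely generated indecomposable modules. -/
abbrev IndecIso := Quotient (indecSetoid A)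

/-- The free abelian group on iso-classes of f.g. indecomposable modules. -/
abbrev K0Group := IndecIso A →₀ ℤ

/-- `f` records a decomposition of `M` as a direct sum of indecomposables with
multiplicities. -/
def IsDecompositionOf (f : IndecIso A →₀ ℕ) (M : ModuleCat.{0} A) : Prop :=
  Nonempty (↥M ≃ₗ[A] DirectSum (Σ x : f.support, Fin (f x.1))
    (fun i => ↥((Quotient.out i.1.1).1)))

/-- The class of `M` in the free abelian group on indecomposables (junk value `0` if no
decomposition exists). -/
def decompClass (M : ModuleCat.{0} A) : K0Group A :=
  if h : ∃ f : IndecIso A →₀ ℕ, IsDecompositionOf A f M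
  then (Classical.choose h).mapRange (fun m : ℕ => (m : ℤ)) (by simp)
  else 0

/-- A choice of syzygy module `Ω(M)` (junk value `0` if no projective cover exists). -/
def syzygyModule (M : ModuleCat.{0} A) : ModuleCat.{0} A :=
  if h : ∃ N : ModuleCat.{0} A, IsSyzygyOf A N M then Classical.choose h
  else ModuleCat.of A PUnit

/-- The Igusa–Todorov endomorphism `L` of the free abelian group on indecomposables,
sending `[M] ↦ [Ω M]`. -/
def syzygyEnd : AddMonoid.End (K0Group A) :=
  Finsupp.liftAddHom fun x : IndecIso A =>
    (zmultiplesHom (K0Group A)) (decompClass A (syzygyModule A (Quotient.out x).1))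

/-- The generators `[X]`, `X` an indecomposable direct summand of `M`, of the subgroup
`⟨add M⟩`. -/
def addGenerators (M : ModuleCat.{0} A) : Set (K0Group A) :=
  {g | ∃ (X : ModuleCat.{0} A) (h : Module.Finite A ↥X ∧ IndecomposableModule A X),
      IsDirectSummandOf A X M ∧ g = Finsupp.single (Quotient.mk (indecSetoid A) ⟨X, h⟩) 1}

/-- The Igusa–Todorov function `φ(M)`: the least `t` at which the rank of
`L^t⟨add M⟩` stabilizes. -/
def phiMod (M : ModuleCat.{0} A) : ℕ∞ :=
  sInf ((fun n : ℕ => (n : ℕ∞)) ''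
    {t : ℕ | ∀ j : ℕ, 1 ≤ j →
      Module.finrank ℤ
        ↥(AddSubgroup.map ((syzygyEnd A) ^ t) (AddSubgroup.closure (addGenerators A M))) =
      Module.finrank ℤ
        ↥(AddSubgroup.map ((syzygyEnd A) ^ (t + j)) (AddSubgroup.closure (addGenerators A M)))})

/-- The `φ`-dimension of the algebra. -/
def phiDim : ℕ∞ :=
  sSup {d : ℕ∞ | ∃ M : ModuleCat.{0} A, Module.Finite A ↥M ∧ phiMod A M = d}

end Phi

section Epsilon

variable (A : Type) [Ring A]

/-- `T` is (isomorphic to) the socle of some indecomposable projective module. -/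
def IsSocleOfIndecProjective (T : ModuleCat.{0} A) : Prop :=
  IsSimpleModule A ↥T ∧ ∃ Q : ModuleCat.{0} A, Module.Projective A ↥Q ∧ Module.Finite A ↥Q ∧
    IndecomposableModule A Q ∧ Nonempty (↥T ≃ₗ[A] ↥(socleOf A Q))

/-- `S` belongs to `S'(Λ)`: `S ≅ S_{i+1}` where `S_i` is a socle of an indecomposable
projective; here `S_{i+1} = top (rad P(S_i))` for the cyclic quiver. -/
def IsInSPrime (S : ModuleCat.{0} A) : Prop :=
  IsSimpleModule A ↥S ∧ ∃ T P : ModuleCat.{0} A, IsSocleOfIndecProjective A T ∧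
    IsProjCoverOf A P T ∧ Nonempty ((topOf A ↥(radOf A ↥P)) ≃ₗ[A] ↥S)

/-- `B` is (isomorphic to) the syzygy filtered algebra
`ε(Λ) = End_Λ(⊕_{S ∈ S'(Λ)} P(S))`. -/
def IsSyzygyFilteredAlgebra (B : Type) [Ring B] : Prop :=
  ∃ (ι : Type) (_ : Fintype ι) (Sf Pf : ι → ModuleCat.{0} A),
    (∀ i, IsInSPrime A (Sf i) ∧ IsProjCoverOf A (Pf i) (Sf i)) ∧
    (∀ i j, Nonempty (↥(Sf i) ≃ₗ[A] ↥(Sf j)) → i = j) ∧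
    (∀ S : ModuleCat.{0} A, IsInSPrime A S → ∃ i, Nonempty (↥S ≃ₗ[A] ↥(Sf i))) ∧
    Nonempty (B ≃+* Module.End A (DirectSum ι fun i => ↥(Pf i)))

/-- `B` is (isomorphic to) the `d`-th iterated syzygy filtered algebra `ε^d(Λ)`,
each intermediate step being a cyclic non-selfinjective Nakayama algebra. -/
def IsIterSyzygyFiltered (d : ℕ) (B : Type) [Ring B] : Prop :=
  ∃ C : ℕ → RingCat.{0},
    Nonempty (A ≃+* ↥(C 0)) ∧ Nonempty (↥(C d) ≃+* B) ∧
    ∀ i < d, IsCyclicNakayama ↥(C i) ∧ ¬ IsSelfinjectiveRing ↥(C i) ∧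
      IsSyzygyFilteredAlgebra ↥(C i) ↥(C (i + 1))

end Epsilon

section SerialDatum

/-- A serial presentation of the module category of `R`: finitely many pairwise non-isomorphic
local projectives `P i` generating all modules, with maps `α i : P (τ i) → P i` onto the unique
maximal submodule of `P i`, along which endomorphisms can be moved. -/
structure IsSerialDatum (R : Type) [Ring R] {I : Type} (P : I → Type)
    [∀ i, AddCommGroup (P i)] [∀ i, Module R (P i)] (τ : I → I)
    (α : ∀ i, P (τ i) →ₗ[R] P i) : Prop where
  projective : ∀ i, Module.Projective R (P i)
  le_range : ∀ (i : I) (N : Submodule R (P i)), N ≠ ⊤ → N ≤ LinearMap.range (α i)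
  range_ne_top : ∀ i, LinearMap.range (α i) ≠ ⊤
  artinian : ∀ i, IsArtinian R (P i)
  generates : ∀ (M : Type) [AddCommGroup M] [Module R M] (K : Submodule R M), K ≠ ⊤ →
    ∃ (i : I) (f : P i →ₗ[R] M), ¬ LinearMap.range f ≤ K
  eq_of_surjective : ∀ (i j : I) (f : P i →ₗ[R] P j), Surjective f → i = j
  injective : Injective τ
  comm : ∀ (i : I) (u : P (τ i) →ₗ[R] P (τ i)), ∃ v : P i →ₗ[R] P i, v ∘ₗ α i = α i ∘ₗ u

variable {R : Type} [Ring R] {I : Type} {P : I → Type}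
  [∀ i, AddCommGroup (P i)] [∀ i, Module R (P i)] {τ : I → I}
  {α : ∀ i, P (τ i) →ₗ[R] P i}

/-- The radical series of the projective `P i`. -/
def serialRad (α : ∀ i, P (τ i) →ₗ[R] P i) : ℕ → ∀ i, Submodule R (P i)
  | 0, _ => ⊤
  | k + 1, i => (serialRad α k (τ i)).map (α i)

@[simp] lemma serialRad_zero (i : I) : serialRad α 0 i = ⊤ := rfl

lemma serialRad_succ (k : ℕ) (i : I) :
    serialRad α (k + 1) i = (serialRad α k (τ i)).map (α i) := rfl

lemma serialRad_one (i : I) : serialRad α 1 i = LinearMap.range (α i) := by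
  rw [serialRad_succ, serialRad_zero, Submodule.map_top]

lemma serialRad_succ_le (k : ℕ) (i : I) : serialRad α (k + 1) i ≤ serialRad α k i := by
  induction k generalizing i with
  | zero => exact le_top
  | succ k ih => exact Submodule.map_mono (ih (τ i))

lemma serialRad_antitone (i : I) : Antitone fun k => serialRad α k i :=
  antitone_nat_of_succ_le fun k => serialRad_succ_le k i

/-- Every submodule of `P i` is a term of the radical series or lies below it. -/
lemma le_serialRad_or_eq_of_le_range
    (hα : ∀ (i : I) (N : Submodule R (P i)), N ≠ ⊤ → N ≤ LinearMap.range (α i))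
    (k : ℕ) (i : I) (N : Submodule R (P i)) :
    N ≤ serialRad α k i ∨ ∃ j < k, N = serialRad α j i := by
  induction k generalizing i with
  | zero => exact Or.inl le_top
  | succ k ih =>
    by_cases hN : N = ⊤
    · exact Or.inr ⟨0, k.succ_pos, hN⟩
    have hmap : (N.comap (α i)).map (α i) = N :=
      Submodule.map_comap_eq_self (hα i N hN)
    rcases ih (τ i) (N.comap (α i)) with h | ⟨j, hj, h⟩
    · left
      rw [← hmap]
      exact Submodule.map_mono h
    · right
      exact ⟨j + 1, by omega, by rw [serialRad_succ, ← h, hmap]⟩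

namespace IsSerialDatum

variable (D : IsSerialDatum R P τ α)

include D

lemma ker_le_range {i : I} {M : Type} [AddCommGroup M] [Module R M] {f : P i →ₗ[R] M}
    (hf : f ≠ 0) : LinearMap.ker f ≤ LinearMap.range (α i) :=
  D.le_range i _ fun h => hf (LinearMap.ker_eq_top.1 h)

lemma le_serialRad_or_eq (k : ℕ) (i : I) (N : Submodule R (P i)) :
    N ≤ serialRad α k i ∨ ∃ j < k, N = serialRad α j i :=
  le_serialRad_or_eq_of_le_range D.le_range k i N

/-- The radical series is strictly decreasing until it reaches zero. -/
lemma serialRad_succ_lt {k : ℕ} {i : I} (h : serialRad α k i ≠ ⊥) :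
    serialRad α (k + 1) i < serialRad α k i := by
  induction k generalizing i with
  | zero => rw [serialRad_one]; exact (D.range_ne_top i).lt_top
  | succ k ih =>
    have hk : serialRad α k (τ i) ≠ ⊥ := fun h0 => h (by rw [serialRad_succ, h0, Submodule.map_bot])
    refine lt_of_le_of_ne (serialRad_succ_le _ _) fun heq => ?_
    change ((serialRad α (k + 1) (τ i)).map (α i)) = (serialRad α k (τ i)).map (α i) at heq
    rcases D.le_serialRad_or_eq (k + 1) (τ i) (LinearMap.ker (α i)) with hle | ⟨j, hj, hje⟩
    · have h1 := congrArg (Submodule.comap (α i)) heq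
      rw [Submodule.comap_map_eq, Submodule.comap_map_eq, sup_eq_left.2 hle,
        sup_eq_left.2 (hle.trans (serialRad_succ_le _ _))] at h1
      exact (ih hk).ne h1
    · apply h
      rw [serialRad_succ, eq_bot_iff, Submodule.map_le_iff_le_comap]
      change _ ≤ LinearMap.ker (α i)
      rw [hje]
      exact serialRad_antitone _ (by omega)

lemma exists_serialRad_eq_bot (i : I) : ∃ k, serialRad α k i = ⊥ := by
  have := D.artinian i
  obtain ⟨n, hn⟩ := IsArtinian.monotone_stabilizes
    ⟨fun k => OrderDual.toDual (serialRad α k i), fun _ _ h => serialRad_antitone i h⟩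
  by_contra! hne
  exact (D.serialRad_succ_lt (hne n)).ne' (hn (n + 1) n.le_succ)

/-- The length of `P i`. -/
def length (i : I) : ℕ := Nat.find (D.exists_serialRad_eq_bot i)

lemma serialRad_eq_bot_iff {k : ℕ} {i : I} : serialRad α k i = ⊥ ↔ D.length i ≤ k := by
  refine ⟨fun h => Nat.find_min' _ h, fun h => le_bot_iff.1 ?_⟩
  exact (serialRad_antitone i h).trans (Nat.find_spec (D.exists_serialRad_eq_bot i)).le

lemma length_pos (i : I) : 0 < D.length i := by
  by_contra! h
  have h1 := D.serialRad_eq_bot_iff.2 h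
  rw [serialRad_zero] at h1
  exact D.range_ne_top i (le_antisymm le_top (h1.le.trans bot_le))

lemma serialRad_le_iff {k l : ℕ} {i : I} (hl : l ≤ D.length i) :
    serialRad α k i ≤ serialRad α l i ↔ l ≤ k := by
  refine ⟨fun h => ?_, fun h => serialRad_antitone i h⟩
  by_contra! hkl
  have hk : serialRad α k i ≠ ⊥ := fun h0 => by rw [D.serialRad_eq_bot_iff] at h0; omega
  exact (D.serialRad_succ_lt hk).not_ge (h.trans (serialRad_antitone i hkl))

lemma serialRad_inj {k l : ℕ} {i : I} (hk : k ≤ D.length i) (hl : l ≤ D.length i)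
    (h : serialRad α k i = serialRad α l i) : k = l :=
  le_antisymm ((D.serialRad_le_iff hk).1 h.ge) ((D.serialRad_le_iff hl).1 h.le)

lemma exists_eq_serialRad {i : I} (N : Submodule R (P i)) :
    ∃ k ≤ D.length i, N = serialRad α k i := by
  rcases D.le_serialRad_or_eq (D.length i) i N with h | ⟨j, hj, h⟩
  · refine ⟨_, le_rfl, le_antisymm h ?_⟩
    rw [D.serialRad_eq_bot_iff.2 le_rfl]
    exact bot_le
  · exact ⟨j, hj.le, h⟩

lemma le_total {i : I} (N K : Submodule R (P i)) : N ≤ K ∨ K ≤ N := by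
  obtain ⟨k, -, rfl⟩ := D.exists_eq_serialRad N
  obtain ⟨l, -, rfl⟩ := D.exists_eq_serialRad K
  exact (Nat.le_total l k).imp (fun h => serialRad_antitone i h) fun h => serialRad_antitone i h

lemma isNoetherian (i : I) : IsNoetherian R (P i) := by
  have hfin : Finite (Submodule R (P i)) := by
    refine Finite.of_surjective (fun k : Fin (D.length i + 1) => serialRad α k i) fun N => ?_
    obtain ⟨k, hk, rfl⟩ := D.exists_eq_serialRad N
    exact ⟨⟨k, by omega⟩, rfl⟩
  rw [isNoetherian_iff']
  infer_instance

/-- A map with image `rad^e` carries the radical onto `rad^(e+1)`. -/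
lemma map_range_eq {i j : I} (f : P i →ₗ[R] P j) {e : ℕ}
    (hf : LinearMap.range f = serialRad α e j) :
    (LinearMap.range (α i)).map f = serialRad α (e + 1) j := by
  by_cases h0 : serialRad α e j = ⊥
  · rw [h0, LinearMap.range_eq_bot] at hf
    rw [hf, Submodule.map_zero, eq_comm, eq_bot_iff, ← h0]
    exact serialRad_succ_le e j
  have hf0 : f ≠ 0 := fun h => h0 (by rw [← hf, h, LinearMap.range_zero])
  apply le_antisymm
  · obtain ⟨m, hm, hme⟩ := D.exists_eq_serialRad ((LinearMap.range (α i)).map f)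
    rw [hme]
    refine serialRad_antitone j (show e + 1 ≤ m from ?_)
    by_contra! hlt
    have hle : LinearMap.range f ≤ (LinearMap.range (α i)).map f := by
      rw [hf, hme]; exact serialRad_antitone j (by omega)
    refine D.range_ne_top i (le_antisymm le_top fun x _ => ?_)
    obtain ⟨y, hy, hyx⟩ := hle ⟨x, rfl⟩
    have hk : x - y ∈ LinearMap.ker f := by simp [hyx]
    simpa using add_mem (D.ker_le_range hf0 hk) hy
  · have hle : serialRad α (e + 1) j ≤ LinearMap.range f := by
      rw [hf]; exact serialRad_succ_le e j
    rw [← Submodule.map_comap_eq_self hle]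
    refine Submodule.map_mono (D.le_range i _ fun h => ?_)
    rw [← LinearMap.range_le_iff_comap, hf] at h
    exact (D.serialRad_succ_lt h0).not_ge h

lemma exists_range_eq (d : ℕ) (i : I) :
    ∃ f : P (τ^[d] i) →ₗ[R] P i, LinearMap.range f = serialRad α d i := by
  induction d generalizing i with
  | zero => exact ⟨LinearMap.id, LinearMap.range_id⟩
  | succ d ih =>
    obtain ⟨f, hf⟩ := ih (τ i)
    change ∃ f : P (τ^[d] (τ i)) →ₗ[R] P i, LinearMap.range f = serialRad α (d + 1) i
    exact ⟨α i ∘ₗ f, by rw [LinearMap.range_comp, hf, serialRad_succ]⟩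

/-- A map with image `rad^e` carries `rad^d` onto `rad^(e+d)`. -/
lemma map_serialRad {i j : I} (f : P i →ₗ[R] P j) {e : ℕ}
    (hf : LinearMap.range f = serialRad α e j) (d : ℕ) :
    (serialRad α d i).map f = serialRad α (e + d) j := by
  induction d with
  | zero => rw [serialRad_zero, Submodule.map_top, hf, add_zero]
  | succ d ih =>
    obtain ⟨g, hg⟩ := D.exists_range_eq d i
    rw [← D.map_range_eq g hg, ← Submodule.map_comp]
    exact D.map_range_eq (e := e + d) (f ∘ₗ g) (by rw [LinearMap.range_comp, hg, ih])

lemma ker_eq_serialRad {i j : I} (f : P i →ₗ[R] P j) {e : ℕ} (he : e ≤ D.length j)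
    (hf : LinearMap.range f = serialRad α e j) :
    LinearMap.ker f = serialRad α (D.length j - e) i ∧ D.length j - e ≤ D.length i := by
  have key : ∀ d, serialRad α d i ≤ LinearMap.ker f ↔ D.length j - e ≤ d := by
    intro d
    rw [LinearMap.le_ker_iff_map, D.map_serialRad f hf, D.serialRad_eq_bot_iff]
    omega
  obtain ⟨m, hm, hme⟩ := D.exists_eq_serialRad (LinearMap.ker f)
  have h1 : D.length j - e ≤ m := (key m).1 hme.ge
  have h2 := (key _).2 le_rfl
  rw [hme, D.serialRad_le_iff hm] at h2
  rw [hme, le_antisymm h2 h1]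
  exact ⟨rfl, le_antisymm h2 h1 ▸ hm⟩

lemma length_iterate (d : ℕ) (i : I) : D.length i - d ≤ D.length (τ^[d] i) := by
  rcases le_or_gt d (D.length i) with h | h
  · obtain ⟨f, hf⟩ := D.exists_range_eq d i
    exact (D.ker_eq_serialRad f h hf).2
  · omega

/-- A nonzero map into `P i` with image in the radical lifts along `α i`. -/
lemma exists_lift {i j : I} (f : P j →ₗ[R] P i) {e : ℕ}
    (hf : LinearMap.range f = serialRad α (e + 1) i) :
    ∃ g : P j →ₗ[R] P (τ i), α i ∘ₗ g = f ∧
      (serialRad α (e + 1) i ≠ ⊥ → LinearMap.range g = serialRad α e (τ i)) := by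
  have hle : LinearMap.range f ≤ LinearMap.range (α i) := by
    rw [hf, ← serialRad_one]; exact serialRad_antitone i (by omega)
  have := D.projective j
  obtain ⟨g, hg⟩ := Module.projective_lifting_property (α i).rangeRestrict
    (f.codRestrict _ fun x => hle ⟨x, rfl⟩) (LinearMap.surjective_rangeRestrict _)
  have hg' : α i ∘ₗ g = f := by
    ext x
    simpa using congrArg Subtype.val (LinearMap.congr_fun hg x)
  refine ⟨g, hg', fun h0 => ?_⟩
  obtain ⟨m, hm, hme⟩ := D.exists_eq_serialRad (LinearMap.range g)
  have h1 : serialRad α (m + 1) i = serialRad α (e + 1) i := by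
    rw [← hf, ← hg', LinearMap.range_comp, hme, serialRad_succ]
  have hm' : m + 1 ≤ D.length i := by
    by_contra! hlt
    exact h0 (by rw [← h1, D.serialRad_eq_bot_iff]; omega)
  have he' : e + 1 ≤ D.length i := by
    by_contra! hlt
    exact h0 (by rw [D.serialRad_eq_bot_iff]; omega)
  have := D.serialRad_inj hm' he' h1
  rw [hme, show m = e by omega]

lemma exists_comp_eq_of_range_eq {a : I} (e : ℕ) (x : I) (t : P (τ a) →ₗ[R] P x)
    (ht : LinearMap.range t = serialRad α (e + 1) x) (h0 : serialRad α (e + 1) x ≠ ⊥) :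
    ∃ h : P a →ₗ[R] P x, h ∘ₗ α a = t := by
  induction e generalizing x with
  | zero =>
    obtain ⟨s, hs, hs'⟩ := D.exists_lift t ht
    have := D.injective (D.eq_of_surjective _ _ s (LinearMap.range_eq_top.1 (hs' h0)))
    subst this
    obtain ⟨v, hv⟩ := D.comm a s
    exact ⟨v, hv.trans hs⟩
  | succ e ih =>
    obtain ⟨s, hs, hs'⟩ := D.exists_lift t ht
    obtain ⟨h, hh⟩ := ih (τ x) s (hs' h0)
      fun h => h0 (by rw [serialRad_succ, h, Submodule.map_bot])
    exact ⟨α x ∘ₗ h, by rw [LinearMap.comp_assoc, hh, hs]⟩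

/-- Maps of depth at least `d` out of `P (τ^d a)` factor through the map of depth `d` into
`P a`. -/
lemma exists_cover (d : ℕ) (a : I) :
    ∃ f : P (τ^[d] a) →ₗ[R] P a, LinearMap.range f = serialRad α d a ∧
      ∀ (x : I) (t : P (τ^[d] a) →ₗ[R] P x), LinearMap.range t ≤ serialRad α d x →
        ∃ h : P a →ₗ[R] P x, h ∘ₗ f = t := by
  induction d generalizing a with
  | zero => exact ⟨LinearMap.id, LinearMap.range_id, fun x t _ => ⟨t, LinearMap.comp_id t⟩⟩
  | succ d ih =>
    obtain ⟨f, hf, hfac⟩ := ih (τ a)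
    change ∃ f : P (τ^[d] (τ a)) →ₗ[R] P a, LinearMap.range f = serialRad α (d + 1) a ∧
      ∀ (x : I) (t : P (τ^[d] (τ a)) →ₗ[R] P x), LinearMap.range t ≤ serialRad α (d + 1) x →
        ∃ h : P a →ₗ[R] P x, h ∘ₗ f = t
    refine ⟨α a ∘ₗ f, by rw [LinearMap.range_comp, hf, serialRad_succ], fun x t ht => ?_⟩
    by_cases ht0 : t = 0
    · exact ⟨0, by rw [ht0, LinearMap.zero_comp]⟩
    obtain ⟨h, hh⟩ := hfac x t (ht.trans (serialRad_succ_le d x))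
    obtain ⟨e, he, hee⟩ := D.exists_eq_serialRad (LinearMap.range h)
    have hrt : LinearMap.range t = serialRad α (e + d) x := by
      rw [← hh, LinearMap.range_comp, hf, D.map_serialRad h hee]
    have hne : serialRad α (e + d) x ≠ ⊥ := by
      rw [← hrt]; exact fun h => ht0 (LinearMap.range_eq_bot.1 h)
    have hlen : e + d < D.length x := by
      by_contra! hlt
      exact hne (D.serialRad_eq_bot_iff.2 hlt)
    rw [hrt, D.serialRad_le_iff (by omega)] at ht
    obtain ⟨e, rfl⟩ : ∃ e', e = e' + 1 := ⟨e - 1, by omega⟩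
    obtain ⟨g, hg⟩ := D.exists_comp_eq_of_range_eq e x h hee
      fun h => by rw [D.serialRad_eq_bot_iff] at h; omega
    exact ⟨g, by rw [← LinearMap.comp_assoc, hg, hh]⟩

end IsSerialDatum
end SerialDatum

section Syzygy

variable {R : Type} [Ring R]

lemma IsSmallSubmodule.mono {M : Type} [AddCommGroup M] [Module R M] {N N' : Submodule R M}
    (h : IsSmallSubmodule R N') (hle : N ≤ N') : IsSmallSubmodule R N := fun K hK =>
  h K (top_le_iff.1 (hK.ge.trans (sup_le_sup_right hle K)))

lemma IsSmallSubmodule.map {M M' : Type} [AddCommGroup M] [Module R M] [AddCommGroup M']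
    [Module R M'] {N : Submodule R M} (h : IsSmallSubmodule R N) (f : M →ₗ[R] M') :
    IsSmallSubmodule R (N.map f) := by
  intro K hK
  have h1 : K.comap f = ⊤ := by
    refine h _ (top_le_iff.1 fun x _ => ?_)
    have hx : f x ∈ N.map f ⊔ K := hK ▸ Submodule.mem_top
    obtain ⟨_, ⟨n, hn, rfl⟩, k, hk, hnk⟩ := Submodule.mem_sup.1 hx
    refine Submodule.mem_sup.2 ⟨n, hn, x - n, ?_, by abel⟩
    rw [Submodule.mem_comap, map_sub, ← hnk, add_sub_cancel_left]
    exact hk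
  rw [← hK, eq_comm, sup_eq_right]
  exact Submodule.map_le_iff_le_comap.2 (h1 ▸ le_top)

lemma isSmallSubmodule_finset_sup {M κ : Type} [AddCommGroup M] [Module R M]
    (s : Finset κ) (N : κ → Submodule R M) (h : ∀ k, IsSmallSubmodule R (N k)) :
    IsSmallSubmodule R (s.sup N) := by
  induction s using Finset.induction_on with
  | empty => intro K hK; simpa using hK
  | insert a s _ ih =>
    intro K hK
    rw [Finset.sup_insert, sup_assoc] at hK
    exact ih K (h a _ hK)

lemma isSmallSubmodule_pi {κ : Type} [Fintype κ] {M : κ → Type}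
    [∀ k, AddCommGroup (M k)] [∀ k, Module R (M k)] (N : ∀ k, Submodule R (M k))
    (h : ∀ k, IsSmallSubmodule R (N k)) : IsSmallSubmodule R (Submodule.pi Set.univ N) := by
  refine (isSmallSubmodule_finset_sup Finset.univ
    (fun k => (N k).map (LinearMap.single R M k)) fun k => (h k).map _).mono ?_
  intro x hx
  rw [← LinearMap.sum_single_apply M x]
  refine Submodule.sum_mem _ fun k _ => ?_
  exact Finset.le_sup (f := fun k => (N k).map (LinearMap.single R M k)) (Finset.mem_univ k)
    ⟨x k, hx k trivial, rfl⟩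

/-- Syzygies are unique up to isomorphism. -/
lemma IsSyzygyOf.nonempty_equiv {N N' M M' : ModuleCat.{0} R} (h : IsSyzygyOf R N M)
    (h' : IsSyzygyOf R N' M') (e : M ≃ₗ[R] M') : Nonempty (N ≃ₗ[R] N') := by
  obtain ⟨P, f, hP, -, hf, hs, ⟨eN⟩⟩ := h
  obtain ⟨P', f', hP', -, hf', hs', ⟨eN'⟩⟩ := h'
  obtain ⟨g, hg⟩ := Module.projective_lifting_property f' (e.toLinearMap ∘ₗ f) hf'
  have hg' : ∀ x, f' (g x) = e (f x) := fun x => LinearMap.congr_fun hg x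
  have hgsurj : Surjective g := by
    refine LinearMap.range_eq_top.1 (hs' _ (top_le_iff.1 fun y _ => ?_))
    obtain ⟨x, hx⟩ := hf (e.symm (f' y))
    refine Submodule.mem_sup.2 ⟨y - g x, ?_, g x, ⟨x, rfl⟩, by abel⟩
    rw [LinearMap.mem_ker, map_sub, hg', hx, e.apply_symm_apply, sub_self]
  obtain ⟨s, hsg⟩ := Module.projective_lifting_property g LinearMap.id hgsurj
  have hsg' : ∀ y, g (s y) = y := fun y => LinearMap.congr_fun hsg y
  have hssurj : Surjective s := by
    refine LinearMap.range_eq_top.1 (hs _ (top_le_iff.1 fun x _ => ?_))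
    refine Submodule.mem_sup.2 ⟨x - s (g x), ?_, s (g x), ⟨_, rfl⟩, by abel⟩
    have : e (f (x - s (g x))) = 0 := by rw [← hg', map_sub, hsg', sub_self, map_zero]
    exact LinearMap.mem_ker.2 (e.map_eq_zero_iff.1 this)
  have hginj : Injective g := by
    intro x y hxy
    obtain ⟨a, rfl⟩ := hssurj x
    obtain ⟨b, rfl⟩ := hssurj y
    rw [hsg', hsg'] at hxy
    rw [hxy]
  let eg := LinearEquiv.ofBijective g ⟨hginj, hgsurj⟩
  refine ⟨(eN.trans (eg.ofSubmodules (LinearMap.ker f) (LinearMap.ker f') ?_)).trans eN'.symm⟩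
  ext y
  constructor
  · rintro ⟨x, hx, rfl⟩
    change f' (g x) = 0
    rw [hg', LinearMap.mem_ker.1 hx, map_zero]
  · intro hy
    obtain ⟨x, rfl⟩ := hgsurj y
    refine ⟨x, ?_, rfl⟩
    have : e (f x) = 0 := by rw [← hg']; exact hy
    exact e.map_eq_zero_iff.1 this

lemma IsSyzygyOf.congr {N N' M M' : ModuleCat.{0} R} (h : IsSyzygyOf R N M)
    (e : M ≃ₗ[R] M') (e' : N ≃ₗ[R] N') : IsSyzygyOf R N' M' := by
  obtain ⟨P, f, hP, hfin, hf, hs, ⟨eN⟩⟩ := h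
  have hker : LinearMap.ker (e.toLinearMap ∘ₗ f) = LinearMap.ker f := LinearEquiv.ker_comp e f
  exact ⟨P, e.toLinearMap ∘ₗ f, hP, hfin, e.surjective.comp hf, hker ▸ hs,
    ⟨(e'.symm.trans eN).trans (LinearEquiv.ofEq _ _ hker.symm)⟩⟩

lemma isSyzygyOf_pi {κ : Type} [Fintype κ] (N M : κ → ModuleCat.{0} R)
    (h : ∀ k, IsSyzygyOf R (N k) (M k)) :
    IsSyzygyOf R (ModuleCat.of R (∀ k, N k)) (ModuleCat.of R (∀ k, M k)) := by
  choose P f hP hfin hf hs eN using h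
  have hker : LinearMap.ker (LinearMap.piMap f) =
      Submodule.pi Set.univ fun k => LinearMap.ker (f k) := by
    ext x
    simp [Submodule.mem_pi, funext_iff]
  refine ⟨ModuleCat.of R (∀ k, P k), LinearMap.piMap f, ?_, ?_, ?_, ?_, ⟨?_⟩⟩
  · have := fun k => hP k
    exact Module.Projective.of_equiv (DirectSum.linearEquivFunOnFintype R κ fun k => ↥(P k))
  · have := fun k => hfin k
    exact Module.Finite.pi
  · intro y
    choose x hx using fun k => hf k (y k)
    exact ⟨x, funext hx⟩
  · rw [hker]
    exact isSmallSubmodule_pi _ hs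
  · let e : (∀ k, LinearMap.ker (f k)) ≃ₗ[R] Submodule.pi Set.univ fun k => LinearMap.ker (f k) :=
      { toFun := fun x => ⟨fun k => (x k : P k), fun k _ => (x k).2⟩
        map_add' := fun _ _ => rfl
        map_smul' := fun _ _ => rfl
        invFun := fun x k => ⟨x.1 k, x.2 k trivial⟩
        left_inv := fun _ => rfl
        right_inv := fun _ => rfl }
    exact ((LinearEquiv.piCongrRight fun k => (eN k).some).trans e).trans
      (LinearEquiv.ofEq _ _ hker.symm)

lemma isNthSyzygyOf_iff_of_iterate {X : Type} (U : X → ModuleCat.{0} R) (s : X → X) (V : Set X)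
    (hV : ∀ x ∈ V, s x ∈ V) (hU : ∀ x ∈ V, IsSyzygyOf R (U (s x)) (U x)) {κ : Type} [Fintype κ]
    (w : κ → X) (hw : ∀ k, w k ∈ V) {M N : ModuleCat.{0} R} (e : M ≃ₗ[R] ∀ k, U (w k)) (d : ℕ) :
    IsNthSyzygyOf R d N M ↔ Nonempty (N ≃ₗ[R] ∀ k, U (s^[d] (w k))) := by
  have hV' : ∀ d k, s^[d] (w k) ∈ V := by
    intro d k
    induction d with
    | zero => exact hw k
    | succ d ih => rw [iterate_succ_apply']; exact hV _ ih
  have hstep : ∀ d, IsSyzygyOf R (ModuleCat.of R (∀ k, U (s^[d + 1] (w k))))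
      (ModuleCat.of R (∀ k, U (s^[d] (w k)))) := by
    intro d
    apply isSyzygyOf_pi
    intro k
    rw [iterate_succ_apply']
    exact hU _ (hV' d k)
  induction d generalizing N with
  | zero =>
    exact ⟨fun h => h.elim fun e' => ⟨e'.trans e⟩, fun h => h.elim fun e' => ⟨e'.trans e.symm⟩⟩
  | succ d ih =>
    constructor
    · rintro ⟨K, hK, hNK⟩
      obtain ⟨eK⟩ := ih.1 hK
      exact hNK.nonempty_equiv (hstep d) eK
    · rintro ⟨eN⟩
      exact ⟨ModuleCat.of R (∀ k, U (s^[d] (w k))), ih.2 ⟨LinearEquiv.refl R _⟩,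
        (hstep d).congr (LinearEquiv.refl R _) eN.symm⟩

lemma nonempty_equiv_prod_ker {N M : Type} [AddCommGroup N] [Module R N] [AddCommGroup M]
    [Module R M] (g : N →ₗ[R] M) (f : M →ₗ[R] N) (h : f ∘ₗ g = LinearMap.id) :
    Nonempty (M ≃ₗ[R] (N × LinearMap.ker f)) := by
  have h' : ∀ x, f (g x) = x := fun x => LinearMap.congr_fun h x
  refine ⟨?_⟩
  exact
    { toFun := fun x => (f x, ⟨x - g (f x), by simp [h']⟩)
      map_add' := fun x y => by
        refine Prod.ext (map_add f x y) (Subtype.ext ?_)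
        change x + y - g (f (x + y)) = (x - g (f x)) + (y - g (f y))
        rw [map_add, map_add]; abel
      map_smul' := fun r x => by
        refine Prod.ext (map_smul f r x) (Subtype.ext ?_)
        change r • x - g (f (r • x)) = r • (x - g (f x))
        rw [map_smul, map_smul, smul_sub]
      invFun := fun y => g y.1 + y.2.1
      left_inv := fun x => by simp
      right_inv := fun y => by
        have hy : f y.2.1 = 0 := y.2.2
        refine Prod.ext ?_ (Subtype.ext ?_)
        · change f (g y.1 + y.2.1) = y.1
          rw [map_add, h', hy, add_zero]
        · change g y.1 + y.2.1 - g (f (g y.1 + y.2.1)) = y.2.1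
          rw [map_add, h', hy, add_zero, add_sub_cancel_left] }

/-- A retract is a direct summand. -/
lemma isDirectSummandOf_of_retract {N M : ModuleCat.{0} R} (g : N →ₗ[R] M) (f : M →ₗ[R] N)
    (h : f ∘ₗ g = LinearMap.id) : IsDirectSummandOf R N M :=
  ⟨ModuleCat.of R (LinearMap.ker f), nonempty_equiv_prod_ker g f h⟩

lemma IsDirectSummandOf.exists_retract {N M : ModuleCat.{0} R} (h : IsDirectSummandOf R N M) :
    ∃ (g : N →ₗ[R] M) (f : M →ₗ[R] N), f ∘ₗ g = LinearMap.id := by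
  obtain ⟨C, ⟨e⟩⟩ := h
  refine ⟨e.symm.toLinearMap ∘ₗ LinearMap.inl R N C, LinearMap.fst R N C ∘ₗ e.toLinearMap, ?_⟩
  ext x
  simp

end Syzygy

section SerialModules

variable {R : Type} [Ring R] {I : Type} {P : I → Type}
  [∀ i, AddCommGroup (P i)] [∀ i, Module R (P i)] {τ : I → I}
  {α : ∀ i, P (τ i) →ₗ[R] P i}

/-- The uniserial module of length `w.2` with top that of `P w.1`. -/
abbrev serialQuot (α : ∀ i, P (τ i) →ₗ[R] P i) (w : I × ℕ) : ModuleCat.{0} R :=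
  ModuleCat.of R (P w.1 ⧸ serialRad α w.2 w.1)

lemma subsingleton_serialQuot (i : I) : Subsingleton (serialQuot α (i, 0)) :=
  Submodule.Quotient.subsingleton_iff.2 rfl

/-- The effect of the syzygy on the pairs (top, length), given the lengths of the projectives. -/
def serialSyz (τ : I → I) (c : I → ℕ) (w : I × ℕ) : I × ℕ :=
  if w.2 = 0 then w else (τ^[w.2] w.1, c w.1 - w.2)

namespace IsSerialDatum

variable (D : IsSerialDatum R P τ α)

include D

lemma range_eq_top_of_not_le {M : Type} [AddCommGroup M] [Module R M] {i : I}
    (f : M →ₗ[R] P i) (h : ¬ LinearMap.range f ≤ LinearMap.range (α i)) :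
    LinearMap.range f = ⊤ := by
  by_contra hne
  exact h (D.le_range i _ hne)

lemma serialRad_ne_top {i : I} {l : ℕ} (hl : l ≠ 0) : serialRad α l i ≠ ⊤ := by
  intro h
  refine D.range_ne_top i (top_le_iff.1 ?_)
  rw [← h, ← serialRad_one]
  exact serialRad_antitone i (Nat.one_le_iff_ne_zero.2 hl)

lemma serialRad_le_range {i : I} {l : ℕ} (hl : l ≠ 0) :
    serialRad α l i ≤ LinearMap.range (α i) :=
  D.le_range i _ (D.serialRad_ne_top hl)

lemma finite (i : I) : Module.Finite R (P i) := by
  have := D.isNoetherian i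
  infer_instance

/-- Nonzero uniserial quotients are local. -/
lemma le_of_ne_top {w : I × ℕ} (N : Submodule R (serialQuot α w)) (hN : N ≠ ⊤) :
    N ≤ (LinearMap.range (α w.1)).map (serialRad α w.2 w.1).mkQ := by
  have h : N.comap (serialRad α w.2 w.1).mkQ ≠ ⊤ := fun h => hN (by
    rw [← Submodule.map_comap_eq_of_surjective (Submodule.mkQ_surjective _) N, h,
      Submodule.map_top, Submodule.range_mkQ])
  rw [← Submodule.map_comap_eq_of_surjective (Submodule.mkQ_surjective _) N]
  exact Submodule.map_mono (D.le_range _ _ h)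

lemma map_mkQ_ne_top {w : I × ℕ} (hw : w.2 ≠ 0) :
    (LinearMap.range (α w.1)).map (serialRad α w.2 w.1).mkQ ≠ ⊤ := by
  intro h
  have h1 := congrArg (Submodule.comap (serialRad α w.2 w.1).mkQ) h
  rw [Submodule.comap_map_mkQ, Submodule.comap_top, sup_eq_right.2 (D.serialRad_le_range hw)] at h1
  exact D.range_ne_top _ h1

lemma nontrivial_serialQuot {w : I × ℕ} (hw : w.2 ≠ 0) : Nontrivial (serialQuot α w) :=
  Submodule.Quotient.nontrivial_iff.2 (D.serialRad_ne_top hw)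

lemma uniserial_serialQuot (w : I × ℕ) : IsUniserialModule R (serialQuot α w) := by
  intro N K
  rw [← Submodule.map_comap_eq_of_surjective (Submodule.mkQ_surjective _) N,
    ← Submodule.map_comap_eq_of_surjective (Submodule.mkQ_surjective _) K]
  exact (D.le_total _ _).imp (fun h => Submodule.map_mono h) fun h => Submodule.map_mono h

lemma isNoetherian_serialQuot (w : I × ℕ) : IsNoetherian R (serialQuot α w) := by
  have := D.isNoetherian w.1
  exact isNoetherian_of_surjective (f := (serialRad α w.2 w.1).mkQ) (Submodule.range_mkQ _)

lemma finite_serialQuot (w : I × ℕ) : Module.Finite R (serialQuot α w) := by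
  have := D.isNoetherian_serialQuot w
  infer_instance

lemma indecomposable_serialQuot {w : I × ℕ} (hw : w.2 ≠ 0) :
    IndecomposableModule R (serialQuot α w) := by
  refine ⟨D.nontrivial_serialQuot hw, fun N N' h => ?_⟩
  rcases D.uniserial_serialQuot w N N' with hle | hle
  · exact Or.inl (le_bot_iff.1 (h.disjoint le_rfl hle))
  · right
    have := h.sup_eq_top
    rwa [sup_eq_left.2 hle] at this

/-- The pair (top, length) is determined by the isomorphism class. -/
lemma eq_of_equiv {w w' : I × ℕ} (hw : w.2 ≤ D.length w.1) (hw' : w'.2 ≤ D.length w'.1)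
    (hw'0 : w'.2 ≠ 0) (e : serialQuot α w ≃ₗ[R] serialQuot α w') : w = w' := by
  obtain ⟨i, l⟩ := w
  obtain ⟨j, m⟩ := w'
  have := D.projective i
  obtain ⟨f, hf⟩ := Module.projective_lifting_property (serialRad α m j).mkQ
    (e.toLinearMap ∘ₗ (serialRad α l i).mkQ) (Submodule.mkQ_surjective _)
  have hf' : ∀ x, (serialRad α m j).mkQ (f x) = e ((serialRad α l i).mkQ x) :=
    fun x => LinearMap.congr_fun hf x
  have hsurj : LinearMap.range f = ⊤ := by
    refine D.range_eq_top_of_not_le f fun hle => D.range_ne_top j (top_le_iff.1 fun y _ => ?_)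
    obtain ⟨x, hx⟩ := Submodule.mkQ_surjective _ (e.symm ((serialRad α m j).mkQ y))
    have h1 : (serialRad α m j).mkQ (y - f x) = 0 := by
      rw [map_sub, hf', hx, e.apply_symm_apply, sub_self]
    have h2 : y - f x ∈ serialRad α m j := (Submodule.Quotient.mk_eq_zero _).1 h1
    simpa using add_mem (D.serialRad_le_range hw'0 h2) (hle ⟨x, rfl⟩)
  obtain rfl := D.eq_of_surjective i j f (LinearMap.range_eq_top.1 hsurj)
  have hcomap : (serialRad α m i).comap f = serialRad α l i := by
    ext x
    have h1 : (serialRad α m i).mkQ (f x) = 0 ↔ (serialRad α l i).mkQ x = 0 := by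
      rw [hf', LinearEquiv.map_eq_zero_iff]
    simpa using h1
  have hmap := D.map_serialRad f (e := 0) hsurj l
  rw [← hcomap, Submodule.map_comap_eq_of_surjective (LinearMap.range_eq_top.1 hsurj),
    zero_add] at hmap
  exact Prod.ext rfl (D.serialRad_inj hw' hw hmap).symm

lemma serialSyz_mem (w : I × ℕ) (hw : w.2 ≤ D.length w.1) :
    (serialSyz τ D.length w).2 ≤ D.length (serialSyz τ D.length w).1 := by
  unfold serialSyz
  split_ifs
  · exact hw
  · exact D.length_iterate _ _

lemma isSyzygyOf_serialQuot (w : I × ℕ) (hw : w.2 ≤ D.length w.1) :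
    IsSyzygyOf R (serialQuot α (serialSyz τ D.length w)) (serialQuot α w) := by
  unfold serialSyz
  obtain ⟨i, l⟩ := w
  split_ifs with h0
  · change l = 0 at h0
    subst h0
    have := subsingleton_serialQuot (α := α) i
    have hsub : Subsingleton (LinearMap.ker (LinearMap.id : serialQuot α (i, 0) →ₗ[R] _)) :=
      inferInstance
    refine ⟨serialQuot α (i, 0), LinearMap.id, ?_, D.finite_serialQuot _, surjective_id, ?_, ⟨?_⟩⟩
    · infer_instance
    · intro K _
      exact Subsingleton.elim _ _
    · exact LinearEquiv.ofSubsingleton _ _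
  · obtain ⟨f, hf⟩ := D.exists_range_eq l i
    refine ⟨ModuleCat.of R (P i), (serialRad α l i).mkQ, D.projective i, D.finite i,
      Submodule.mkQ_surjective _, ?_, ⟨?_⟩⟩
    · intro K hK
      by_contra hne
      rw [Submodule.ker_mkQ] at hK
      exact D.range_ne_top i
        (top_le_iff.1 (hK.ge.trans (sup_le (D.serialRad_le_range h0) (D.le_range i K hne))))
    · refine (Submodule.quotEquivOfEq _ _ (D.ker_eq_serialRad f hw hf).1.symm).trans
        (f.quotKerEquivRange.trans (LinearEquiv.ofEq _ _ ?_))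
      rw [hf, Submodule.ker_mkQ]

lemma exists_top (M : Type) [AddCommGroup M] [Module R M] [Nontrivial M] :
    ∃ (i : I) (f : P i →ₗ[R] M), f ≠ 0 := by
  obtain ⟨i, f, hf⟩ := D.generates M ⊥ bot_ne_top
  exact ⟨i, f, fun h => hf (by rw [h, LinearMap.range_zero])⟩

/-- The simple modules are the tops of the `P i`. -/
lemma exists_equiv_of_isSimpleModule (S : Type) [AddCommGroup S] [Module R S]
    [IsSimpleModule R S] : ∃ i, Nonempty (S ≃ₗ[R] serialQuot α (i, 1)) := by
  have := IsSimpleModule.nontrivial R S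
  obtain ⟨i, f, hf⟩ := D.exists_top S
  have hsurj : Surjective f := LinearMap.surjective_of_ne_zero hf
  have e := f.quotKerEquivOfSurjective hsurj
  have hco : IsCoatom (LinearMap.ker f) := by
    rw [← isSimpleModule_iff_isCoatom]
    exact IsSimpleModule.congr e
  have hker : LinearMap.ker f = serialRad α 1 i := by
    rw [serialRad_one]
    exact ((hco.le_iff.1 (D.ker_le_range hf)).resolve_left (D.range_ne_top i)).symm
  exact ⟨i, ⟨e.symm.trans (Submodule.quotEquivOfEq _ _ hker)⟩⟩

lemma isSimpleModule_serialQuot (i : I) : IsSimpleModule R (serialQuot α (i, 1)) := by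
  rw [isSimpleModule_iff_isCoatom]
  change IsCoatom (serialRad α 1 i)
  rw [serialRad_one]
  refine ⟨D.range_ne_top i, fun N hN => ?_⟩
  by_contra hne
  exact hN.not_ge (D.le_range i N hne)

lemma exists_finset_sup_eq_top :
    ∃ s : Finset (Σ i, P i →ₗ[R] R), ⨆ x : s, LinearMap.range x.1.2 = ⊤ := by
  have htop : ⨆ x : (Σ i, P i →ₗ[R] R), LinearMap.range x.2 = ⊤ := by
    by_contra hne
    obtain ⟨i, f, hf⟩ := D.generates R _ hne
    exact hf (le_iSup (fun x : (Σ i, P i →ₗ[R] R) => LinearMap.range x.2) ⟨i, f⟩)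
  have h1 : (1 : R) ∈ ⨆ x : (Σ i, P i →ₗ[R] R), LinearMap.range x.2 := htop ▸ Submodule.mem_top
  obtain ⟨s, hs⟩ := Submodule.mem_iSup_iff_exists_finset.1 h1
  refine ⟨s, ?_⟩
  rw [← (Ideal.eq_top_iff_one _).2 hs, iSup_subtype]

lemma isNoetherianRing : IsNoetherianRing R := by
  obtain ⟨s, hs⟩ := D.exists_finset_sup_eq_top
  have := fun i => D.isNoetherian i
  rw [isNoetherianRing_iff, ← isNoetherian_top_iff, ← hs]
  have : ∀ x : s, IsNoetherian R (LinearMap.range x.1.2) := fun x => inferInstance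
  infer_instance

lemma isArtinianRing : IsArtinianRing R := by
  obtain ⟨s, hs⟩ := D.exists_finset_sup_eq_top
  have := fun i => D.artinian i
  have : ∀ x : s, IsArtinian R (LinearMap.range x.1.2) := fun x => inferInstance
  have h : IsArtinian R (⊤ : Submodule R R) := hs ▸ inferInstance
  exact isArtinian_of_linearEquiv (Submodule.topEquiv (R := R) (M := R))

/-- A uniserial submodule of maximal length splits off. -/
lemma exists_retraction {M : Type} [AddCommGroup M] [Module R M] [IsNoetherian R M] {i : I}
    (f : P i →ₗ[R] M) {l : ℕ} (hl : l ≤ D.length i) (hf : LinearMap.ker f = serialRad α l i)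
    (hmax : ∀ (j : I) (g : P j →ₗ[R] M) (m : ℕ), m ≤ D.length j →
      LinearMap.ker g = serialRad α m j → m ≤ l) :
    ∃ r : M →ₗ[R] (P i ⧸ serialRad α l i), r ∘ₗ f = (serialRad α l i).mkQ := by
  let good : Set (Submodule R M) := {N | LinearMap.range f ≤ N ∧
    ∃ r : N →ₗ[R] (P i ⧸ serialRad α l i), ∀ (x : P i) (h : f x ∈ N),
      r ⟨f x, h⟩ = (serialRad α l i).mkQ x}
  have hgood : good.Nonempty := by
    refine ⟨LinearMap.range f, le_rfl,
      (Submodule.quotEquivOfEq _ _ hf).toLinearMap ∘ₗ f.quotKerEquivRange.symm.toLinearMap, ?_⟩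
    intro x h
    have : f.quotKerEquivRange.symm ⟨f x, h⟩ = (LinearMap.ker f).mkQ x := by
      rw [LinearEquiv.symm_apply_eq]
      rfl
    simp only [LinearMap.comp_apply, LinearEquiv.coe_coe, this]
    rfl
  obtain ⟨N, ⟨hfN, r, hr⟩, hNmax⟩ :=
    set_has_maximal_iff_noetherian.2 (inferInstance : IsNoetherian R M) good hgood
  by_cases hN : N = ⊤
  · subst hN
    exact ⟨r ∘ₗ (Submodule.topEquiv (R := R) (M := M)).symm.toLinearMap,
      LinearMap.ext fun x => hr x trivial⟩
  exfalso
  obtain ⟨a, g, hg⟩ := D.generates M N hN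
  obtain ⟨d, hd, hde⟩ := D.exists_eq_serialRad (N.comap g)
  obtain ⟨b, hb, hbe⟩ := D.exists_eq_serialRad (LinearMap.ker g)
  have hbl : b ≤ l := hmax a g b hb hbe
  have hdb : d ≤ b := by
    rw [← D.serialRad_le_iff hd, ← hde, ← hbe]
    exact LinearMap.ker_le_comap g
  obtain ⟨fd, hfd, hfac⟩ := D.exists_cover d a
  have hmem : ∀ y, g (fd y) ∈ N := by
    intro y
    have : fd y ∈ N.comap g := by rw [hde, ← hfd]; exact ⟨y, rfl⟩
    exact this
  have := D.projective (τ^[d] a)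
  obtain ⟨t, ht⟩ := Module.projective_lifting_property (serialRad α l i).mkQ
    (r ∘ₗ (g ∘ₗ fd).codRestrict N hmem) (Submodule.mkQ_surjective _)
  have ht' : ∀ y, (serialRad α l i).mkQ (t y) = r ⟨g (fd y), hmem y⟩ :=
    fun y => LinearMap.congr_fun ht y
  obtain ⟨e, he, hee⟩ := D.exists_eq_serialRad (LinearMap.range t)
  have hrange : serialRad α (e + (b - d)) i ≤ serialRad α l i := by
    rw [← D.map_serialRad t hee]
    rintro _ ⟨y, hy, rfl⟩
    have h1 : fd y ∈ LinearMap.ker g := by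
      rw [hbe, show b = d + (b - d) by omega, ← D.map_serialRad fd hfd]
      exact ⟨y, hy, rfl⟩
    have h2 : (serialRad α l i).mkQ (t y) = 0 := by
      rw [ht', ← map_zero r]
      exact congrArg r (Subtype.ext h1)
    simpa using h2
  rw [D.serialRad_le_iff hl] at hrange
  obtain ⟨h, hh⟩ := hfac i t (by rw [hee]; exact serialRad_antitone i (by omega))
  let Φ : N × P a →ₗ[R] M := N.subtype.coprod g
  let Ψ : N × P a →ₗ[R] (P i ⧸ serialRad α l i) := r.coprod ((serialRad α l i).mkQ ∘ₗ h)
  have hker : LinearMap.ker Φ ≤ LinearMap.ker Ψ := by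
    rintro ⟨n, x⟩ hnx
    have hnx' : (n : M) + g x = 0 := hnx
    have hgx : g x = -(n : M) := by rw [eq_neg_iff_add_eq_zero, add_comm, hnx']
    have hx : x ∈ LinearMap.range fd := by
      rw [hfd, ← hde]
      change g x ∈ N
      rw [hgx]
      exact N.neg_mem n.2
    obtain ⟨y, rfl⟩ := hx
    change r n + (serialRad α l i).mkQ (h (fd y)) = 0
    have h1 : h (fd y) = t y := LinearMap.congr_fun hh y
    rw [h1, ht', ← map_add, ← map_zero r]
    exact congrArg r (Subtype.ext hnx')
  have hNle : N ≤ LinearMap.range Φ := fun n hn => ⟨(⟨n, hn⟩, 0), by simp [Φ]⟩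
  refine hNmax (LinearMap.range Φ) ⟨hfN.trans hNle,
    (LinearMap.ker Φ).liftQ Ψ hker ∘ₗ Φ.quotKerEquivRange.symm.toLinearMap, ?_⟩ ?_
  · intro x hx
    have hxN : f x ∈ N := hfN ⟨x, rfl⟩
    have : Φ.quotKerEquivRange.symm ⟨f x, hx⟩ = (LinearMap.ker Φ).mkQ (⟨f x, hxN⟩, 0) := by
      rw [LinearEquiv.symm_apply_eq]
      apply Subtype.ext
      change f x = f x + g 0
      rw [map_zero, add_zero]
    simp only [LinearMap.comp_apply, LinearEquiv.coe_coe, this]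
    change r ⟨f x, hxN⟩ + (serialRad α l i).mkQ (h 0) = _
    rw [map_zero, map_zero, add_zero, hr]
  · refine lt_of_le_of_ne hNle fun heq => hg ?_
    rw [heq]
    rintro _ ⟨x, rfl⟩
    exact ⟨(0, x), by simp [Φ]⟩

/-- A nonzero noetherian module has a nonzero uniserial direct summand. -/
lemma exists_summand [Finite I] (M : Type) [AddCommGroup M] [Module R M] [IsNoetherian R M]
    [Nontrivial M] : ∃ (w : I × ℕ) (C : Submodule R M), w.2 ≠ 0 ∧ w.2 ≤ D.length w.1 ∧ C ≠ ⊤ ∧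
      Nonempty (M ≃ₗ[R] (serialQuot α w × C)) := by
  let L : Set ℕ := {m | ∃ (j : I) (g : P j →ₗ[R] M), m ≤ D.length j ∧
    LinearMap.ker g = serialRad α m j}
  have hfin : L.Finite := by
    refine (Set.finite_range fun x : Σ j, Fin (D.length j + 1) => (x.2 : ℕ)).subset ?_
    rintro m ⟨j, g, hm, -⟩
    exact ⟨⟨j, ⟨m, by omega⟩⟩, rfl⟩
  have hpos : ∃ m ∈ L, m ≠ 0 := by
    obtain ⟨i, f, hf⟩ := D.exists_top M
    obtain ⟨m, hm, hme⟩ := D.exists_eq_serialRad (LinearMap.ker f)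
    refine ⟨m, ⟨i, f, hm, hme⟩, ?_⟩
    rintro rfl
    exact hf (LinearMap.ker_eq_top.1 hme)
  obtain ⟨m, hmL, hm0⟩ := hpos
  obtain ⟨l, ⟨i, f, hl, hf⟩, hmax⟩ := hfin.exists_maximal ⟨m, hmL⟩
  have hmax' : ∀ m' ∈ L, m' ≤ l := fun m' hm' => by
    by_contra! hlt
    exact hlt.not_ge (hmax hm' hlt.le)
  have hl0 : l ≠ 0 := by
    have := hmax' m hmL
    omega
  obtain ⟨r, hr⟩ := D.exists_retraction f hl hf
    fun j g m' hm' hg => hmax' m' ⟨j, g, hm', hg⟩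
  have hnt := D.nontrivial_serialQuot (w := (i, l)) hl0
  have hrs : Surjective r := by
    intro y
    obtain ⟨x, rfl⟩ := Submodule.mkQ_surjective _ y
    exact ⟨f x, LinearMap.congr_fun hr x⟩
  let s : (P i ⧸ serialRad α l i) →ₗ[R] M := (serialRad α l i).liftQ f hf.ge
  have hrs' : r ∘ₗ s = LinearMap.id := by
    apply Submodule.linearMap_qext
    rw [LinearMap.comp_assoc, Submodule.liftQ_mkQ, hr, LinearMap.id_comp]
  refine ⟨(i, l), LinearMap.ker r, hl0, hl, fun h => ?_, nonempty_equiv_prod_ker s r hrs'⟩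
  obtain ⟨y, hy⟩ := exists_ne (0 : P i ⧸ serialRad α l i)
  obtain ⟨x, rfl⟩ := hrs y
  exact hy (by rw [LinearMap.ker_eq_top.1 h, LinearMap.zero_apply])

end IsSerialDatum
end SerialModules

section Delooping

variable {R : Type} [Ring R] {I : Type} {P : I → Type}
  [∀ i, AddCommGroup (P i)] [∀ i, Module R (P i)] {τ : I → I}
  {α : ∀ i, P (τ i) →ₗ[R] P i}

/-- The combinatorial form of the condition that `Ω^d S_i` is a summand of
`A ⊕ Ω^(d+1) M'` for some `M'`. -/
def SerialDeloops (τ : I → I) (c : I → ℕ) (i : I) (d : ℕ) : Prop :=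
  ((serialSyz τ c)^[d] (i, 1)).2 = 0 ∨
  ((serialSyz τ c)^[d] (i, 1)).2 = c ((serialSyz τ c)^[d] (i, 1)).1 ∨
  ∃ w : I × ℕ, w.2 ≤ c w.1 ∧ (serialSyz τ c)^[d + 1] w = (serialSyz τ c)^[d] (i, 1)

lemma SerialDeloops.succ {c : I → ℕ} {i : I} {d : ℕ} (h : SerialDeloops τ c i d) :
    SerialDeloops τ c i (d + 1) := by
  unfold SerialDeloops at h ⊢
  rw [iterate_succ_apply']
  rcases h with h | h | ⟨w, hw, h⟩
  · left
    simp [serialSyz, h]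
  · left
    unfold serialSyz
    split_ifs with h0
    · exact h0
    · exact Nat.sub_eq_zero_of_le h.ge
  · exact Or.inr (Or.inr ⟨w, hw, by rw [iterate_succ_apply', h]⟩)

lemma SerialDeloops.mono {c : I → ℕ} {i : I} {d d' : ℕ} (h : SerialDeloops τ c i d)
    (hd : d ≤ d') : SerialDeloops τ c i d' := by
  induction hd with
  | refl => exact h
  | step _ ih => exact ih.succ

namespace IsSerialDatum

variable (D : IsSerialDatum R P τ α)

include D

/-- Every finitely generated module is a finite direct sum of uniserial quotients of the
`P i`. -/
lemma exists_decomposition [Finite I] (M : Type) [AddCommGroup M] [Module R M]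
    [Module.Finite R M] : ∃ (κ : Type) (_ : Fintype κ) (w : κ → I × ℕ),
      (∀ k, (w k).2 ≠ 0) ∧ (∀ k, (w k).2 ≤ D.length (w k).1) ∧
      Nonempty (M ≃ₗ[R] ∀ k, serialQuot α (w k)) := by
  have := D.isNoetherianRing
  have := D.isArtinianRing
  suffices h : ∀ N : Submodule R M, ∃ (κ : Type) (_ : Fintype κ) (w : κ → I × ℕ),
      (∀ k, (w k).2 ≠ 0) ∧ (∀ k, (w k).2 ≤ D.length (w k).1) ∧
      Nonempty (N ≃ₗ[R] ∀ k, serialQuot α (w k)) by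
    obtain ⟨κ, hκ, w, h0, hw, ⟨e⟩⟩ := h ⊤
    exact ⟨κ, hκ, w, h0, hw, ⟨Submodule.topEquiv.symm.trans e⟩⟩
  intro N
  induction N using WellFoundedLT.induction with
  | ind N ih =>
    rcases subsingleton_or_nontrivial N with hN | hN
    · exact ⟨Empty, inferInstance, Empty.elim, fun k => k.elim, fun k => k.elim,
        ⟨LinearEquiv.ofSubsingleton _ _⟩⟩
    obtain ⟨w₀, C, h0, hw₀, hC, ⟨e⟩⟩ := D.exists_summand N
    have hlt : C.map N.subtype < N := by
      refine lt_of_le_of_ne (Submodule.map_subtype_le N C) fun heq => hC ?_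
      have h1 := congrArg (Submodule.comap N.subtype) heq
      rwa [Submodule.comap_map_eq_of_injective N.injective_subtype, Submodule.comap_subtype_self]
        at h1
    obtain ⟨κ, hκ, w, hw0, hw, ⟨e'⟩⟩ := ih _ hlt
    refine ⟨Option κ, inferInstance, fun o => o.elim w₀ w, ?_, ?_, ⟨?_⟩⟩
    · rintro (_ | k)
      exacts [h0, hw0 k]
    · rintro (_ | k)
      exacts [hw₀, hw k]
    · exact (e.trans (LinearEquiv.prodCongr (LinearEquiv.refl R (serialQuot α w₀))
        ((N.equivSubtypeMap C).trans e'))).trans (LinearEquiv.piOptionEquivProd R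
        (M := fun o : Option κ => serialQuot α (o.elim w₀ w))).symm

/-- Endomorphisms of a nonzero uniserial quotient adding up to the identity cannot all be
non-surjective. -/
lemma exists_surjective_of_sum_eq_id {w : I × ℕ} (hw : w.2 ≠ 0) {κ : Type} [Fintype κ]
    (φ : κ → (serialQuot α w →ₗ[R] serialQuot α w)) (h : ∑ k, φ k = LinearMap.id) :
    ∃ k, Surjective (φ k) := by
  by_contra! hne
  refine D.map_mkQ_ne_top hw (top_le_iff.1 fun x _ => ?_)
  have hx : x = ∑ k, φ k x := by
    rw [← LinearMap.sum_apply, h, LinearMap.id_apply]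
  rw [hx]
  exact Submodule.sum_mem _ fun k _ =>
    D.le_of_ne_top _ (fun h => hne k (LinearMap.range_eq_top.1 h)) ⟨x, rfl⟩

lemma bijective_of_surjective {w : I × ℕ} {φ : serialQuot α w →ₗ[R] serialQuot α w}
    (h : Surjective φ) : Bijective φ := by
  have := D.isNoetherian_serialQuot w
  exact IsNoetherian.bijective_of_surjective_endomorphism φ h

lemma eq_of_retract {x y : I × ℕ} (hx0 : x.2 ≠ 0) (hx : x.2 ≤ D.length x.1)
    (hy : y.2 ≤ D.length y.1) (q : serialQuot α x →ₗ[R] serialQuot α y)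
    (p : serialQuot α y →ₗ[R] serialQuot α x) (h : Surjective (p ∘ₗ q)) : y = x := by
  have hb := D.bijective_of_surjective h
  have hp : Injective p := by
    rw [injective_iff_map_eq_zero]
    intro z hz
    rcases D.uniserial_serialQuot y (LinearMap.ker p) (LinearMap.range q) with hle | hle
    · obtain ⟨u, rfl⟩ := hle hz
      have hu : u = 0 := hb.1 (by rw [map_zero]; exact hz)
      rw [hu, map_zero]
    · exfalso
      have := D.nontrivial_serialQuot hx0
      obtain ⟨v, hv⟩ := exists_ne (0 : serialQuot α x)
      obtain ⟨u, rfl⟩ := h v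
      exact hv (hle ⟨u, rfl⟩)
  exact D.eq_of_equiv hy hx hx0 (LinearEquiv.ofBijective p ⟨hp, Surjective.of_comp h⟩)

lemma length_of_projective {x : I × ℕ} (hx0 : x.2 ≠ 0) (hx : x.2 ≤ D.length x.1)
    (h : Module.Projective R (serialQuot α x)) : x.2 = D.length x.1 := by
  obtain ⟨s, hs⟩ := Module.projective_lifting_property (serialRad α x.2 x.1).mkQ
    (LinearMap.id : serialQuot α x →ₗ[R] serialQuot α x) (Submodule.mkQ_surjective _)
  have hs' : ∀ y, (serialRad α x.2 x.1).mkQ (s y) = y := fun y => LinearMap.congr_fun hs y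
  have htop : LinearMap.range s = ⊤ := by
    refine D.range_eq_top_of_not_le s fun hle =>
      D.range_ne_top x.1 (top_le_iff.1 fun y _ => ?_)
    have h2 : y - s ((serialRad α x.2 x.1).mkQ y) ∈ serialRad α x.2 x.1 := by
      refine (Submodule.Quotient.mk_eq_zero _).1 ?_
      change (serialRad α x.2 x.1).mkQ _ = 0
      rw [map_sub, hs', sub_self]
    simpa using add_mem (D.serialRad_le_range hx0 h2) (hle ⟨(serialRad α x.2 x.1).mkQ y, rfl⟩)
  refine le_antisymm hx (D.serialRad_eq_bot_iff.1 (eq_bot_iff.2 fun y hy => ?_))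
  obtain ⟨z, rfl⟩ := LinearMap.range_eq_top.1 htop y
  have hz : z = 0 := by
    rw [← hs' z]
    exact (Submodule.Quotient.mk_eq_zero _).2 hy
  rw [hz, map_zero]
  exact zero_mem _

lemma exists_retract_ring (i : I) :
    ∃ (g : P i →ₗ[R] R) (f : R →ₗ[R] P i), f ∘ₗ g = LinearMap.id := by
  obtain ⟨x, hx⟩ : ∃ x, x ∉ LinearMap.range (α i) := by
    by_contra! hall
    exact D.range_ne_top i (top_le_iff.1 fun x _ => hall x)
  have hsurj : LinearMap.range (LinearMap.toSpanSingleton R (P i) x) = ⊤ :=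
    D.range_eq_top_of_not_le _ fun hle => hx (hle ⟨1, by simp⟩)
  have := D.projective i
  obtain ⟨g, hg⟩ := Module.projective_lifting_property (LinearMap.toSpanSingleton R (P i) x)
    LinearMap.id (LinearMap.range_eq_top.1 hsurj)
  exact ⟨g, _, hg⟩

lemma isNthSyzygyOf_iff {κ : Type} [Fintype κ] (w : κ → I × ℕ)
    (hw : ∀ k, (w k).2 ≤ D.length (w k).1) {M N : ModuleCat.{0} R}
    (e : M ≃ₗ[R] ∀ k, serialQuot α (w k)) (d : ℕ) :
    IsNthSyzygyOf R d N M ↔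
      Nonempty (N ≃ₗ[R] ∀ k, serialQuot α ((serialSyz τ D.length)^[d] (w k))) :=
  isNthSyzygyOf_iff_of_iterate (serialQuot α) (serialSyz τ D.length)
    {w | w.2 ≤ D.length w.1} D.serialSyz_mem D.isSyzygyOf_serialQuot w hw e d

lemma isNthSyzygyOf_iff_single {w : I × ℕ} (hw : w.2 ≤ D.length w.1) {M N : ModuleCat.{0} R}
    (e : M ≃ₗ[R] serialQuot α w) (d : ℕ) :
    IsNthSyzygyOf R d N M ↔
      Nonempty (N ≃ₗ[R] serialQuot α ((serialSyz τ D.length)^[d] w)) := by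
  rw [D.isNthSyzygyOf_iff (fun _ : Unit => w) (fun _ => hw)
    (e.trans (LinearEquiv.funUnique Unit R (serialQuot α w)).symm)]
  have e' := LinearEquiv.funUnique Unit R (serialQuot α ((serialSyz τ D.length)^[d] w))
  exact ⟨fun h => h.elim fun e => ⟨e.trans e'⟩, fun h => h.elim fun e => ⟨e.trans e'.symm⟩⟩

lemma iterate_serialSyz_mem {w : I × ℕ} (hw : w.2 ≤ D.length w.1) (d : ℕ) :
    ((serialSyz τ D.length)^[d] w).2 ≤ D.length ((serialSyz τ D.length)^[d] w).1 := by
  induction d with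
  | zero => exact hw
  | succ d ih => rw [iterate_succ_apply']; exact D.serialSyz_mem _ ih

/-- The delooping condition for the simple module `S_i` is the combinatorial one. -/
lemma deloops_iff [Finite I] {S : ModuleCat.{0} R} {i : I}
    (e : S ≃ₗ[R] serialQuot α (i, 1)) (d : ℕ) :
    (∃ (M' N N' : ModuleCat.{0} R), Module.Finite R ↥M' ∧
      IsNthSyzygyOf R d N S ∧ IsNthSyzygyOf R (d + 1) N' M' ∧
      IsDirectSummandOf R N (ModuleCat.of R (R × ↥N'))) ↔ SerialDeloops τ D.length i d := by
  have hi : (i, 1).2 ≤ D.length (i, 1).1 := D.length_pos i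
  unfold SerialDeloops
  set x := (serialSyz τ D.length)^[d] (i, 1) with hxdef
  have hx : x.2 ≤ D.length x.1 := D.iterate_serialSyz_mem hi d
  constructor
  · rintro ⟨M', N, N', hM', hN, hN', hsum⟩
    by_cases hx0 : x.2 = 0
    · exact Or.inl hx0
    right
    obtain ⟨κ, _, w, -, hw, ⟨eM⟩⟩ := D.exists_decomposition M'
    obtain ⟨eN⟩ := (D.isNthSyzygyOf_iff_single hi e d).1 hN
    obtain ⟨eN'⟩ := (D.isNthSyzygyOf_iff w hw eM (d + 1)).1 hN'
    set y := fun k => (serialSyz τ D.length)^[d + 1] (w k) with hy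
    obtain ⟨g, f, hfg⟩ := hsum.exists_retract
    let g' : serialQuot α x →ₗ[R] R × N' := g ∘ₗ eN.symm.toLinearMap
    let f' : R × N' →ₗ[R] serialQuot α x := eN.toLinearMap ∘ₗ f
    let q : ∀ k, serialQuot α x →ₗ[R] serialQuot α (y k) := fun k =>
      LinearMap.proj k ∘ₗ eN'.toLinearMap ∘ₗ LinearMap.snd R R N' ∘ₗ g'
    let p : ∀ k, serialQuot α (y k) →ₗ[R] serialQuot α x := fun k =>
      f' ∘ₗ LinearMap.inr R R N' ∘ₗ eN'.symm.toLinearMap ∘ₗ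
        LinearMap.single R (fun k => serialQuot α (y k)) k
    let φ : Option κ → (serialQuot α x →ₗ[R] serialQuot α x) := fun o =>
      o.elim ((f' ∘ₗ LinearMap.inl R R N') ∘ₗ (LinearMap.fst R R N' ∘ₗ g')) fun k => p k ∘ₗ q k
    have hsum : ∑ o, φ o = LinearMap.id := by
      refine LinearMap.ext fun u => ?_
      rw [LinearMap.sum_apply, Fintype.sum_option]
      have h1 : ∑ k, φ (some k) u = f' (0, (g' u).2) := by
        have h2 : (g' u).2 = ∑ k, eN'.symm (Pi.single k (eN' (g' u).2 k)) := by
          rw [← map_sum, Finset.univ_sum_single, LinearEquiv.symm_apply_apply]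
        have h3 : ((0, (g' u).2) : R × N') =
            ∑ k, LinearMap.inr R R N' (eN'.symm (Pi.single k (eN' (g' u).2 k))) := by
          rw [← map_sum, ← h2]; rfl
        rw [h3, map_sum]
        rfl
      rw [h1]
      change f' ((g' u).1, 0) + f' (0, (g' u).2) = u
      rw [← map_add, Prod.mk_add_mk, add_zero, zero_add]
      change eN (f (g (eN.symm u))) = u
      rw [← LinearMap.comp_apply, hfg, LinearMap.id_apply, LinearEquiv.apply_symm_apply]
    obtain ⟨o, ho⟩ := D.exists_surjective_of_sum_eq_id hx0 φ hsum
    rcases o with _ | k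
    · left
      refine D.length_of_projective hx0 hx ?_
      let eφ := LinearEquiv.ofBijective (φ none) (D.bijective_of_surjective ho)
      refine Module.Projective.of_split (M := R) ((LinearMap.fst R R N' ∘ₗ g') ∘ₗ
        eφ.symm.toLinearMap) (f' ∘ₗ LinearMap.inl R R N') ?_
      refine LinearMap.ext fun u => ?_
      exact eφ.apply_symm_apply u
    · right
      exact ⟨w k, hw k, D.eq_of_retract hx0 hx (D.iterate_serialSyz_mem (hw k) (d + 1))
        (q k) (p k) ho⟩
  · intro h
    have hN : IsNthSyzygyOf R d (serialQuot α x) S :=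
      (D.isNthSyzygyOf_iff_single hi e d).2 ⟨LinearEquiv.refl R _⟩
    have key : ∀ w : I × ℕ, w.2 ≤ D.length w.1 →
        (∃ (g : serialQuot α x →ₗ[R] R × serialQuot α ((serialSyz τ D.length)^[d + 1] w))
          (f : R × serialQuot α ((serialSyz τ D.length)^[d + 1] w) →ₗ[R] serialQuot α x),
          f ∘ₗ g = LinearMap.id) → ∃ (M' N N' : ModuleCat.{0} R), Module.Finite R ↥M' ∧
            IsNthSyzygyOf R d N S ∧ IsNthSyzygyOf R (d + 1) N' M' ∧
            IsDirectSummandOf R N (ModuleCat.of R (R × ↥N')) := by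
      rintro w hw ⟨g, f, hfg⟩
      exact ⟨serialQuot α w, serialQuot α x,
        serialQuot α ((serialSyz τ D.length)^[d + 1] w), D.finite_serialQuot w, hN,
        (D.isNthSyzygyOf_iff_single hw (LinearEquiv.refl R _) (d + 1)).2 ⟨LinearEquiv.refl R _⟩,
        isDirectSummandOf_of_retract g f hfg⟩
    rcases h with h | h | ⟨w, hw, h⟩
    · refine key (i, 0) (Nat.zero_le _) ⟨0, 0, ?_⟩
      have : Subsingleton (serialQuot α x) := by
        have := subsingleton_serialQuot (α := α) x.1
        rwa [← h] at this
      exact LinearMap.ext fun _ => Subsingleton.elim _ _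
    · refine key (i, 0) (Nat.zero_le _) ?_
      obtain ⟨g, f, hfg⟩ := D.exists_retract_ring x.1
      have ex : serialQuot α x ≃ₗ[R] P x.1 :=
        Submodule.quotEquivOfEqBot _ (D.serialRad_eq_bot_iff.2 h.ge)
      refine ⟨LinearMap.inl R R _ ∘ₗ g ∘ₗ ex.toLinearMap,
        ex.symm.toLinearMap ∘ₗ f ∘ₗ LinearMap.fst R R _, ?_⟩
      refine LinearMap.ext fun u => ?_
      change ex.symm (f (g (ex u))) = u
      rw [← LinearMap.comp_apply f g, hfg, LinearMap.id_apply, LinearEquiv.symm_apply_apply]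
    · refine key w hw ?_
      rw [h]
      exact ⟨LinearMap.inr R R _, LinearMap.snd R R _, rfl⟩

lemma delMod_le_iff [Finite I] {S : ModuleCat.{0} R} {i : I}
    (e : S ≃ₗ[R] serialQuot α (i, 1)) (d : ℕ) :
    delMod R S ≤ d ↔ SerialDeloops τ D.length i d := by
  unfold delMod
  constructor
  · intro h
    have hne : ((fun n : ℕ => (n : ℕ∞)) '' {d : ℕ | ∃ (M' N N' : ModuleCat.{0} R),
        Module.Finite R ↥M' ∧ IsNthSyzygyOf R d N S ∧ IsNthSyzygyOf R (d + 1) N' M' ∧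
        IsDirectSummandOf R N (ModuleCat.of R (R × ↥N'))}).Nonempty := by
      by_contra hemp
      rw [Set.not_nonempty_iff_eq_empty.1 hemp, sInf_empty] at h
      exact (ENat.natCast_lt_top d).not_ge h
    obtain ⟨d', hd', hd'eq⟩ := csInf_mem hne
    rw [← hd'eq] at h
    exact ((D.deloops_iff e d').1 hd').mono (Nat.cast_le.1 h)
  · intro h
    exact sInf_le ⟨d, (D.deloops_iff e d).2 h, rfl⟩

/-- The delooping level of a ring with a serial datum is combinatorial. -/
theorem delAlg_le_iff [Finite I] (d : ℕ) :
    delAlg R ≤ d ↔ ∀ i, SerialDeloops τ D.length i d := by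
  unfold delAlg
  rw [sSup_le_iff]
  constructor
  · intro h i
    exact (D.delMod_le_iff (LinearEquiv.refl R _) d).1
      (h _ ⟨serialQuot α (i, 1), D.isSimpleModule_serialQuot i, rfl⟩)
  · rintro h _ ⟨S, hS, rfl⟩
    obtain ⟨i, ⟨e⟩⟩ := D.exists_equiv_of_isSimpleModule S
    exact (D.delMod_le_iff e d).2 (h i)

end IsSerialDatum
end Delooping

section Lines

/-- The even delooping condition for a map of the integers. -/
def EvenDeloops (p : ℤ → ℤ) (k : ℕ) : Prop :=
  ∀ a, p^[k] a = p^[k] (a + 1) ∨ ∃ b, p^[k + 1] b = p^[k] (a + 1)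

/-- The odd delooping condition for a map of the integers. -/
def OddDeloops (p : ℤ → ℤ) (k : ℕ) : Prop :=
  ∀ a, p^[k + 1] a = p^[k + 1] (a + 1) ∨ ∃ b, p^[k + 1] b = p^[k] (a + 1)

/-- The conjugate of a map of the integers by negation. -/
def negConj (p : ℤ → ℤ) (s : ℤ) : ℤ := -p (-s)

lemma negConj_negConj (p : ℤ → ℤ) : negConj (negConj p) = p := by
  ext s
  simp [negConj]

lemma iterate_negConj (p : ℤ → ℤ) (k : ℕ) (s : ℤ) : (negConj p)^[k] s = -p^[k] (-s) := by
  induction k generalizing s with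
  | zero => simp
  | succ k ih => rw [iterate_succ_apply, iterate_succ_apply, ih]; simp [negConj]

section Shift

variable {p : ℤ → ℤ} {N : ℤ}

lemma map_add_mul_period (hp : ∀ a, p (a + N) = p a + N) (a j : ℤ) :
    p (a + j * N) = p a + j * N := by
  induction j using Int.induction_on with
  | zero => simp
  | succ j ih =>
    rw [show a + ((j : ℤ) + 1) * N = a + j * N + N by ring, hp, ih]; ring
  | pred j ih =>
    have := hp (a + (-(j : ℤ) - 1) * N)
    rw [show a + (-(j : ℤ) - 1) * N + N = a + -(j : ℤ) * N by ring, ih] at this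
    linarith

lemma iterate_add_period (hp : ∀ a, p (a + N) = p a + N) (k : ℕ) (a : ℤ) :
    p^[k] (a + N) = p^[k] a + N := by
  induction k generalizing a with
  | zero => rfl
  | succ k ih => rw [iterate_succ_apply, iterate_succ_apply, hp, ih]

/-- An injective self-map of a periodic set of integers compatible with the period is
surjective. -/
lemma exists_of_injOn_periodic (hN : 0 < N) {S : Set ℤ} (hS : ∀ x (j : ℤ), x ∈ S → x + j * N ∈ S)
    (hp : ∀ x ∈ S, ∀ j : ℤ, p (x + j * N) = p x + j * N) (hmaps : ∀ x ∈ S, p x ∈ S)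
    (hinj : Set.InjOn p S) {s : ℤ} (hs : s ∈ S) : ∃ x ∈ S, p x = s := by
  have hmod : ∀ y, y % N = y + -(y / N) * N := fun y => by
    have := Int.emod_add_mul_ediv y N
    linarith
  let T := {x : Set.Ico 0 N // (x : ℤ) ∈ S}
  have hmemT : ∀ y ∈ S, y % N ∈ Set.Ico 0 N ∧ y % N ∈ S := fun y hy =>
    ⟨⟨Int.emod_nonneg y hN.ne', Int.emod_lt_of_pos y hN⟩, by rw [hmod]; exact hS _ _ hy⟩
  let g : T → T := fun x =>
    ⟨⟨p x.1 % N, (hmemT _ (hmaps _ x.2)).1⟩, (hmemT _ (hmaps _ x.2)).2⟩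
  have hg : Injective g := by
    rintro ⟨⟨x, hx⟩, hxS⟩ ⟨⟨y, hy⟩, hyS⟩ hxy
    have h1 : p x % N = p y % N := congrArg (fun z : T => (z.1 : ℤ)) hxy
    change x ∈ S at hxS
    change y ∈ S at hyS
    obtain ⟨j, hj⟩ : ∃ j, p x = p y + j * N := by
      refine ⟨p x / N - p y / N, ?_⟩
      have := Int.emod_add_mul_ediv (p x) N
      have := Int.emod_add_mul_ediv (p y) N
      linarith
    rw [← hp y hyS] at hj
    have h2 : x = y + j * N := hinj hxS (hS _ _ hyS) hj
    have h3 : x % N = y % N := by rw [h2, Int.add_mul_emod_self_right]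
    rw [Int.emod_eq_of_lt hx.1 hx.2, Int.emod_eq_of_lt hy.1 hy.2] at h3
    subst h3
    rfl
  obtain ⟨⟨⟨x, hx⟩, hxS⟩, hxs⟩ := Finite.surjective_of_injective hg ⟨⟨s % N, (hmemT s hs).1⟩,
    (hmemT s hs).2⟩
  change x ∈ S at hxS
  have h1 : p x % N = s % N := congrArg (fun z : T => (z.1 : ℤ)) hxs
  refine ⟨x + (s / N - p x / N) * N, hS _ _ hxS, ?_⟩
  rw [hp x hxS]
  have := Int.emod_add_mul_ediv (p x) N
  have := Int.emod_add_mul_ediv s N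
  linarith

lemma exists_lt_of_periodic (hN : 0 < N) (hp : ∀ a, p (a + N) = p a + N) (y : ℤ) :
    ∃ x, p x < y := by
  refine ⟨0 + -(|y - p 0| + 1) * N, ?_⟩
  have h1 := map_add_mul_period hp 0 (-(|y - p 0| + 1))
  rw [h1]
  have h2 : (|y - p 0| + 1) * 1 ≤ (|y - p 0| + 1) * N :=
    mul_le_mul_of_nonneg_left hN (by positivity)
  have h3 := neg_abs_le (y - p 0)
  linarith

/-- A value of a monotone periodic map is attained at a point of strict increase. -/
lemma exists_ascent (hm : Monotone p) (hN : 0 < N) (hp : ∀ a, p (a + N) = p a + N) (z : ℤ) :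
    ∃ a, p a ≠ p (a + 1) ∧ p (a + 1) = p z := by
  obtain ⟨x, hx⟩ := exists_lt_of_periodic hN hp (p z)
  have hbdd : ∀ a, p a = p z → x ≤ a := fun a ha => by
    by_contra! hlt
    have := hm hlt.le
    omega
  obtain ⟨l, hl, hmin⟩ := Int.exists_least_of_bdd ⟨x, hbdd⟩ ⟨z, rfl⟩
  refine ⟨l - 1, fun h => ?_, by rw [sub_add_cancel, hl]⟩
  rw [sub_add_cancel, hl] at h
  have := hmin _ h
  omega

lemma evenDeloops_iff (hm : Monotone p) (hN : 0 < N) (hp : ∀ a, p (a + N) = p a + N) (k : ℕ) :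
    EvenDeloops p k ↔ ∀ z, ∃ b, p^[k + 1] b = p^[k] z := by
  refine ⟨fun h z => ?_, fun h a => Or.inr (h _)⟩
  obtain ⟨a, ha, haz⟩ := exists_ascent (hm.iterate k) hN (iterate_add_period hp k) z
  obtain ⟨b, hb⟩ := (h a).resolve_left ha
  exact ⟨b, hb.trans haz⟩

end Shift

section Adjoint

variable {p q : ℤ → ℤ} {N : ℤ}

lemma GaloisConnection.iterate (h : GaloisConnection p q) (k : ℕ) :
    GaloisConnection p^[k] q^[k] := by
  induction k with
  | zero => exact GaloisConnection.id
  | succ k ih =>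
    rw [iterate_succ, iterate_succ']
    exact h.compose ih

lemma GaloisConnection.negConj (h : GaloisConnection p q) :
    GaloisConnection (negConj q) (negConj p) := by
  intro x y
  have := h (-y) (-x)
  unfold _root_.negConj
  constructor
  · intro h1
    have := this.2 (by linarith)
    linarith
  · intro h1
    have := this.1 (by linarith)
    linarith

lemma GaloisConnection.map_add_period (h : GaloisConnection p q)
    (hq : ∀ a, q (a + N) = q a + N) (a : ℤ) : p (a + N) = p a + N := by
  have key : ∀ y, p (a + N) ≤ y ↔ p a + N ≤ y := by
    intro y
    have h1 := hq (y - N)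
    rw [sub_add_cancel] at h1
    rw [h, h1, ← sub_nonneg, show q (y - N) + N - (a + N) = q (y - N) - a by ring, sub_nonneg,
      ← h]
    constructor <;> intro <;> linarith
  exact le_antisymm ((key _).2 le_rfl) ((key _).1 le_rfl)

lemma negConj_add_period (hp : ∀ a, p (a + N) = p a + N) (a : ℤ) :
    negConj p (a + N) = negConj p a + N := by
  have := hp (-(a + N))
  unfold negConj
  rw [show -(a + N) + N = -a by ring] at this
  linarith

lemma monotone_negConj (hp : Monotone p) : Monotone (negConj p) := fun _ _ h =>
  neg_le_neg (hp (neg_le_neg h))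

lemma EvenDeloops.of_negConj (h : GaloisConnection p q) (hN : 0 < N)
    (hp : ∀ a, p (a + N) = p a + N) (hq : ∀ a, q (a + N) = q a + N) {k : ℕ}
    (hc : EvenDeloops (negConj q) k) : EvenDeloops p k := by
  rw [evenDeloops_iff h.monotone_l hN hp]
  rw [evenDeloops_iff (monotone_negConj h.monotone_u) hN (negConj_add_period hq)] at hc
  have hc' : ∀ z, ∃ b, q^[k + 1] b = q^[k] z := by
    intro z
    obtain ⟨b, hb⟩ := hc (-z)
    rw [iterate_negConj, iterate_negConj, neg_neg] at hb
    exact ⟨-b, neg_injective hb⟩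
  have hk := h.iterate k
  have hk1 := h.iterate (k + 1)
  have hle : ∀ z z', p^[k + 1] z ≤ p^[k + 1] z' → p^[k] z ≤ p^[k] z' := by
    intro z z' hzz
    obtain ⟨y, hy⟩ := hc' (p^[k] z')
    rw [hk, ← hy, ← hk1]
    refine hzz.trans ?_
    rw [hk1, hy, ← hk]
  have hS : ∀ x (j : ℤ), x ∈ Set.range p^[k] → x + j * N ∈ Set.range p^[k] := by
    rintro _ j ⟨z, rfl⟩
    exact ⟨z + j * N, map_add_mul_period (iterate_add_period hp k) z j⟩
  intro z
  obtain ⟨_, ⟨b, rfl⟩, hb⟩ := exists_of_injOn_periodic hN hS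
    (fun x _ j => map_add_mul_period hp x j) (by
      rintro _ ⟨z, rfl⟩
      exact ⟨p z, by rw [← iterate_succ_apply, iterate_succ_apply']⟩) (by
      rintro _ ⟨z, rfl⟩ _ ⟨z', rfl⟩ hzz
      rw [← iterate_succ_apply' p, ← iterate_succ_apply' p] at hzz
      exact le_antisymm (hle _ _ hzz.le) (hle _ _ hzz.ge)) ⟨z, rfl⟩
  exact ⟨b, by rw [iterate_succ_apply', hb]⟩

lemma OddDeloops.of_negConj (h : GaloisConnection p q) (hN : 0 < N)
    (hp : ∀ a, p (a + N) = p a + N) {k : ℕ}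
    (hc : OddDeloops (negConj q) k) : OddDeloops p k := by
  have hc' : ∀ t, q^[k + 1] (t + 1) = q^[k + 1] t ∨ ∃ b, q^[k + 1] b = q^[k] t := by
    intro t
    have := hc (-t - 1)
    simp only [iterate_negConj, neg_inj] at this
    rw [show -(-t - 1) = t + 1 by ring, show -(-t - 1 + 1) = t by ring] at this
    exact this.imp_right fun ⟨b, hb⟩ => ⟨-b, hb⟩
  have hk := h.iterate k
  have hk1 := h.iterate (k + 1)
  let S : Set ℤ := {a | p^[k + 1] (a - 1) < p^[k + 1] a}
  have hcover : ∀ z, ∃ a ∈ S, p^[k] a = p^[k + 1] z := by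
    intro z
    set y := p^[k + 1] z with hy
    have hne : q^[k + 1] (y - 1 + 1) ≠ q^[k + 1] (y - 1) := by
      rw [sub_add_cancel]
      intro heq
      have h1 : z ≤ q^[k + 1] y := (hk1 _ _).1 le_rfl
      rw [heq, ← hk1] at h1
      omega
    obtain ⟨b, hb⟩ := (hc' (y - 1)).resolve_left hne
    refine ⟨q^[k] (y - 1) + 1, ?_, le_antisymm ?_ ?_⟩
    · change p^[k + 1] (q^[k] (y - 1) + 1 - 1) < _
      rw [add_sub_cancel_right, ← hb]
      have h1 : p^[k + 1] (q^[k + 1] b) ≤ b := (hk1 _ _).2 le_rfl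
      have h2 : ¬ p^[k + 1] (q^[k + 1] b + 1) ≤ b := by
        rw [hk1]; omega
      omega
    · have h1 : ¬ p z ≤ q^[k] (y - 1) := by
        rw [← hk]; change ¬ p^[k + 1] z ≤ y - 1; omega
      have h2 : p^[k] (q^[k] (y - 1) + 1) ≤ p^[k] (p z) := hk.monotone_l (by omega)
      rwa [← iterate_succ_apply] at h2
    · have h1 : ¬ p^[k] (q^[k] (y - 1) + 1) ≤ y - 1 := by rw [hk]; omega
      omega
  choose θ hθS hθ using hcover
  have hSstrict : ∀ {n : ℕ}, n ≤ k + 1 → ∀ a b, b ∈ S → a < b → p^[n] a < p^[n] b := by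
    intro n hn a b hb hab
    have h1 : p^[n] a ≤ p^[n] (b - 1) := (h.iterate n).monotone_l (by omega)
    have h2 : p^[n] (b - 1) ≤ p^[n] b := (h.iterate n).monotone_l (by omega)
    have h3 : p^[n] (b - 1) ≠ p^[n] b := by
      intro heq
      have hb' : p^[k + 1] (b - 1) < p^[k + 1] b := hb
      rw [show k + 1 = (k + 1 - n) + n by omega, iterate_add_apply, iterate_add_apply, heq] at hb'
      exact lt_irrefl _ hb'
    omega
  have hinj : ∀ {n : ℕ}, n ≤ k + 1 → Set.InjOn p^[n] S := by
    intro n hn a ha b hb hab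
    rcases lt_trichotomy a b with hlt | heq | hlt
    · exact absurd hab (hSstrict hn a b hb hlt).ne
    · exact heq
    · exact absurd hab (hSstrict hn b a ha hlt).ne'
  have hpk := fun n a j => map_add_mul_period (iterate_add_period hp n) a j
  have hS : ∀ x (j : ℤ), x ∈ S → x + j * N ∈ S := by
    intro x j hx
    change p^[k + 1] (x + j * N - 1) < p^[k + 1] (x + j * N)
    rw [show x + j * N - 1 = (x - 1) + j * N by ring, hpk, hpk]
    have hx' : p^[k + 1] (x - 1) < p^[k + 1] x := hx
    linarith
  intro a
  by_cases ha : p^[k + 1] a = p^[k + 1] (a + 1)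
  · exact Or.inl ha
  right
  have haS : a + 1 ∈ S := by
    have h1 : p^[k + 1] a ≤ p^[k + 1] (a + 1) := hk1.monotone_l (by omega)
    change p^[k + 1] (a + 1 - 1) < _
    rw [add_sub_cancel_right]
    omega
  obtain ⟨x, hxS, hx⟩ := exists_of_injOn_periodic (p := θ) hN hS (fun x _ j => by
    refine hinj (Nat.le_succ k) (hθS _) (hS _ _ (hθS _)) ?_
    rw [hθ, hpk, hpk, hθ]) (fun x _ => hθS x) (fun x hx y hy hxy => by
    refine hinj le_rfl hx hy ?_
    rw [← hθ, ← hθ, hxy]) haS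
  exact ⟨x, by rw [← hx, hθ]⟩

end Adjoint
end Lines

section LineComparison

section Transport

variable {p e ν : ℤ → ℤ} {N M : ℤ}

lemma evenDeloops_succ_iff (hm : Monotone p) (hN : 0 < N) (hp : ∀ a, p (a + N) = p a + N)
    (hme : Monotone e) (hM : 0 < M) (he : ∀ a, e (a + M) = e a + M) (hν : Injective ν)
    (hrange : Set.range ν = Set.range p) (hνe : Semiconj ν e p) (k : ℕ) :
    EvenDeloops p (k + 1) ↔ EvenDeloops e k := by
  rw [evenDeloops_iff hm hN hp, evenDeloops_iff hme hM he]
  constructor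
  · intro h s
    obtain ⟨z, hz⟩ : ν s ∈ Set.range p := hrange ▸ ⟨s, rfl⟩
    obtain ⟨b, hb⟩ := h z
    obtain ⟨t, ht⟩ : p b ∈ Set.range ν := hrange ▸ ⟨b, rfl⟩
    refine ⟨t, hν ?_⟩
    rw [(hνe.iterate_right _).eq, (hνe.iterate_right _).eq, ht, ← hz, ← iterate_succ_apply,
      ← iterate_succ_apply, hb]
  · intro h z
    obtain ⟨s, hs⟩ : p z ∈ Set.range ν := hrange ▸ ⟨z, rfl⟩
    obtain ⟨t, ht⟩ := h s
    obtain ⟨b, hb⟩ : ν t ∈ Set.range p := hrange ▸ ⟨t, rfl⟩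
    have := congrArg ν ht
    rw [(hνe.iterate_right _).eq, (hνe.iterate_right _).eq, hs, ← hb, ← iterate_succ_apply,
      ← iterate_succ_apply] at this
    exact ⟨b, this⟩

lemma oddDeloops_succ_iff (hm : Monotone p) (hN : 0 < N) (hp : ∀ a, p (a + N) = p a + N)
    (hν : StrictMono ν) (hrange : Set.range ν = Set.range p) (hνe : Semiconj ν e p) (k : ℕ) :
    OddDeloops p (k + 1) ↔ OddDeloops e k := by
  have hstep : ∀ a s, p a ≠ p (a + 1) → p (a + 1) = ν (s + 1) → p a = ν s := by
    intro a s hne hs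
    have hlt : p a < p (a + 1) := lt_of_le_of_ne (hm (by omega)) hne
    obtain ⟨t, ht⟩ : p a ∈ Set.range ν := hrange ▸ ⟨a, rfl⟩
    obtain ⟨b, hb⟩ : ν s ∈ Set.range p := hrange ▸ ⟨s, rfl⟩
    have hts : t < s + 1 := by rw [← hν.lt_iff_lt, ht, ← hs]; exact hlt
    have hba : b < a + 1 := by
      by_contra! h
      have h1 := hm h
      rw [hb, hs, hν.le_iff_le] at h1
      omega
    refine le_antisymm ?_ ?_
    · rw [← ht]; exact hν.monotone (by omega)
    · rw [← hb]; exact hm (by omega)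
  constructor
  · intro h s
    obtain ⟨z, hz⟩ : ν (s + 1) ∈ Set.range p := hrange ▸ ⟨s + 1, rfl⟩
    obtain ⟨a, ha, haz⟩ := exists_ascent hm hN hp z
    have h1 := haz.trans hz
    have h2 := hstep a s ha h1
    rcases h a with heq | ⟨b, hb⟩
    · left
      apply hν.injective
      rw [iterate_succ_apply p (k + 1), iterate_succ_apply p (k + 1), h1, h2] at heq
      rw [(hνe.iterate_right _).eq, (hνe.iterate_right _).eq, heq]
    · right
      obtain ⟨t, ht⟩ : p b ∈ Set.range ν := hrange ▸ ⟨b, rfl⟩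
      refine ⟨t, hν.injective ?_⟩
      rw [(hνe.iterate_right _).eq, (hνe.iterate_right _).eq, ht, ← iterate_succ_apply, hb,
        iterate_succ_apply, h1]
  · intro h a
    by_cases ha : p a = p (a + 1)
    · left
      rw [iterate_succ_apply p (k + 1), iterate_succ_apply p (k + 1), ha]
    obtain ⟨s, hs⟩ : p (a + 1) ∈ Set.range ν := hrange ▸ ⟨a + 1, rfl⟩
    have h1 : p (a + 1) = ν (s - 1 + 1) := by rw [sub_add_cancel, hs]
    have h2 := hstep a (s - 1) ha h1
    rcases h (s - 1) with heq | ⟨t, ht⟩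
    · left
      have := congrArg ν heq
      rw [(hνe.iterate_right _).eq, (hνe.iterate_right _).eq, ← h1, ← h2, ← iterate_succ_apply,
        ← iterate_succ_apply] at this
      exact this
    · right
      obtain ⟨b, hb⟩ : ν t ∈ Set.range p := hrange ▸ ⟨t, rfl⟩
      refine ⟨b, ?_⟩
      have := congrArg ν ht
      rw [(hνe.iterate_right _).eq, (hνe.iterate_right _).eq, ← h1, ← hb, ← iterate_succ_apply,
        ← iterate_succ_apply] at this
      exact this

/-- Comparison of the line of an algebra with the line of its syzygy filtered algebra. -/
lemma deloops_succ_iff_of_adjoint {r : ℤ → ℤ} (hm : Monotone p) (hN : 0 < N)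
    (hp : ∀ a, p (a + N) = p a + N) (hM : 0 < M) (hr : ∀ a, r (a + M) = r a + M)
    (hν : StrictMono ν) (hrange : Set.range ν = Set.range p)
    (hadj : ∀ x y, p (ν x) ≤ ν y ↔ x ≤ -r (-y)) (k : ℕ) :
    (EvenDeloops p (k + 1) ↔ EvenDeloops r k) ∧ (OddDeloops p (k + 1) ↔ OddDeloops r k) := by
  have hex : ∀ x, ∃ s, ν s = p (ν x) := fun x => by
    have : p (ν x) ∈ Set.range ν := hrange ▸ ⟨ν x, rfl⟩
    exact this
  choose e he using hex
  have hgc : GaloisConnection e (negConj r) := fun x y => by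
    rw [← hν.le_iff_le, he]
    exact hadj x y
  have hgc' : GaloisConnection r (negConj e) := by
    have := hgc.negConj
    rwa [negConj_negConj] at this
  have her : ∀ a, e (a + M) = e a + M := hgc.map_add_period (negConj_add_period hr)
  constructor
  · rw [evenDeloops_succ_iff hm hN hp hgc.monotone_l hM her hν.injective hrange he]
    constructor
    · intro h
      exact EvenDeloops.of_negConj hgc' hM hr (negConj_add_period her)
        (by rwa [negConj_negConj])
    · intro h
      exact EvenDeloops.of_negConj hgc hM her (negConj_add_period hr) (by rwa [negConj_negConj])
  · rw [oddDeloops_succ_iff hm hN hp hν hrange he]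
    constructor
    · intro h
      exact OddDeloops.of_negConj hgc' hM hr (by rwa [negConj_negConj])
    · intro h
      exact OddDeloops.of_negConj hgc hM her (by rwa [negConj_negConj])

end Transport

variable {I : Type}

/-- The end points of the projectives along the orbit of `i`. -/
def lineMap (σ : Equiv.Perm I) (c : I → ℕ) (i : I) (a : ℤ) : ℤ := a + c ((σ ^ a) i)

/-- The syzygy on intervals. -/
def lineSyz (p : ℤ → ℤ) (x : ℤ × ℤ) : ℤ × ℤ := (x.2, p x.1)

lemma iterate_lineSyz_two_mul (p : ℤ → ℤ) (k : ℕ) (a b : ℤ) :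
    (lineSyz p)^[2 * k] (a, b) = (p^[k] a, p^[k] b) := by
  rw [iterate_mul]
  induction k with
  | zero => rfl
  | succ k ih =>
    rw [iterate_succ_apply', ih, iterate_succ_apply' p, iterate_succ_apply' p]
    rfl

lemma iterate_lineSyz_two_mul_add_one (p : ℤ → ℤ) (k : ℕ) (a b : ℤ) :
    (lineSyz p)^[2 * k + 1] (a, b) = (p^[k] b, p^[k + 1] a) := by
  rw [iterate_succ_apply', iterate_lineSyz_two_mul, iterate_succ_apply']
  rfl

/-- The delooping condition on intervals. -/
def LineDeloops (p : ℤ → ℤ) (d : ℕ) : Prop :=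
  ∀ a, ((lineSyz p)^[d] (a, a + 1)).1 = ((lineSyz p)^[d] (a, a + 1)).2 ∨
    ((lineSyz p)^[d] (a, a + 1)).2 = p ((lineSyz p)^[d] (a, a + 1)).1 ∨
    ∃ u v, u ≤ v ∧ v ≤ p u ∧ (lineSyz p)^[d + 1] (u, v) = (lineSyz p)^[d] (a, a + 1)

lemma lineDeloops_even_iff {p : ℤ → ℤ} (hm : Monotone p) (hp : ∀ a, a < p a) (k : ℕ) :
    LineDeloops p (2 * k) ↔ EvenDeloops p k := by
  refine forall_congr' fun a => ?_
  have hmk := hm.iterate k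
  simp only [iterate_lineSyz_two_mul, iterate_lineSyz_two_mul_add_one, Prod.mk.injEq]
  constructor
  · rintro (h | h | ⟨u, v, -, -, -, h⟩)
    · exact Or.inl h
    · exact Or.inr ⟨a, by rw [h, iterate_succ_apply']⟩
    · exact Or.inr ⟨u, h⟩
  · rintro (h | ⟨u, hu⟩)
    · exact Or.inl h
    by_cases h : p^[k] a = p^[k] (a + 1)
    · exact Or.inl h
    right
    have hlt : p^[k] a < p^[k] (a + 1) := lt_of_le_of_ne (hmk (by omega)) h
    by_cases hua : u ≤ a
    · right
      refine ⟨u, a, hua, ?_, rfl, hu⟩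
      by_contra! hlt'
      have h1 := hmk hlt'.le
      rw [← iterate_succ_apply, hu] at h1
      omega
    · left
      rw [← iterate_succ_apply' p]
      refine le_antisymm ?_ ?_
      · rw [iterate_succ_apply]
        exact hmk (hp a)
      · rw [← hu]
        exact hm.iterate (k + 1) (by omega)

lemma lineDeloops_odd_iff {p : ℤ → ℤ} (hm : Monotone p) (hp : ∀ a, a < p a) (k : ℕ) :
    LineDeloops p (2 * k + 1) ↔ OddDeloops p k := by
  refine forall_congr' fun a => ?_
  have hmk := hm.iterate k
  have hmk1 := hm.iterate (k + 1)
  simp only [show 2 * k + 1 + 1 = 2 * (k + 1) by ring, iterate_lineSyz_two_mul,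
    iterate_lineSyz_two_mul_add_one, Prod.mk.injEq, ← iterate_succ_apply' p]
  constructor
  · rintro (h | h | ⟨u, v, -, -, h, -⟩)
    · exact Or.inr ⟨a, h.symm⟩
    · exact Or.inl h
    · exact Or.inr ⟨u, h⟩
  · rintro (h | ⟨b, hb⟩)
    · exact Or.inr (Or.inl h)
    by_cases h : p^[k + 1] a = p^[k + 1] (a + 1)
    · exact Or.inr (Or.inl h)
    have hlt : p^[k + 1] a < p^[k + 1] (a + 1) := lt_of_le_of_ne (hmk1 (by omega)) h
    refine Or.inr (Or.inr ⟨b, a, ?_, ?_, hb, rfl⟩)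
    · by_contra! hab
      have h1 := hmk1 (show a + 1 ≤ b by omega)
      have h2 : p^[k] (a + 1) ≤ p^[k + 1] a := hmk (hp a)
      omega
    · by_contra! hab
      have h1 : p^[k] (p b) ≤ p^[k] a := hmk hab.le
      have h2 : p^[k] a ≤ p^[k] (a + 1) := hmk (by omega)
      rw [← iterate_succ_apply, hb] at h1
      apply h
      rw [iterate_succ_apply', iterate_succ_apply', le_antisymm h2 h1]

/-- The variant of the syzygy on pairs without an exception for the zero module. -/
def serialSyzAux (τ : I → I) (c : I → ℕ) (w : I × ℕ) : I × ℕ := (τ^[w.2] w.1, c w.1 - w.2)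

lemma iterate_serialSyz_eq_or (τ : I → I) (c : I → ℕ) (w : I × ℕ) (d : ℕ) :
    (serialSyz τ c)^[d] w = (serialSyzAux τ c)^[d] w ∨ ((serialSyz τ c)^[d] w).2 = 0 ∧
      (((serialSyzAux τ c)^[d] w).2 = 0 ∨
        ((serialSyzAux τ c)^[d] w).2 = c ((serialSyzAux τ c)^[d] w).1) := by
  induction d with
  | zero => exact Or.inl rfl
  | succ d ih =>
    rw [iterate_succ_apply', iterate_succ_apply']
    rcases ih with h | ⟨h0, h⟩
    · rw [← h]
      by_cases h0 : ((serialSyz τ c)^[d] w).2 = 0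
      · right
        refine ⟨by simp [serialSyz, h0], Or.inr ?_⟩
        simp [serialSyzAux, h0]
      · left
        rw [serialSyz, if_neg h0]
        rfl
    · right
      refine ⟨by simp [serialSyz, h0], ?_⟩
      rcases h with h | h
      · right
        simp [serialSyzAux, h]
      · left
        simp [serialSyzAux, h]

lemma serialDeloops_iff_aux (τ : I → I) (c : I → ℕ) (i : I) (d : ℕ) :
    SerialDeloops τ c i d ↔ ((serialSyzAux τ c)^[d] (i, 1)).2 = 0 ∨
      ((serialSyzAux τ c)^[d] (i, 1)).2 = c ((serialSyzAux τ c)^[d] (i, 1)).1 ∨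
      ∃ w : I × ℕ, w.2 ≤ c w.1 ∧ (serialSyzAux τ c)^[d + 1] w = (serialSyzAux τ c)^[d] (i, 1) := by
  unfold SerialDeloops
  rcases iterate_serialSyz_eq_or τ c (i, 1) d with h | ⟨h0, h⟩
  · rw [← h]
    constructor
    · rintro (h1 | h1 | ⟨w, hw, h1⟩)
      · exact Or.inl h1
      · exact Or.inr (Or.inl h1)
      · rcases iterate_serialSyz_eq_or τ c w (d + 1) with h2 | ⟨h2, -⟩
        · exact Or.inr (Or.inr ⟨w, hw, h2.symm.trans h1⟩)
        · rw [h1] at h2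
          exact Or.inl h2
    · rintro (h1 | h1 | ⟨w, hw, h1⟩)
      · exact Or.inl h1
      · exact Or.inr (Or.inl h1)
      · rcases iterate_serialSyz_eq_or τ c w (d + 1) with h2 | ⟨-, h2⟩
        · exact Or.inr (Or.inr ⟨w, hw, h2.trans h1⟩)
        · rw [h1] at h2
          exact h2.imp_right Or.inl
  · exact ⟨fun _ => h.imp_right Or.inl, fun _ => Or.inl h0⟩

section LineOfDatum

variable (σ : Equiv.Perm I) (c : I → ℕ) (i : I)

/-- The pair attached to an interval. -/
def linePair (x : ℤ × ℤ) : I × ℕ := ((σ ^ x.1) i, (x.2 - x.1).toNat)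

lemma iterate_perm_apply (m : ℕ) (a : ℤ) : σ^[m] ((σ ^ a) i) = (σ ^ (a + m)) i := by
  rw [add_comm, zpow_add, Equiv.Perm.mul_apply, zpow_natCast, Equiv.Perm.iterate_eq_pow]

lemma serialSyzAux_linePair {x : ℤ × ℤ} (h : x.1 ≤ x.2) :
    serialSyzAux σ c (linePair σ i x) = linePair σ i (lineSyz (lineMap σ c i) x) := by
  obtain ⟨a, b⟩ := x
  change a ≤ b at h
  refine Prod.ext ?_ ?_
  · change σ^[(b - a).toNat] ((σ ^ a) i) = (σ ^ b) i
    rw [iterate_perm_apply, Int.toNat_of_nonneg (by omega), add_sub_cancel]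
  · change c ((σ ^ a) i) - (b - a).toNat = (a + (c ((σ ^ a) i) : ℤ) - b).toNat
    omega

lemma iterate_serialSyzAux_linePair {x : ℤ × ℤ} (h : x.1 ≤ x.2)
    (h' : x.2 ≤ lineMap σ c i x.1) (hm : Monotone (lineMap σ c i)) (d : ℕ) :
    (serialSyzAux σ c)^[d] (linePair σ i x) = linePair σ i ((lineSyz (lineMap σ c i))^[d] x) ∧
      ((lineSyz (lineMap σ c i))^[d] x).1 ≤ ((lineSyz (lineMap σ c i))^[d] x).2 ∧
      ((lineSyz (lineMap σ c i))^[d] x).2 ≤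
        lineMap σ c i ((lineSyz (lineMap σ c i))^[d] x).1 := by
  induction d with
  | zero => exact ⟨rfl, h, h'⟩
  | succ d ih =>
    rw [iterate_succ_apply', iterate_succ_apply', ih.1, serialSyzAux_linePair σ c i ih.2.1]
    exact ⟨rfl, ih.2.2, hm ih.2.1⟩

lemma exists_of_iterate_serialSyzAux_eq (d : ℕ) {w : I × ℕ} {x : ℤ × ℤ} (h : x.1 ≤ x.2)
    (h' : x.2 ≤ lineMap σ c i x.1) (hw : w.2 ≤ c w.1)
    (hmem : ∀ w : I × ℕ, w.2 ≤ c w.1 →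
      (serialSyzAux σ c w).2 ≤ c (serialSyzAux σ c w).1)
    (he : (serialSyzAux σ c)^[d] w = linePair σ i x) :
    ∃ u v, u ≤ v ∧ v ≤ lineMap σ c i u ∧ (lineSyz (lineMap σ c i))^[d] (u, v) = x := by
  induction d generalizing x with
  | zero => exact ⟨x.1, x.2, h, h', rfl⟩
  | succ d ih =>
    rw [iterate_succ_apply'] at he
    have hw' : ((serialSyzAux σ c)^[d] w).2 ≤ c ((serialSyzAux σ c)^[d] w).1 := by
      clear ih he
      induction d with
      | zero => exact hw
      | succ d ih => rw [iterate_succ_apply']; exact hmem _ ih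
    set y := (serialSyzAux σ c)^[d] w with hy
    obtain ⟨j, m⟩ := y
    obtain ⟨a, b⟩ := x
    change m ≤ c j at hw'
    have h1 : σ^[m] j = (σ ^ a) i := congrArg Prod.fst he
    have h2 : c j - m = (b - a).toNat := congrArg Prod.snd he
    have hj : j = (σ ^ (a - m)) i := by
      apply (σ ^ (m : ℤ)).injective
      rw [← Equiv.Perm.mul_apply, ← zpow_add, show (m : ℤ) + (a - m) = a by ring, ← h1,
        zpow_natCast, Equiv.Perm.iterate_eq_pow]
    change a ≤ b at h
    have hp : lineMap σ c i (a - m) = b := by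
      unfold lineMap
      rw [← hj]
      omega
    obtain ⟨u, v, huv, hvu, he'⟩ := ih (x := (a - m, a)) (by simp) (by
      change a ≤ lineMap σ c i (a - m)
      omega) (by
      rw [hj]
      exact Prod.ext rfl (by simp [linePair]))
    refine ⟨u, v, huv, hvu, ?_⟩
    rw [iterate_succ_apply', he']
    exact Prod.ext rfl hp

lemma lineMap_monotone (hc : ∀ j, c j ≤ c (σ j) + 1) : Monotone (lineMap σ c i) := by
  refine monotone_int_of_le_succ fun a => ?_
  have := hc ((σ ^ a) i)
  rw [← Equiv.Perm.mul_apply, ← zpow_one_add, add_comm 1 a] at this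
  unfold lineMap
  omega

lemma lineMap_add_orderOf (a : ℤ) :
    lineMap σ c i (a + orderOf σ) = lineMap σ c i a + orderOf σ := by
  unfold lineMap
  rw [zpow_add, zpow_natCast, pow_orderOf_eq_one, mul_one]
  ring

lemma forall_serialDeloops_iff (hc0 : ∀ j, 0 < c j) (hc : ∀ j, c j ≤ c (σ j) + 1)
    (hmem : ∀ w : I × ℕ, w.2 ≤ c w.1 →
      (serialSyzAux σ c w).2 ≤ c (serialSyzAux σ c w).1) (d : ℕ) :
    (∀ a : ℤ, SerialDeloops σ c ((σ ^ a) i) d) ↔ LineDeloops (lineMap σ c i) d := by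
  refine forall_congr' fun a => ?_
  have hm := lineMap_monotone σ c i hc
  have ha : (a, a + 1).2 ≤ lineMap σ c i (a, a + 1).1 := by
    have := hc0 ((σ ^ a) i)
    change a + 1 ≤ a + (c ((σ ^ a) i) : ℤ)
    omega
  have ha' : (a, a + 1).1 ≤ (a, a + 1).2 := by
    change a ≤ a + 1
    omega
  have hpair : ((σ ^ a) i, 1) = linePair σ i (a, a + 1) := by simp [linePair]
  obtain ⟨h1, h2, h3⟩ := iterate_serialSyzAux_linePair σ c i ha' ha hm d
  rw [serialDeloops_iff_aux, hpair, h1]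
  set x := (lineSyz (lineMap σ c i))^[d] (a, a + 1) with hx
  have hx2 : (linePair σ i x).2 = (x.2 - x.1).toNat := rfl
  have hx1 : (linePair σ i x).1 = (σ ^ x.1) i := rfl
  refine or_congr ?_ (or_congr ?_ ?_)
  · rw [hx2]; omega
  · rw [hx2, hx1]
    unfold lineMap
    omega
  · constructor
    · rintro ⟨w, hw, he⟩
      exact exists_of_iterate_serialSyzAux_eq σ c i (d + 1) h2 h3 hw hmem he
    · rintro ⟨u, v, huv, hvu, he⟩
      refine ⟨linePair σ i (u, v), ?_, ?_⟩
      · change (v - u).toNat ≤ c ((σ ^ u) i)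
        unfold lineMap at hvu
        omega
      · rw [(iterate_serialSyzAux_linePair σ c i (x := (u, v)) huv hvu hm (d + 1)).1, he]

end LineOfDatum
end LineComparison

section OrbitComparison

lemma exists_int_antidifference (f : ℤ → ℤ) :
    ∃ ν : ℤ → ℤ, ν 0 = 0 ∧ ∀ x, ν (x + 1) = ν x + f x := by
  refine ⟨fun x => (∑ j ∈ Finset.range x.toNat, f j) -
    ∑ j ∈ Finset.range (-x).toNat, f (-(j + 1)), by simp, fun x => ?_⟩
  rcases Int.le_total 0 x with h | h
  · obtain ⟨n, rfl⟩ := Int.eq_ofNat_of_zero_le h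
    have h1 : ((n : ℤ) + 1).toNat = n + 1 := by omega
    have h2 : (-((n : ℤ) + 1)).toNat = 0 := by omega
    have h3 : (-(n : ℤ)).toNat = 0 := by omega
    simp only [h1, h2, h3, Finset.sum_range_succ, Int.toNat_natCast, Finset.range_zero,
      Finset.sum_empty, sub_zero]
  · obtain ⟨n, hn⟩ := Int.eq_ofNat_of_zero_le (show 0 ≤ -x by omega)
    rcases n with - | n
    · obtain rfl : x = 0 := by simpa using hn
      simp
    · obtain rfl : x = -((n : ℤ) + 1) := by push_cast at hn; omega
      have h1 : (-((n : ℤ) + 1) + 1).toNat = 0 := by omega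
      have h2 : (-(-((n : ℤ) + 1) + 1)).toNat = n := by omega
      have h3 : (-((n : ℤ) + 1)).toNat = 0 := by omega
      have h4 : (-(-((n : ℤ) + 1))).toNat = n + 1 := by omega
      simp only [h1, h2, h3, h4, Finset.sum_range_succ, Finset.range_zero, Finset.sum_empty]
      ring

lemma lineDeloops_add_two_iff {p r : ℤ → ℤ} (hp : Monotone p) (hpl : ∀ a, a < p a)
    (hr : Monotone r) (hrl : ∀ a, a < r a)
    (h : ∀ k, (EvenDeloops p (k + 1) ↔ EvenDeloops r k) ∧ (OddDeloops p (k + 1) ↔ OddDeloops r k))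
    (d : ℕ) : LineDeloops p (d + 2) ↔ LineDeloops r d := by
  rcases Nat.even_or_odd' d with ⟨k, rfl | rfl⟩
  · rw [show 2 * k + 2 = 2 * (k + 1) by ring, lineDeloops_even_iff hp hpl,
      lineDeloops_even_iff hr hrl, (h k).1]
  · rw [show 2 * k + 1 + 2 = 2 * (k + 1) + 1 by ring, lineDeloops_odd_iff hp hpl,
      lineDeloops_odd_iff hr hrl, (h k).2]

variable {I J : Type}

lemma lineMap_gt {σ : Equiv.Perm I} {c : I → ℕ} (hc : ∀ j, 0 < c j) (i : I) (a : ℤ) :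
    a < lineMap σ c i a := by
  have := hc ((σ ^ a) i)
  unfold lineMap
  omega

/-- Comparison of the delooping conditions along the orbits of `σ` with those along the orbits
of the first return map of `σ⁻¹` to the image of `i ↦ σ^[c i] i`. -/
lemma forall_serialDeloops_add_two_iff [Finite I] [Finite J] (σ : Equiv.Perm I) (c : I → ℕ)
    (σ' : Equiv.Perm J) (c' : J → ℕ) (κ : J → I) (m : J → ℕ)
    (hc0 : ∀ j, 0 < c j) (hc : ∀ j, c j ≤ c (σ j) + 1)
    (hmem : ∀ w : I × ℕ, w.2 ≤ c w.1 → (serialSyzAux σ c w).2 ≤ c (serialSyzAux σ c w).1)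
    (hc0' : ∀ j, 0 < c' j) (hc' : ∀ j, c' j ≤ c' (σ' j) + 1)
    (hmem' : ∀ w : J × ℕ, w.2 ≤ c' w.1 → (serialSyzAux σ' c' w).2 ≤ c' (serialSyzAux σ' c' w).1)
    (hκ : Set.range κ = Set.range fun i => σ^[c i] i)
    (hm : ∀ k, 0 < m k) (hmκ : ∀ k, σ^[m k] (κ (σ' k)) = κ k)
    (hmin : ∀ k n, 0 < n → n < m k → ∀ l, σ^[n] (κ l) ≠ κ k)
    (hcc : ∀ k n, c' k ≤ n ↔ c (κ (σ'^[n] k)) ≤ ∑ s ∈ Finset.range n, m (σ'^[s] k)) (d : ℕ) :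
    (∀ i, SerialDeloops σ c i (d + 2)) ↔ ∀ k, SerialDeloops σ' c' k d := by
  have key : ∀ k₀, LineDeloops (lineMap σ c (κ k₀)) (d + 2) ↔
      LineDeloops (lineMap σ' c' k₀) d := by
    intro k₀
    refine lineDeloops_add_two_iff (lineMap_monotone σ c _ hc) (lineMap_gt hc0 _)
      (lineMap_monotone σ' c' _ hc') (lineMap_gt hc0' _) (fun k => ?_) d
    obtain ⟨ν, hν0, hν1⟩ := exists_int_antidifference fun x => m ((σ' ^ (-x - 1)) k₀)
    have hνm : StrictMono ν := strictMono_int_of_lt_succ fun x => by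
      have := hm ((σ' ^ (-x - 1)) k₀)
      rw [hν1]
      omega
    have hstep : ∀ x : ℤ, (σ ^ (m ((σ' ^ (-x - 1)) k₀) : ℤ)) (κ ((σ' ^ (-x)) k₀)) =
        κ ((σ' ^ (-x - 1)) k₀) := by
      intro x
      rw [← hmκ ((σ' ^ (-x - 1)) k₀), zpow_natCast, ← Equiv.Perm.iterate_eq_pow,
        ← Equiv.Perm.mul_apply, ← zpow_one_add]
      congr 5
      ring
    have hνκ : ∀ x : ℤ, κ ((σ' ^ (-x)) k₀) = (σ ^ ν x) (κ k₀) := by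
      intro x
      induction x using Int.induction_on with
      | zero => simp [hν0]
      | succ x ih =>
        rw [hν1, add_comm (ν x), zpow_add, Equiv.Perm.mul_apply, ← ih, hstep, neg_add']
      | pred x ih =>
        have h1 := hν1 (-(x : ℤ) - 1)
        have h2 := hstep (-(x : ℤ) - 1)
        rw [sub_add_cancel] at h1
        rw [show -(-(x : ℤ) - 1) - 1 = -(-(x : ℤ)) by ring] at h1 h2
        apply (σ ^ (m ((σ' ^ (-(-(x : ℤ)))) k₀) : ℤ)).injective
        rw [h2, ih, ← Equiv.Perm.mul_apply, ← zpow_add, h1, add_comm]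
    have hrange : Set.range ν = Set.range (lineMap σ c (κ k₀)) := by
      apply Set.Subset.antisymm
      · rintro _ ⟨x, rfl⟩
        obtain ⟨j, hj⟩ : κ ((σ' ^ (-x)) k₀) ∈ Set.range fun i => σ^[c i] i := hκ ▸ ⟨_, rfl⟩
        change σ^[c j] j = _ at hj
        have hj' : j = (σ ^ (ν x - c j)) (κ k₀) := by
          apply (σ ^ (c j : ℤ)).injective
          rw [← Equiv.Perm.mul_apply, ← zpow_add, add_sub_cancel, ← hνκ, ← hj, zpow_natCast,
            Equiv.Perm.iterate_eq_pow]
        refine ⟨ν x - c j, ?_⟩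
        rw [lineMap, ← hj']
        ring
      · rintro _ ⟨a, rfl⟩
        set b := lineMap σ c (κ k₀) a with hb
        obtain ⟨l, hl⟩ : (σ ^ b) (κ k₀) ∈ Set.range κ := by
          rw [hκ]
          refine ⟨(σ ^ a) (κ k₀), ?_⟩
          change σ^[c ((σ ^ a) (κ k₀))] ((σ ^ a) (κ k₀)) = _
          rw [iterate_perm_apply, hb, lineMap]
        have hνle : ∀ x y : ℤ, x ≤ y → ν x + (y - x) ≤ ν y := by
          intro x y hxy
          induction y, hxy using Int.leInduction with
          | base => simp
          | succ y _ ih =>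
            have := hνm (Int.lt_succ y)
            change ν y < ν (y + 1) at this
            omega
        obtain ⟨x, hx, hxmax⟩ := Int.exists_greatest_of_bdd (P := fun x => ν x ≤ b)
          ⟨max 0 b, fun z hz => by
            by_contra! hlt
            have := hνle 0 z (by omega)
            omega⟩ ⟨min 0 b, by
            have := hνle (min 0 b) 0 (by omega)
            change ν (min 0 b) ≤ b
            omega⟩
        have hx1 : b < ν (x + 1) := by
          by_contra! hle
          have := hxmax _ hle
          omega
        refine ⟨x, le_antisymm hx ?_⟩
        by_contra! hlt
        have hν1x := hν1 x
        obtain ⟨n, hn⟩ := Int.eq_ofNat_of_zero_le (show 0 ≤ ν (x + 1) - b by omega)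
        refine hmin ((σ' ^ (-x - 1)) k₀) n (by omega) (by omega) l ?_
        rw [hl, iterate_perm_apply, ← neg_add', hνκ]
        congr 2
        omega
    refine deloops_succ_iff_of_adjoint (N := orderOf σ) (M := orderOf σ')
      (lineMap_monotone σ c _ hc) (by exact_mod_cast orderOf_pos σ)
      (lineMap_add_orderOf σ c _) (by exact_mod_cast orderOf_pos σ')
      (lineMap_add_orderOf σ' c' _) hνm hrange (fun x y => ?_) k
    unfold lineMap
    rw [← hνκ]
    rcases le_or_gt x y with hxy | hxy
    · obtain ⟨n, hn⟩ := Int.eq_ofNat_of_zero_le (show 0 ≤ y - x by omega)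
      have hit : ∀ s : ℕ, σ'^[s] ((σ' ^ (-y)) k₀) = (σ' ^ (-(y - s))) k₀ := fun s => by
        rw [iterate_perm_apply]
        congr 2
        ring
      have hsum : ∀ n : ℕ, (∑ s ∈ Finset.range n, m (σ'^[s] ((σ' ^ (-y)) k₀)) : ℕ) =
          ν y - ν (y - n) := by
        intro n
        induction n with
        | zero => simp
        | succ n ih =>
          have h1 := hν1 (y - (n + 1 : ℕ))
          rw [show y - ((n + 1 : ℕ) : ℤ) + 1 = y - n by push_cast; ring,
            show -(y - ((n + 1 : ℕ) : ℤ)) - 1 = -(y - n) by push_cast; ring, ← hit] at h1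
          rw [Finset.sum_range_succ, Nat.cast_add, ih]
          omega
      have h1 := hcc ((σ' ^ (-y)) k₀) n
      have h2 := hsum n
      rw [hit, show y - (n : ℤ) = x by omega] at h1
      rw [show y - (n : ℤ) = x by omega] at h2
      omega
    · have h1 := hνm hxy
      have h2 := hc0 (κ ((σ' ^ (-x)) k₀))
      omega
  have horb : ∀ i, ∃ k, ∃ a : ℤ, (σ ^ a) (κ k) = i := by
    intro i
    obtain ⟨k, hk⟩ : σ^[c i] i ∈ Set.range κ := hκ ▸ ⟨i, rfl⟩
    refine ⟨k, -(c i), ?_⟩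
    rw [hk, Equiv.Perm.iterate_eq_pow, ← Equiv.Perm.mul_apply, ← zpow_natCast, ← zpow_add,
      neg_add_cancel, zpow_zero, Equiv.Perm.one_apply]
  constructor
  · intro h k
    have h1 := (forall_serialDeloops_iff σ c (κ k) hc0 hc hmem (d + 2)).1 fun a => h _
    simpa using (forall_serialDeloops_iff σ' c' k hc0' hc' hmem' d).2 ((key k).1 h1) 0
  · intro h i
    obtain ⟨k, a, rfl⟩ := horb i
    have h1 := (forall_serialDeloops_iff σ' c' k hc0' hc' hmem' d).1 fun a => h _
    exact (forall_serialDeloops_iff σ c (κ k) hc0 hc hmem (d + 2)).2 ((key k).2 h1) a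

end OrbitComparison

section Compression

variable {R : Type} [Ring R] {I : Type} {P : I → Type}
  [∀ i, AddCommGroup (P i)] [∀ i, Module R (P i)] {τ : I → I}
  {α : ∀ i, P (τ i) →ₗ[R] P i}

namespace IsSerialDatum

variable (D : IsSerialDatum R P τ α)

include D

lemma exists_cover_of_eq {d : ℕ} {a b : I} (h : τ^[d] a = b) :
    ∃ f : P b →ₗ[R] P a, LinearMap.range f = serialRad α d a ∧
      ∀ (x : I) (t : P b →ₗ[R] P x), LinearMap.range t ≤ serialRad α d x →
        ∃ h : P a →ₗ[R] P x, h ∘ₗ f = t := by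
  subst h
  exact D.exists_cover d a

/-- The source of a nonzero map is determined by the depth of its image. -/
lemma eq_iterate_of_range_eq {i j : I} (f : P i →ₗ[R] P j) {e : ℕ} (hf0 : f ≠ 0)
    (hf : LinearMap.range f = serialRad α e j) : i = τ^[e] j := by
  induction e generalizing j with
  | zero => exact D.eq_of_surjective i j f (LinearMap.range_eq_top.1 hf)
  | succ e ih =>
    obtain ⟨g, hg, hg'⟩ := D.exists_lift f hf
    refine ih g (fun h => hf0 ?_) (hg' fun h => hf0 ?_)
    · rw [← hg, h, LinearMap.comp_zero]
    · rwa [h, LinearMap.range_eq_bot] at hf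

lemma bijective_endo {i : I} (f : P i →ₗ[R] P i) (hf : Surjective f) : Bijective f := by
  have := D.isNoetherian i
  exact ⟨IsNoetherian.injective_of_surjective_endomorphism f hf, hf⟩

lemma not_id_eq_comp {i j : I} (g : P j →ₗ[R] P i) (f : P i →ₗ[R] P j)
    (hf : LinearMap.range f ≤ LinearMap.range (α j)) : g ∘ₗ f ≠ LinearMap.id := by
  intro h
  have hg : LinearMap.range g = serialRad α 0 i := by
    rw [serialRad_zero, LinearMap.range_eq_top]
    exact fun x => ⟨f x, LinearMap.congr_fun h x⟩
  have h1 := D.map_range_eq g hg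
  have h2 : (⊤ : Submodule R (P i)) ≤ serialRad α (0 + 1) i := by
    rw [← h1, ← LinearMap.range_id, ← h, LinearMap.range_comp]
    exact Submodule.map_mono hf
  rw [zero_add, serialRad_one] at h2
  exact D.range_ne_top i (top_le_iff.1 h2)

end IsSerialDatum

/-- Data exhibiting `B` as the endomorphism ring of `M = ⨁ k, P (κ k)`, together with the first
return map `τ'` of the inverse of `τ` to the range of `κ`. -/
structure IsCompression {J : Type} [Fintype J] (P : I → Type)
    [∀ i, AddCommGroup (P i)] [∀ i, Module R (P i)] (τ : I → I) (κ : J → I) (τ' : J → J)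
    (m : J → ℕ) (B M : Type) [Ring B] [AddCommGroup M] [Module R M] [Module B M]
    (inc : ∀ k, P (κ k) →ₗ[R] M) (pr : ∀ k, M →ₗ[R] P (κ k)) : Prop where
  κ_injective : Injective κ
  pos : ∀ k, 0 < m k
  iterate_eq : ∀ k, τ^[m k] (κ (τ' k)) = κ k
  minimal : ∀ k n, 0 < n → n < m k → ∀ l, τ^[n] (κ l) ≠ κ k
  full : ∀ f : M →ₗ[R] M, ∃ b : B, ∀ x, b • x = f x
  faithful : ∀ b : B, (∀ x : M, b • x = 0) → b = 0
  pr_inc : ∀ k, pr k ∘ₗ inc k = LinearMap.id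
  sum_inc_pr : ∀ x, ∑ k, inc k (pr k x) = x

namespace IsCompression

variable {J : Type} [Fintype J] {κ : J → I} {τ' : J → J}
  {m : J → ℕ} {B M : Type} [Ring B] [AddCommGroup M] [Module R M] [Module B M]
  {inc : ∀ k, P (κ k) →ₗ[R] M} {pr : ∀ k, M →ₗ[R] P (κ k)}

section

variable (C : IsCompression P τ κ τ' m B M inc pr)

/-- The element of `B` acting as a given endomorphism of `M`. -/
def act (f : M →ₗ[R] M) : B := Classical.choose (C.full f)

lemma act_smul (f : M →ₗ[R] M) (x : M) : C.act f • x = f x := Classical.choose_spec (C.full f) x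

include C

lemma ext_smul {b b' : B} (h : ∀ x : M, b • x = b' • x) : b = b' :=
  sub_eq_zero.1 (C.faithful _ fun x => by rw [sub_smul, h, sub_self])

lemma pr_inc_apply (k : J) (x : P (κ k)) : pr k (inc k x) = x := LinearMap.congr_fun (C.pr_inc k) x

variable [SMulCommClass R B M]

/-- The embedding of `Hom(P (κ k), M)` as a direct summand of `B`. -/
def section' (k : J) : (P (κ k) →ₗ[R] M) →ₗ[B] B where
  toFun q := C.act (q ∘ₗ pr k)
  map_add' q q' := C.ext_smul fun x => by
    simp [add_smul, C.act_smul]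
  map_smul' b q := C.ext_smul fun x => by
    simp [mul_smul, C.act_smul]

lemma section'_smul (k : J) (q : P (κ k) →ₗ[R] M) (x : M) :
    C.section' k q • x = q (pr k x) := C.act_smul _ _

lemma section'_smul_inc (k : J) (q : P (κ k) →ₗ[R] M) : C.section' k q • inc k = q := by
  refine LinearMap.ext fun x => ?_
  rw [LinearMap.smul_apply, C.section'_smul, C.pr_inc_apply]

/-- `B`-linear maps between the modules `Hom(P (κ k), M)` are precompositions. -/
lemma map_eq_comp {k l : J} (φ : (P (κ k) →ₗ[R] M) →ₗ[B] (P (κ l) →ₗ[R] M))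
    (g : P (κ k) →ₗ[R] M) : φ g = g ∘ₗ (pr k ∘ₗ φ (inc k)) := by
  conv_lhs => rw [← C.section'_smul_inc k g, map_smul]
  refine LinearMap.ext fun x => ?_
  rw [LinearMap.smul_apply, C.section'_smul]
  rfl

end

variable [SMulCommClass R B M]

/-- Precomposition as a `B`-linear map. -/
def precomp (B M : Type) [Ring B] [AddCommGroup M] [Module R M] [Module B M]
    [SMulCommClass R B M] {i j : I} (f : P i →ₗ[R] P j) :
    (P j →ₗ[R] M) →ₗ[B] (P i →ₗ[R] M) where
  toFun g := g ∘ₗ f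
  map_add' _ _ := rfl
  map_smul' _ _ := rfl

variable (C : IsCompression P τ κ τ' m B M inc pr) (D : IsSerialDatum R P τ α)

include C D

lemma mem_of_not_le {k : J} {F : P (κ k) →ₗ[R] P (κ (τ' k))}
    (hfac : ∀ (x : I) (t : P (κ k) →ₗ[R] P x), LinearMap.range t ≤ serialRad α (m k) x →
        ∃ h : P (κ (τ' k)) →ₗ[R] P x, h ∘ₗ F = t)
    (N : Submodule B (P (κ k) →ₗ[R] M)) (hN : N ≠ ⊤) :
    N ≤ LinearMap.range (precomp B M F) := by
  intro f hf
  have hns : ∀ l, ¬ Surjective (pr l ∘ₗ f) := by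
    intro l hl
    obtain rfl := C.κ_injective (D.eq_of_surjective _ _ _ hl)
    refine hN (eq_top_iff.2 fun g _ => ?_)
    let a := LinearEquiv.ofBijective _ (D.bijective_endo _ hl)
    have : g = C.section' k (g ∘ₗ a.symm.toLinearMap) • f := by
      refine LinearMap.ext fun x => ?_
      rw [LinearMap.smul_apply, C.section'_smul]
      change g x = g (a.symm (a x))
      rw [a.symm_apply_apply]
    rw [this]
    exact N.smul_mem _ hf
  have hh : ∀ l, ∃ h : P (κ (τ' k)) →ₗ[R] P (κ l), h ∘ₗ F = pr l ∘ₗ f := by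
    intro l
    apply hfac
    by_cases h0 : pr l ∘ₗ f = 0
    · rw [h0, LinearMap.range_zero]
      exact bot_le
    obtain ⟨e, -, he⟩ := D.exists_eq_serialRad (LinearMap.range (pr l ∘ₗ f))
    rw [he]
    refine serialRad_antitone _ ?_
    by_contra! hlt
    refine C.minimal k e ?_ hlt l (D.eq_iterate_of_range_eq _ h0 he).symm
    by_contra! he0
    obtain rfl : e = 0 := by omega
    exact hns l (LinearMap.range_eq_top.1 he)
  choose h hh using hh
  refine ⟨∑ l, inc l ∘ₗ h l, ?_⟩
  refine LinearMap.ext fun x => ?_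
  change (∑ l, inc l ∘ₗ h l) (F x) = f x
  rw [LinearMap.sum_apply, ← C.sum_inc_pr (f x)]
  exact Finset.sum_congr rfl fun l _ => congrArg (inc l) (LinearMap.congr_fun (hh l) x)

omit C [Fintype J] in
/-- The radical series of the compressed datum. -/
lemma exists_serialRad_eq (F : ∀ k, P (κ k) →ₗ[R] P (κ (τ' k)))
    (hF : ∀ k, LinearMap.range (F k) = serialRad α (m k) (κ (τ' k))) (n : ℕ) (k : J) :
    ∃ G : P (κ k) →ₗ[R] P (κ (τ'^[n] k)),
      LinearMap.range G =
        serialRad α (∑ s ∈ Finset.range n, m (τ'^[s] k)) (κ (τ'^[n] k)) ∧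
      serialRad (P := fun k => P (κ k) →ₗ[R] M) (fun k => precomp B M (F k)) n k =
        LinearMap.range (precomp B M G) := by
  induction n generalizing k with
  | zero =>
    refine ⟨LinearMap.id, LinearMap.range_id, ?_⟩
    rw [serialRad_zero, eq_comm, LinearMap.range_eq_top]
    exact fun g => ⟨g, rfl⟩
  | succ n ih =>
    obtain ⟨G, hG, hG'⟩ := ih (τ' k)
    have hGF : LinearMap.range (G ∘ₗ F k) = serialRad α
        (∑ s ∈ Finset.range (n + 1), m (τ'^[s] k)) (κ (τ'^[n] (τ' k))) := by
      rw [LinearMap.range_comp, hF, D.map_serialRad G hG, Finset.sum_range_succ']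
      rfl
    refine ⟨G ∘ₗ F k, hGF, ?_⟩
    rw [serialRad_succ, hG', ← LinearMap.range_comp]
    rfl

theorem exists_isSerialDatum [Finite I] :
    ∃ (α' : ∀ k, (P (κ (τ' k)) →ₗ[R] M) →ₗ[B] (P (κ k) →ₗ[R] M))
      (D' : IsSerialDatum B (fun k => P (κ k) →ₗ[R] M) τ' α'),
      ∀ k n, D'.length k ≤ n ↔
        D.length (κ (τ'^[n] k)) ≤ ∑ s ∈ Finset.range n, m (τ'^[s] k) := by
  choose F hF hfac using fun k => D.exists_cover_of_eq (C.iterate_eq k)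
  have hbot : ∀ k n, serialRad (P := fun k => P (κ k) →ₗ[R] M) (fun k => precomp B M (F k)) n k = ⊥
      ↔ D.length (κ (τ'^[n] k)) ≤ ∑ s ∈ Finset.range n, m (τ'^[s] k) := by
    intro k n
    obtain ⟨G, hG, hG'⟩ := exists_serialRad_eq (B := B) (M := M) D F hF n k
    rw [hG', ← D.serialRad_eq_bot_iff, ← hG, LinearMap.range_eq_bot, LinearMap.range_eq_bot]
    constructor
    · intro h
      have h1 : inc _ ∘ₗ G = 0 := LinearMap.congr_fun h (inc _)
      rw [← LinearMap.id_comp G, ← C.pr_inc, LinearMap.comp_assoc, h1, LinearMap.comp_zero]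
    · rintro rfl
      exact LinearMap.ext fun g => LinearMap.comp_zero g
  have hle : ∀ k (N : Submodule B (P (κ k) →ₗ[R] M)), N ≠ ⊤ →
      N ≤ LinearMap.range (precomp B M (F k)) := fun k N hN => C.mem_of_not_le D (hfac k) N hN
  refine ⟨fun k => precomp B M (F k), ?_, ?_⟩
  · refine ⟨?_, hle, ?_, ?_, ?_, ?_, ?_, ?_⟩
    · intro k
      refine Module.Projective.of_split (C.section' k) (LinearMap.toSpanSingleton B _ (inc k)) ?_
      exact LinearMap.ext fun q => C.section'_smul_inc k q
    · intro k htop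
      obtain ⟨g, hg⟩ : inc k ∈ LinearMap.range (precomp B M (F k)) := htop ▸ Submodule.mem_top
      refine D.not_id_eq_comp (pr k ∘ₗ g) (F k) ?_ ?_
      · rw [hF, ← serialRad_one]
        exact serialRad_antitone _ (C.pos k)
      · rw [LinearMap.comp_assoc, ← C.pr_inc k, ← hg]
        rfl
    · intro k
      obtain ⟨n, hn⟩ := (Set.finite_range D.length).bddAbove
      have hn' : serialRad (P := fun k => P (κ k) →ₗ[R] M) (fun k => precomp B M (F k)) n k
          = ⊥ := by
        rw [hbot]
        refine (hn ⟨_, rfl⟩).trans ?_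
        calc n = ∑ s ∈ Finset.range n, 1 := by simp
          _ ≤ _ := Finset.sum_le_sum fun s _ => C.pos _
      have hfin : Finite (Submodule B (P (κ k) →ₗ[R] M)) := by
        refine Finite.of_surjective (fun j : Fin (n + 1) =>
          serialRad (P := fun k => P (κ k) →ₗ[R] M) (fun k => precomp B M (F k)) j k) fun N => ?_
        rcases le_serialRad_or_eq_of_le_range hle n k N with h | ⟨j, hj, h⟩
        · rw [hn', le_bot_iff] at h
          exact ⟨⟨n, by omega⟩, hn'.trans h.symm⟩
        · exact ⟨⟨j, by omega⟩, h.symm⟩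
      have : WellFoundedLT (Submodule B (P (κ k) →ₗ[R] M)) := Finite.to_wellFoundedLT
      exact this
    · intro X _ _ K hK
      obtain ⟨x, hx⟩ : ∃ x, x ∉ K := by
        by_contra! h
        exact hK (eq_top_iff.2 fun x _ => h x)
      by_contra! h
      apply hx
      have h1 : (1 : B) = ∑ k, C.section' k (inc k) := C.ext_smul fun y => by
        rw [one_smul, Finset.sum_smul]
        simp only [C.section'_smul]
        rw [C.sum_inc_pr]
      rw [← one_smul B x, h1, Finset.sum_smul]
      refine K.sum_mem fun k _ => h k (LinearMap.toSpanSingleton B X x ∘ₗ C.section' k) ?_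
      exact ⟨inc k, rfl⟩
    · intro k l φ hφ
      obtain ⟨g, hg⟩ := hφ (inc l)
      rw [C.map_eq_comp] at hg
      refine C.κ_injective (D.eq_of_surjective _ _ (pr l ∘ₗ g) fun x => ?_)
      refine ⟨pr k (φ (inc k) x), ?_⟩
      have := congrArg (pr l) (LinearMap.congr_fun hg x)
      rwa [C.pr_inc_apply] at this
    · have haux : ∀ k l, τ' k = τ' l → ¬ m k < m l := by
        intro k l h hlt
        refine C.minimal l (m l - m k) (by omega) (Nat.sub_lt (C.pos l) (C.pos k)) k ?_
        rw [← C.iterate_eq k, ← iterate_add_apply, Nat.sub_add_cancel hlt.le, h, C.iterate_eq]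
      intro k l h
      have : m k = m l := by
        have h1 := haux k l h
        have h2 := haux l k h.symm
        omega
      apply C.κ_injective
      rw [← C.iterate_eq k, ← C.iterate_eq l, h, this]
    · intro k u
      set w := pr (τ' k) ∘ₗ u (inc (τ' k)) with hw
      obtain ⟨e, -, he⟩ := D.exists_eq_serialRad (LinearMap.range w)
      have hle' : LinearMap.range (w ∘ₗ F k) ≤ LinearMap.range (F k) := by
        rw [LinearMap.range_comp, hF, D.map_serialRad w he]
        exact serialRad_antitone _ (by omega)
      have := D.projective (κ k)
      obtain ⟨w', hw'⟩ := Module.projective_lifting_property (F k).rangeRestrict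
        ((w ∘ₗ F k).codRestrict _ fun x => hle' ⟨x, rfl⟩) (LinearMap.surjective_rangeRestrict _)
      have hw2 : ∀ x, F k (w' x) = w (F k x) := fun x =>
        congrArg Subtype.val (LinearMap.congr_fun hw' x)
      refine ⟨precomp B M w', LinearMap.ext fun g => LinearMap.ext fun x => ?_⟩
      change g (F k (w' x)) = u g (F k x)
      rw [C.map_eq_comp u g, hw2]
      rfl
  · intro k n
    rw [← hbot, IsSerialDatum.serialRad_eq_bot_iff]

end IsCompression

end Compression

section SyzygyFiltered

section RadOf

variable {R : Type} [Ring R]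

lemma map_radOf {X Y : Type} [AddCommGroup X] [Module R X] [AddCommGroup Y] [Module R Y]
    (f : X →ₗ[R] Y) (hf : Surjective f) : (radOf R X).map f = radOf R Y := by
  rw [radOf, radOf, Submodule.map_smul'', Submodule.map_top, LinearMap.range_eq_top.2 hf]

lemma nonempty_radOf_equiv {X Y : Type} [AddCommGroup X] [Module R X] [AddCommGroup Y]
    [Module R Y] (e : X ≃ₗ[R] Y) : Nonempty (radOf R X ≃ₗ[R] radOf R Y) :=
  ⟨(e.submoduleMap (radOf R X)).trans (LinearEquiv.ofEq _ _ (map_radOf e.toLinearMap e.surjective))⟩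

lemma IndecomposableModule.bijective_of_retract {Q : ModuleCat.{0} R}
    (hind : IndecomposableModule R Q) {X : Type} [AddCommGroup X] [Module R X] [Nontrivial X]
    {q : Q →ₗ[R] X} {ι : X →ₗ[R] Q} (hqι : ∀ x, q (ι x) = x) : Bijective q := by
  have hcompl : IsCompl (LinearMap.ker q) (LinearMap.range ι) := by
    constructor
    · rw [Submodule.disjoint_def]
      rintro _ h ⟨x, rfl⟩
      rw [LinearMap.mem_ker, hqι] at h
      rw [h, map_zero]
    · rw [codisjoint_iff, eq_top_iff]
      intro x _
      rw [← sub_add_cancel x (ι (q x))]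
      refine Submodule.add_mem_sup ?_ ⟨_, rfl⟩
      rw [LinearMap.mem_ker, map_sub, hqι, sub_self]
  have hsurj : Surjective q := fun x => ⟨ι x, hqι x⟩
  rcases hind.2 _ _ hcompl with h | h
  · exact ⟨LinearMap.ker_eq_bot.1 h, hsurj⟩
  · obtain ⟨y, hy⟩ := exists_ne (0 : X)
    obtain ⟨x, rfl⟩ := hsurj y
    have : x ∈ LinearMap.ker q := h ▸ Submodule.mem_top
    exact absurd this hy

lemma nonempty_socleOf_equiv {X Y : ModuleCat.{0} R} (e : X ≃ₗ[R] Y) :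
    Nonempty (socleOf R X ≃ₗ[R] socleOf R Y) := by
  have key : ∀ {X Y : ModuleCat.{0} R} (e : X ≃ₗ[R] Y),
      (socleOf R X).map e.toLinearMap ≤ socleOf R Y := by
    intro X Y e
    rw [Submodule.map_le_iff_le_comap]
    refine sSup_le fun N hN => ?_
    rw [← Submodule.map_le_iff_le_comap]
    have : IsSimpleModule R N := hN
    exact le_sSup (IsSimpleModule.congr (e.submoduleMap N).symm)
  have heq : (socleOf R X).map e.toLinearMap = socleOf R Y := by
    refine le_antisymm (key e) fun y hy => ?_
    exact ⟨e.symm y, key e.symm ⟨y, hy, rfl⟩, e.apply_symm_apply y⟩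
  exact ⟨(e.submoduleMap _).trans (LinearEquiv.ofEq _ _ heq)⟩

end RadOf

variable {R : Type} [Ring R] {I : Type} {P : I → Type}
  [∀ i, AddCommGroup (P i)] [∀ i, Module R (P i)] {τ : I → I}
  {α : ∀ i, P (τ i) →ₗ[R] P i}

namespace IsSerialDatum

variable (D : IsSerialDatum R P τ α)

include D

lemma range_le_ker {i : I} {S : Type} [AddCommGroup S] [Module R S] [IsSimpleModule R S]
    (f : P i →ₗ[R] S) : LinearMap.range (α i) ≤ LinearMap.ker f := by
  rcases LinearMap.surjective_or_eq_zero f with h | rfl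
  · have hco : IsCoatom (LinearMap.ker f) :=
      LinearMap.isCoatom_ker_of_surjective h
    by_contra hle
    have h1 := hco.2 _ (lt_of_le_of_ne le_sup_left fun h2 => hle (left_eq_sup.1 h2))
    have h2 : LinearMap.ker f ≤ LinearMap.range (α i) := D.le_range i _ hco.1
    rw [sup_eq_right.2 h2] at h1
    exact D.range_ne_top i h1
  · simp

lemma radOf_eq (i : I) : radOf R (P i) = LinearMap.range (α i) := by
  apply le_antisymm
  · have hco : IsCoatom (LinearMap.range (α i)) :=
      ⟨D.range_ne_top i, fun N hN => by
        by_contra h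
        exact (D.le_range i N h).not_gt hN⟩
    rw [radOf, Ideal.jacobson_bot]
    exact (Ring.jacobson_smul_top_le _ _).trans (sInf_le hco)
  · intro y hy
    obtain ⟨g, f, hfg⟩ := D.exists_retract_ring i
    have h1 : y = g y • f 1 := by
      rw [← map_smul, smul_eq_mul, mul_one]
      exact (LinearMap.congr_fun hfg y).symm
    rw [h1]
    refine Submodule.smul_mem_smul ?_ Submodule.mem_top
    rw [Ideal.jacobson_bot, Ring.jacobson_eq_sInf_isMaximal, Submodule.mem_sInf]
    intro J hJ
    have : IsSimpleModule R (R ⧸ J) := isSimpleModule_iff_isCoatom.2 (Ideal.isMaximal_def.1 hJ)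
    have h2 := D.range_le_ker (J.mkQ ∘ₗ g) hy
    simpa using h2

/-- The projective covering a module with top `i` is `P i`. -/
lemma eq_of_surjective_serialQuot {a s : I} (f : P a →ₗ[R] serialQuot α (s, 1))
    (hf : Surjective f) : a = s := by
  have := D.projective a
  obtain ⟨g, hg⟩ := Module.projective_lifting_property (serialRad α 1 s).mkQ f
    (Submodule.mkQ_surjective _)
  refine D.eq_of_surjective _ _ g (LinearMap.range_eq_top.1 (D.range_eq_top_of_not_le g ?_))
  intro hle
  have := D.nontrivial_serialQuot (w := (s, 1)) one_ne_zero
  obtain ⟨y, hy⟩ := exists_ne (0 : serialQuot α (s, 1))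
  obtain ⟨x, rfl⟩ := hf y
  apply hy
  rw [← hg]
  change (serialRad α 1 s).mkQ (g x) = 0
  rw [Submodule.mkQ_apply, Submodule.Quotient.mk_eq_zero, serialRad_one]
  exact hle ⟨x, rfl⟩

lemma nonempty_equiv_of_isProjCoverOf {Q S : ModuleCat.{0} R} (h : IsProjCoverOf R Q S) {s : I}
    (e : S ≃ₗ[R] serialQuot α (s, 1)) : Nonempty (Q ≃ₗ[R] P s) := by
  obtain ⟨hQ, -, f, hf, hker⟩ := h
  have := D.projective s
  obtain ⟨g, hg⟩ := Module.projective_lifting_property (e.toLinearMap ∘ₗ f)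
    (serialRad α 1 s).mkQ (e.surjective.comp hf)
  have hg' : ∀ x, e (f (g x)) = (serialRad α 1 s).mkQ x := fun x => LinearMap.congr_fun hg x
  have hsurj : LinearMap.range g = ⊤ := by
    apply hker
    refine eq_top_iff.2 fun y _ => ?_
    obtain ⟨x, hx⟩ := Submodule.mkQ_surjective _ (e (f y))
    rw [← hg'] at hx
    rw [← sub_add_cancel y (g x)]
    refine Submodule.add_mem_sup ?_ ⟨x, rfl⟩
    rw [LinearMap.mem_ker, map_sub, e.injective hx, sub_self]
  obtain ⟨t, ht⟩ := Module.projective_lifting_property g LinearMap.id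
    (LinearMap.range_eq_top.1 hsurj)
  have ht' : ∀ y, g (t y) = y := fun y => LinearMap.congr_fun ht y
  have htop : LinearMap.range t = ⊤ := by
    refine D.range_eq_top_of_not_le t fun hle => ?_
    have := D.nontrivial_serialQuot (w := (s, 1)) one_ne_zero
    obtain ⟨z, hz⟩ := exists_ne (0 : serialQuot α (s, 1))
    obtain ⟨y, rfl⟩ := (e.surjective.comp hf) z
    apply hz
    change e (f y) = 0
    rw [← ht' y, hg', Submodule.mkQ_apply, Submodule.Quotient.mk_eq_zero, serialRad_one]
    exact hle ⟨y, rfl⟩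
  exact ⟨LinearEquiv.ofBijective t ⟨fun a b hab => by rw [← ht' a, ← ht' b, hab],
    LinearMap.range_eq_top.1 htop⟩⟩

lemma exists_equiv_of_indecomposable [Finite I] {Q : ModuleCat.{0} R} (hfin : Module.Finite R Q)
    (hind : IndecomposableModule R Q) :
    ∃ w : I × ℕ, w.2 ≠ 0 ∧ w.2 ≤ D.length w.1 ∧ Nonempty (Q ≃ₗ[R] serialQuot α w) := by
  have := D.isNoetherianRing
  have : IsNoetherian R Q := isNoetherian_of_isNoetherianRing_of_finite R Q
  have := hind.1
  obtain ⟨w, C, hw0, hw, -, ⟨e⟩⟩ := D.exists_summand Q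
  have := D.nontrivial_serialQuot hw0
  exact ⟨w, hw0, hw, ⟨LinearEquiv.ofBijective _ (hind.bijective_of_retract
    (q := LinearMap.fst R _ _ ∘ₗ e.toLinearMap) (ι := e.symm.toLinearMap ∘ₗ LinearMap.inl R _ _)
    fun x => by simp)⟩⟩

lemma nonempty_equiv_of_projective [Finite I] {Q : ModuleCat.{0} R} (hQ : Module.Projective R Q)
    (hfin : Module.Finite R Q) (hind : IndecomposableModule R Q) :
    ∃ k, Nonempty (Q ≃ₗ[R] P k) := by
  obtain ⟨w, hw0, hw, ⟨e⟩⟩ := D.exists_equiv_of_indecomposable hfin hind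
  have hpr : Module.Projective R (serialQuot α w) := Module.Projective.of_equiv e
  have hlen := D.length_of_projective hw0 hw hpr
  refine ⟨w.1, ⟨e.trans (Submodule.quotEquivOfEqBot _ ?_)⟩⟩
  rw [D.serialRad_eq_bot_iff, hlen]

lemma isAtom_serialRad (k : I) : IsAtom (serialRad α (D.length k - 1) k) := by
  have hpos := D.length_pos k
  refine ⟨fun h => ?_, fun N hN => ?_⟩
  · rw [D.serialRad_eq_bot_iff] at h
    omega
  · obtain ⟨j, hj, rfl⟩ := D.exists_eq_serialRad N
    rw [D.serialRad_eq_bot_iff]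
    by_contra! hlt
    exact hN.not_ge (serialRad_antitone k (by omega))

lemma socleOf_eq (k : I) :
    socleOf R (ModuleCat.of R (P k)) = serialRad α (D.length k - 1) k := by
  have hpos := D.length_pos k
  apply le_antisymm
  · refine sSup_le fun N hN => ?_
    have hatom : IsAtom N := isSimpleModule_iff_isAtom.1 hN
    obtain ⟨j, hj, rfl⟩ := D.exists_eq_serialRad N
    refine serialRad_antitone k ?_
    by_contra! hlt
    exact (D.isAtom_serialRad k).1 (hatom.2 _ (lt_of_le_of_ne (serialRad_antitone k (by omega))
      fun h => by
        have := D.serialRad_inj (by omega) hj h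
        omega))
  · exact le_sSup (isSimpleModule_iff_isAtom.2 (D.isAtom_serialRad k))

lemma exists_of_isInSPrime [Finite I] {S : ModuleCat.{0} R} (h : IsInSPrime R S) :
    ∃ k, Nonempty (S ≃ₗ[R] serialQuot α (τ^[D.length k] k, 1)) := by
  obtain ⟨hS, T, Q, ⟨hT, X, hX, hXf, hXi, ⟨eT⟩⟩, hQ, ⟨eS⟩⟩ := h
  obtain ⟨k, ⟨eX⟩⟩ := D.nonempty_equiv_of_projective hX hXf hXi
  obtain ⟨eX'⟩ := nonempty_socleOf_equiv (Y := ModuleCat.of R (P k)) eX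
  obtain ⟨t, ⟨et⟩⟩ := D.exists_equiv_of_isSimpleModule T
  obtain ⟨s, ⟨es⟩⟩ := D.exists_equiv_of_isSimpleModule S
  obtain ⟨eQ⟩ := D.nonempty_equiv_of_isProjCoverOf hQ et
  obtain ⟨er⟩ := nonempty_radOf_equiv eQ
  have hpos := D.length_pos k
  have ht : τ^[D.length k - 1] k = t := by
    obtain ⟨f, hf⟩ := D.exists_range_eq (D.length k - 1) k
    let e1 : LinearMap.range f ≃ₗ[R] serialQuot α (t, 1) :=
      (LinearEquiv.ofEq _ _ (hf.trans (D.socleOf_eq k).symm)).trans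
        (eX'.symm.trans (eT.symm.trans et))
    exact D.eq_of_surjective_serialQuot (e1.toLinearMap ∘ₗ f.rangeRestrict)
      (e1.surjective.comp f.surjective_rangeRestrict)
  have hs : τ t = s := by
    let e1 : LinearMap.range (α t) ≃ₗ[R] radOf R Q :=
      (LinearEquiv.ofEq _ _ (D.radOf_eq t).symm).trans er.symm
    let f : P (τ t) →ₗ[R] serialQuot α (s, 1) :=
      (eS.trans es).toLinearMap ∘ₗ (radOf R (radOf R Q)).mkQ ∘ₗ e1.toLinearMap ∘ₗ
        (α t).rangeRestrict
    refine D.eq_of_surjective_serialQuot f ?_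
    exact (eS.trans es).surjective.comp ((Submodule.mkQ_surjective _).comp
      (e1.surjective.comp (α t).surjective_rangeRestrict))
  refine ⟨k, ?_⟩
  rw [show D.length k = (D.length k - 1) + 1 by omega, iterate_succ_apply', ht, hs]
  exact ⟨es⟩

lemma isProjCoverOf_serialQuot (s : I) :
    IsProjCoverOf R (ModuleCat.of R (P s)) (serialQuot α (s, 1)) := by
  refine ⟨D.projective s, D.finite s, (serialRad α 1 s).mkQ, Submodule.mkQ_surjective _, ?_⟩
  rw [Submodule.ker_mkQ, serialRad_one]
  intro K hK
  by_contra hne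
  rw [sup_eq_left.2 (D.le_range s K hne)] at hK
  exact D.range_ne_top s hK

lemma isInSPrime_serialQuot (hlen : ∀ i, 2 ≤ D.length i) (k : I) :
    IsInSPrime R (serialQuot α (τ^[D.length k] k, 1)) := by
  have hpos := D.length_pos k
  refine ⟨D.isSimpleModule_serialQuot _, serialQuot α (τ^[D.length k - 1] k, 1),
    ModuleCat.of R (P (τ^[D.length k - 1] k)), ⟨D.isSimpleModule_serialQuot _,
    ModuleCat.of R (P k), D.projective k, D.finite k, ⟨?_, ?_⟩, ?_⟩,
    D.isProjCoverOf_serialQuot _, ?_⟩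
  · by_contra h
    rw [not_nontrivial_iff_subsingleton] at h
    exact D.range_ne_top k (Subsingleton.elim (h := (Submodule.subsingleton_iff R).2 h) _ _)
  · intro N N' hc
    rcases D.le_total N N' with h | h
    · exact Or.inl (hc.disjoint.eq_bot_of_le h)
    · exact Or.inr (by rw [← hc.sup_eq_top, sup_eq_left.2 h])
  · obtain ⟨f, hf⟩ := D.exists_range_eq (D.length k - 1) k
    have hsimple : IsSimpleModule R (serialRad α (D.length k - 1) k) :=
      isSimpleModule_iff_isAtom.2 (D.isAtom_serialRad k)
    obtain ⟨t, ⟨et⟩⟩ := D.exists_equiv_of_isSimpleModule (serialRad α (D.length k - 1) k)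
    let e1 : LinearMap.range f ≃ₗ[R] serialQuot α (t, 1) := (LinearEquiv.ofEq _ _ hf).trans et
    have ht := D.eq_of_surjective_serialQuot (e1.toLinearMap ∘ₗ f.rangeRestrict)
      (e1.surjective.comp f.surjective_rangeRestrict)
    rw [ht, D.socleOf_eq k]
    exact ⟨et.symm⟩
  · set t := τ^[D.length k - 1] k with ht
    have hst : τ^[D.length k] k = τ t := by
      rw [ht, ← iterate_succ_apply' τ]
      congr 1
      omega
    rw [hst]
    obtain ⟨e1⟩ : Nonempty (LinearMap.range (α t) ≃ₗ[R] radOf R (P t)) :=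
      ⟨LinearEquiv.ofEq _ _ (D.radOf_eq t).symm⟩
    set f : P (τ t) →ₗ[R] radOf R (P t) := e1.toLinearMap ∘ₗ (α t).rangeRestrict with hf
    have hfs : Surjective f := e1.surjective.comp (α t).surjective_rangeRestrict
    have hα : α t ≠ 0 := fun h => by
      have h1 : serialRad α 1 t = ⊥ := by rw [serialRad_one, h, LinearMap.range_zero]
      rw [D.serialRad_eq_bot_iff] at h1
      have := hlen t
      omega
    have hker : LinearMap.ker f ≤ LinearMap.range (α (τ t)) :=
      D.ker_le_range fun h => hα (LinearMap.ext fun x => by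
        have h1 := LinearMap.congr_fun h x
        change e1 ((α t).rangeRestrict x) = 0 at h1
        rw [LinearEquiv.map_eq_zero_iff] at h1
        exact congrArg Subtype.val h1)
    have hkq : LinearMap.ker ((radOf R (radOf R (P t))).mkQ ∘ₗ f) = serialRad α 1 (τ t) := by
      rw [LinearMap.ker_comp, Submodule.ker_mkQ, ← map_radOf f hfs, Submodule.comap_map_eq,
        D.radOf_eq, sup_eq_left.2 hker, serialRad_one]
    exact ⟨(LinearMap.quotKerEquivOfSurjective ((radOf R (radOf R (P t))).mkQ ∘ₗ f)
      ((Submodule.mkQ_surjective _).comp hfs)).symm.trans (Submodule.quotEquivOfEq _ _ hkq)⟩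

end IsSerialDatum

end SyzygyFiltered

section SyzygyFiltered

variable {R : Type} [Ring R] {I : Type} {P : I → Type}
  [∀ i, AddCommGroup (P i)] [∀ i, Module R (P i)] {τ : I → I}
  {α : ∀ i, P (τ i) →ₗ[R] P i}

namespace IsSerialDatum

lemma length_le_add_one (D : IsSerialDatum R P τ α) (i : I) :
    D.length i ≤ D.length (τ i) + 1 := by
  have := D.length_iterate 1 i
  rw [iterate_one] at this
  omega

/-- Passing to the syzygy filtered algebra lowers the delooping level by two. -/
theorem delAlg_le_add_two_iff [Finite I] (D : IsSerialDatum R P τ α)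
    (hlen : ∀ i, 2 ≤ D.length i) {B : Type} [Ring B] (hB : IsSyzygyFilteredAlgebra R B) (d : ℕ) :
    delAlg R ≤ (d + 2 : ℕ) ↔ delAlg B ≤ d := by
  obtain ⟨J, _, Sf, Pf, hSP, hdist, hall, ⟨φ⟩⟩ := hB
  have hsimple : ∀ k, ∃ i, Nonempty (Sf k ≃ₗ[R] serialQuot α (i, 1)) := fun k => by
    have := (hSP k).1.1
    exact D.exists_equiv_of_isSimpleModule (Sf k)
  choose κ hκ using hsimple
  have eS : ∀ k, Sf k ≃ₗ[R] serialQuot α (κ k, 1) := fun k => (hκ k).some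
  have eP : ∀ k, Pf k ≃ₗ[R] P (κ k) := fun k =>
    (D.nonempty_equiv_of_isProjCoverOf (hSP k).2 (eS k)).some
  have hκinj : Injective κ := fun k l h => hdist k l
    ⟨(eS k).trans ((LinearEquiv.cast (R := R) (M := fun i => serialQuot α (i, 1)) h).trans
      (eS l).symm)⟩
  have hpos : ∀ i, ((i, 1) : I × ℕ).2 ≤ D.length ((i, 1) : I × ℕ).1 := D.length_pos
  have hκrange : Set.range κ = Set.range fun i => τ^[D.length i] i := by
    apply Set.Subset.antisymm
    · rintro _ ⟨k, rfl⟩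
      obtain ⟨i, ⟨e⟩⟩ := D.exists_of_isInSPrime (hSP k).1
      exact ⟨i, (congrArg Prod.fst (D.eq_of_equiv (hpos _) (hpos _) one_ne_zero
        ((eS k).symm.trans e))).symm⟩
    · rintro _ ⟨i, rfl⟩
      obtain ⟨k, ⟨e⟩⟩ := hall _ (D.isInSPrime_serialQuot hlen i)
      exact ⟨k, (congrArg Prod.fst (D.eq_of_equiv (hpos _) (hpos _) one_ne_zero
        (e.trans (eS k)))).symm⟩
  let σ : Equiv.Perm I := Equiv.ofBijective τ (Finite.injective_iff_bijective.1 D.injective)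
  have hex : ∀ k, ∃ n, 0 < n ∧ ∃ l, τ^[n] (κ l) = κ k := fun k =>
    ⟨orderOf σ, orderOf_pos σ, k, by
      change (⇑σ)^[orderOf σ] (κ k) = κ k
      rw [Equiv.Perm.iterate_eq_pow, pow_orderOf_eq_one, Equiv.Perm.one_apply]⟩
  choose τ' hτ' using fun k => (Nat.find_spec (hex k)).2
  let M := DirectSum J fun k => Pf k
  let _ : Module B M := Module.compHom M φ.toRingHom
  have hsmul : ∀ (b : B) (x : M), b • x = φ b x := fun _ _ => rfl
  have : SMulCommClass R B M := ⟨fun r b x => by rw [hsmul, hsmul, map_smul]⟩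
  have C : IsCompression P τ κ τ' (fun k => Nat.find (hex k)) B M
      (fun k => DirectSum.lof R J (fun k => Pf k) k ∘ₗ (eP k).symm.toLinearMap)
      (fun k => (eP k).toLinearMap ∘ₗ DirectSum.component R J (fun k => Pf k) k) :=
    { κ_injective := hκinj
      pos := fun k => (Nat.find_spec (hex k)).1
      iterate_eq := hτ'
      minimal := fun k n h0 hn l h => Nat.find_min (hex k) hn ⟨h0, l, h⟩
      full := fun f => ⟨φ.symm f, fun x => by rw [hsmul, φ.apply_symm_apply]⟩
      faithful := fun b h => by
        rw [← map_eq_zero_iff φ φ.injective]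
        exact LinearMap.ext h
      pr_inc := fun k => LinearMap.ext fun x =>
        (congrArg (eP k) (DirectSum.component.lof_self R k _)).trans
          ((eP k).apply_symm_apply x)
      sum_inc_pr := fun x => by
        conv_rhs => rw [← DirectSum.sum_univ_of x]
        exact Finset.sum_congr rfl fun k _ => by
          simp only [LinearMap.comp_apply, LinearEquiv.coe_coe, LinearEquiv.symm_apply_apply]
          rfl }
  obtain ⟨α', D', hD'⟩ := C.exists_isSerialDatum D
  let σ' : Equiv.Perm J := Equiv.ofBijective τ' (Finite.injective_iff_bijective.1 D'.injective)
  rw [D.delAlg_le_iff, D'.delAlg_le_iff]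
  exact forall_serialDeloops_add_two_iff σ D.length σ' D'.length κ (fun k => Nat.find (hex k))
    D.length_pos D.length_le_add_one (fun w _ => D.length_iterate _ _)
    D'.length_pos D'.length_le_add_one (fun w _ => D'.length_iterate _ _) hκrange
    C.pos C.iterate_eq C.minimal hD' d

end IsSerialDatum

end SyzygyFiltered

section Nakayama

variable {A : Type} [Ring A] {X Y Z : Type} [AddCommGroup X] [Module A X]
  [AddCommGroup Y] [Module A Y] [AddCommGroup Z] [Module A Z]

lemma exists_greatest_ne_top [IsNoetherian A X] [Nontrivial X]
    (hX : ∀ N N' : Submodule A X, N ≤ N' ∨ N' ≤ N) :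
    ∃ m : Submodule A X, m ≠ ⊤ ∧ ∀ N : Submodule A X, N ≠ ⊤ → N ≤ m := by
  obtain ⟨m, hm, -⟩ := (eq_top_or_exists_le_coatom (⊥ : Submodule A X)).resolve_left bot_ne_top
  refine ⟨m, hm.1, fun N hN => (hX N m).elim id fun h => ?_⟩
  rcases h.lt_or_eq with h | h
  · exact absurd (hm.2 N h) hN
  · exact h.ge

/-- Maps out of a local direct summand of the regular module factor through each other when
indecomposable right modules are uniserial. -/
lemma eq_mul_right_or (hA : IsNakayamaRing Aᵐᵒᵖ) {m : Submodule A X} [IsNoetherian A X]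
    (hm : m ≠ ⊤) (hmax : ∀ N : Submodule A X, N ≠ ⊤ → N ≤ m) {ι : X →ₗ[A] A} {r : A →ₗ[A] X}
    (hr : r ∘ₗ ι = LinearMap.id) (f g : X →ₗ[A] A) :
    (∃ a : A, ∀ x, f x = g x * a) ∨ ∃ a : A, ∀ x, g x = f x * a := by
  have hr' : ∀ x, r (ι x) = x := fun x => LinearMap.congr_fun hr x
  have hmul : ∀ (h : A →ₗ[A] A) (a : A), h a = a * h 1 := fun h a => by
    rw [← smul_eq_mul, ← map_smul, smul_eq_mul, mul_one]
  have hgen : ∀ h : X →ₗ[A] A, h = MulOpposite.op (h (r 1)) • ι := fun h =>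
    LinearMap.ext fun x => by
      rw [LinearMap.smul_apply, op_smul_eq_mul]
      exact (congrArg h (hr' x)).symm.trans (hmul (h ∘ₗ r) (ι x))
  let E : ModuleCat.{0} Aᵐᵒᵖ := ModuleCat.of Aᵐᵒᵖ (X →ₗ[A] A)
  have hfin : Module.Finite Aᵐᵒᵖ E :=
    ⟨⟨{ι}, top_le_iff.1 fun h _ => by
      rw [hgen h]
      exact Submodule.smul_mem _ _ (Submodule.subset_span (by simp))⟩⟩
  have hmem : ∀ (N : Submodule Aᵐᵒᵖ E) (n : X →ₗ[A] A), n ∈ N → Surjective (r ∘ₗ n) → N = ⊤ := by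
    intro N n hn hs
    let w := LinearEquiv.ofBijective (r ∘ₗ n)
      ⟨IsNoetherian.injective_of_surjective_endomorphism _ hs, hs⟩
    have h1 : ι = MulOpposite.op ((ι ∘ₗ w.symm.toLinearMap ∘ₗ r) 1) • n :=
      LinearMap.ext fun x => by
        rw [LinearMap.smul_apply, op_smul_eq_mul, ← hmul]
        exact (congrArg ι (w.symm_apply_apply x)).symm
    have h2 : ι ∈ N := by
      rw [h1]
      exact N.smul_mem _ hn
    exact top_le_iff.1 fun h _ => by
      rw [hgen h]
      exact N.smul_mem _ h2
  have hind : IndecomposableModule Aᵐᵒᵖ E := by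
    constructor
    · refine ⟨ι, 0, fun h => hm (top_le_iff.1 fun x _ => ?_)⟩
      rw [← hr' x, show ι x = 0 from LinearMap.congr_fun h x, map_zero]
      exact m.zero_mem
    · intro N N' hN
      obtain ⟨n, hn, n', hn', hsum⟩ := Submodule.mem_sup.1
        (show ι ∈ N ⊔ N' by rw [hN.sup_eq_top]; exact Submodule.mem_top)
      by_cases h : Surjective (r ∘ₗ n)
      · exact Or.inr (hmem N n hn h)
      by_cases h' : Surjective (r ∘ₗ n')
      · left
        have := hmem N' n' hn' h'
        subst this
        exact hN.inf_eq_bot ▸ (inf_top_eq N).symm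
      · exfalso
        rw [← LinearMap.range_eq_top] at h h'
        refine hm (top_le_iff.1 fun x _ => ?_)
        have h1 : x = r (n x) + r (n' x) := by
          rw [← map_add]
          exact (hr' x).symm.trans (congrArg r (LinearMap.congr_fun hsum x).symm)
        rw [h1]
        exact m.add_mem (hmax _ h ⟨x, rfl⟩) (hmax _ h' ⟨x, rfl⟩)
  have key : ∀ f g : X →ₗ[A] A, Submodule.span Aᵐᵒᵖ {(f : E)} ≤ Submodule.span Aᵐᵒᵖ {(g : E)} →
      ∃ a : A, ∀ x, f x = g x * a := by
    intro f g h
    obtain ⟨a, ha⟩ := Submodule.mem_span_singleton.1 (h (Submodule.mem_span_singleton_self _))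
    exact ⟨a.unop, fun x => (LinearMap.congr_fun ha x).symm⟩
  exact (hA.2 E hfin hind (Submodule.span Aᵐᵒᵖ {(f : E)}) (Submodule.span Aᵐᵒᵖ {(g : E)})).imp
    (key f g) (key g f)

lemma surjective_of_le_map {h : X →ₗ[A] Y} {m : Submodule A X} {n : Submodule A Y}
    (hm : m ≠ ⊤) (hmax : ∀ N : Submodule A X, N ≠ ⊤ → N ≤ m)
    (hn : n ≠ ⊥) (hnax : ∀ N : Submodule A Y, N ≠ ⊤ → N ≤ n) (hle : n ≤ m.map h) :
    Surjective h := by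
  rw [← LinearMap.range_eq_top]
  by_contra hne
  have h1 : LinearMap.ker h = ⊤ := by
    by_contra hk
    refine hm (top_le_iff.1 fun x _ => ?_)
    obtain ⟨y, hy, hxy⟩ := hle (hnax _ hne ⟨x, rfl⟩)
    have h2 : x - y ∈ m := hmax _ hk (by rw [LinearMap.mem_ker, map_sub, hxy, sub_self])
    simpa using m.add_mem h2 hy
  rw [LinearMap.ker_eq_top.1 h1, Submodule.map_zero] at hle
  exact hn (le_bot_iff.1 hle)

/-- Every direct summand of the regular module is generated by indecomposable ones. -/
lemma le_sSup_indecomposable [IsArtinianRing A] (N : Submodule A A) (hN : IsComplemented N) :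
    N ≤ sSup {N : Submodule A A | IsComplemented N ∧
      IndecomposableModule A (ModuleCat.of A N)} := by
  induction N using WellFoundedLT.induction with
  | ind N ih =>
    by_cases hind : IndecomposableModule A (ModuleCat.of A N)
    · exact le_sSup ⟨hN, hind⟩
    rw [IndecomposableModule, not_and_or] at hind
    rcases hind with h | h
    · have : Subsingleton N := not_nontrivial_iff_subsingleton.1 h
      rw [Submodule.subsingleton_iff_eq_bot.1 this]
      exact bot_le
    · push Not at h
      obtain ⟨(K : Submodule A N), (K' : Submodule A N), hK, hK0, hK1⟩ := h
      obtain ⟨C, hC⟩ := hN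
      have hsum : K.map N.subtype ⊔ K'.map N.subtype = N := by
        rw [← Submodule.map_sup, hK.sup_eq_top, Submodule.map_top, Submodule.range_subtype]
      have hinf : K.map N.subtype ⊓ K'.map N.subtype = ⊥ := by
        rw [← Submodule.map_inf _ N.injective_subtype, hK.inf_eq_bot, Submodule.map_bot]
      have hlt : ∀ K : Submodule A N, K ≠ ⊤ → K.map N.subtype < N := fun K hK =>
        lt_of_le_of_ne (Submodule.map_subtype_le N K) fun h => hK
          (Submodule.map_injective_of_injective N.injective_subtype
            (by rw [h, Submodule.map_top, Submodule.range_subtype]))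
      have hcompl : ∀ a b : Submodule A A, a ⊔ b = N → a ⊓ b = ⊥ → IsComplemented a :=
        fun a b h1 h2 => ⟨b ⊔ C, by
          have hd : Disjoint (a ⊔ b) C := h1 ▸ hC.disjoint
          exact ⟨(disjoint_iff.2 h2).disjoint_sup_right_of_disjoint_sup_left hd,
            codisjoint_iff.2 (by rw [← sup_assoc, h1, hC.sup_eq_top])⟩⟩
      have hK1' : K' ≠ ⊤ := by
        rintro rfl
        exact hK0 (by simpa using hK.inf_eq_bot)
      exact hsum.ge.trans <| sup_le (ih _ (hlt K hK1) (hcompl _ _ hsum hinf))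
        (ih _ (hlt K' hK1') (hcompl _ _ (by rw [sup_comm, hsum]) (by rw [inf_comm, hinf])))

end Nakayama

section NakayamaDatum

variable {A : Type} [Ring A]

lemma exists_indecomposable_generators [IsArtinianRing A] :
    ∃ (I : Type) (_ : Finite I) (N : I → Submodule A A),
      (∀ i, IsComplemented (N i) ∧ IndecomposableModule A (ModuleCat.of A (N i))) ∧
      (∀ i j, Nonempty (N i ≃ₗ[A] N j) → i = j) ∧
      ∀ (M : Type) [AddCommGroup M] [Module A M] (K : Submodule A M), K ≠ ⊤ →
        ∃ (i : I) (f : N i →ₗ[A] M), ¬ LinearMap.range f ≤ K := by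
  have hcpt : IsCompactElement (⊤ : Submodule A A) :=
    (Submodule.fg_iff_compact _).1 Module.Finite.fg_top
  rw [CompleteLattice.isCompactElement_iff_exists_le_sSup_of_le_sSup] at hcpt
  obtain ⟨t, ht, htop⟩ := hcpt _ (le_sSup_indecomposable ⊤ ⟨⊥, isCompl_top_bot⟩)
  let s : Setoid t :=
    { r := fun X Y => Nonempty (X.1 ≃ₗ[A] Y.1)
      iseqv := ⟨fun _ => ⟨LinearEquiv.refl A _⟩, fun ⟨e⟩ => ⟨e.symm⟩,
        fun ⟨e⟩ ⟨e'⟩ => ⟨e.trans e'⟩⟩ }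
  refine ⟨Quotient s, inferInstance, fun i => i.out.1, fun i => ht i.out.2, fun i j h => ?_, ?_⟩
  · rw [← Quotient.out_eq i, ← Quotient.out_eq j]
    exact Quotient.sound h
  · intro M _ _ K hK
    by_contra! hcon
    refine hK (top_le_iff.1 fun x _ => ?_)
    let f := LinearMap.toSpanSingleton A M x
    have h1 : t.sup id ≤ K.comap f := Finset.sup_le fun n hn y hy => by
      obtain ⟨e⟩ : Nonempty (((Quotient.mk s ⟨n, hn⟩).out).1 ≃ₗ[A] n) :=
        Quotient.mk_out (s := s) ⟨n, hn⟩
      refine hcon (Quotient.mk s ⟨n, hn⟩) (f ∘ₗ n.subtype ∘ₗ e.toLinearMap)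
        ⟨e.symm ⟨y, hy⟩, ?_⟩
      simp
    have h2 := h1 (htop (Submodule.mem_top : (1 : A) ∈ ⊤))
    simpa [f] using h2

/-- A cyclic Nakayama algebra has a serial datum without simple projectives. -/
theorem IsCyclicNakayama.exists_isSerialDatum (hA : IsCyclicNakayama A) :
    ∃ (I : Type) (_ : Finite I) (N : I → Submodule A A) (τ : I → I)
      (α : ∀ i, N (τ i) →ₗ[A] N i) (D : IsSerialDatum A (fun i => N i) τ α),
      ∀ i, 2 ≤ D.length i := by
  obtain ⟨⟨⟨hart, huni⟩, hop⟩, -, hsp⟩ := hA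
  obtain ⟨I, hI, N, hN, hiso, hgen⟩ := exists_indecomposable_generators (A := A)
  choose C hC using fun i => (hN i).1
  have hr : ∀ i, (N i).projectionOnto (C i) (hC i) ∘ₗ (N i).subtype = LinearMap.id := fun i =>
    LinearMap.ext fun x => Submodule.projectionOnto_apply_left (hC i) x
  have hproj : ∀ i, Module.Projective A (N i) := fun i => Module.Projective.of_split _ _ (hr i)
  have hchain : ∀ i (X Y : Submodule A (N i)), X ≤ Y ∨ Y ≤ X := fun i =>
    huni (ModuleCat.of A (N i)) (inferInstanceAs (Module.Finite A (N i))) (hN i).2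
  have hnt : ∀ i, Nontrivial (N i) := fun i => (hN i).2.1
  choose m hm hmax using fun i => exists_greatest_ne_top (hchain i)
  have hm0 : ∀ i, m i ≠ ⊥ := fun i h => hsp (ModuleCat.of A (N i))
    ((isSimpleModule_iff A (N i)).2 ⟨fun X => by
      by_contra! hX
      exact hX.1 (le_bot_iff.1 (h ▸ hmax i X hX.2))⟩) (hproj i)
  have hsurj : ∀ i j (f : N i →ₗ[A] N j), Surjective f → i = j := by
    intro i j f hf
    have := hproj j
    obtain ⟨g, hg⟩ := Module.projective_lifting_property f LinearMap.id hf
    have hg' : ∀ y, f (g y) = y := fun y => LinearMap.congr_fun hg y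
    have hinj : Injective f := by
      rw [← LinearMap.ker_eq_bot, eq_bot_iff]
      rcases hchain i (LinearMap.ker f) (LinearMap.range g) with h | h
      · intro x hx
        obtain ⟨y, rfl⟩ := h hx
        rw [← hg' y, LinearMap.mem_ker.1 hx, map_zero]
        exact Submodule.zero_mem _
      · obtain ⟨y, hy⟩ := exists_ne (0 : N j)
        exact absurd ((hg' y).symm.trans (h ⟨y, rfl⟩)) hy
    exact hiso i j ⟨LinearEquiv.ofBijective f ⟨hinj, hf⟩⟩
  have hfac : ∀ i j k (f : N i →ₗ[A] N j) (g : N i →ₗ[A] N k),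
      (∃ h : N k →ₗ[A] N j, f = h ∘ₗ g) ∨ ∃ h : N j →ₗ[A] N k, g = h ∘ₗ f := by
    have key : ∀ i j k (f : N i →ₗ[A] N j) (g : N i →ₗ[A] N k) (a : A),
        (∀ x, (f x : A) = g x * a) → ∃ h : N k →ₗ[A] N j, f = h ∘ₗ g := by
      intro i j k f g a ha
      refine ⟨(N j).projectionOnto (C j) (hC j) ∘ₗ LinearMap.toSpanSingleton A A a ∘ₗ
        (N k).subtype, LinearMap.ext fun x => ?_⟩
      simp only [LinearMap.comp_apply, Submodule.subtype_apply, LinearMap.toSpanSingleton_apply,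
        smul_eq_mul, ← ha]
      exact (Submodule.projectionOnto_apply_left (hC j) (f x)).symm
    intro i j k f g
    refine (eq_mul_right_or hop (hm i) (hmax i) (hr i) ((N j).subtype ∘ₗ f)
      ((N k).subtype ∘ₗ g)).imp ?_ ?_
    · rintro ⟨a, ha⟩
      exact key i j k f g a ha
    · rintro ⟨a, ha⟩
      exact key i k j g f a ha
  have hcover : ∀ i, ∃ j, ∃ f : N j →ₗ[A] N i, LinearMap.range f = m i := by
    intro i
    have : Nontrivial (m i) := Submodule.nontrivial_iff_ne_bot.2 (hm0 i)
    obtain ⟨K, hK, hKmax⟩ := exists_greatest_ne_top (X := m i) (A := A) fun X Y => by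
      have h := hchain i (X.map (m i).subtype) (Y.map (m i).subtype)
      rwa [Submodule.map_le_map_iff_of_injective (m i).injective_subtype,
        Submodule.map_le_map_iff_of_injective (m i).injective_subtype] at h
    obtain ⟨j, f, hf⟩ := hgen (m i) K hK
    refine ⟨j, (m i).subtype ∘ₗ f, ?_⟩
    rw [LinearMap.range_comp, not_imp_comm.1 (hKmax (LinearMap.range f)) hf, Submodule.map_top,
      Submodule.range_subtype]
  choose τ α hα using hcover
  have heq : ∀ l l' i j (f : N l →ₗ[A] N i) (g : N l' →ₗ[A] N j), LinearMap.range f = m i →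
      LinearMap.range g = m j → l = l' → i = j := by
    have key : ∀ l i j (f : N l →ₗ[A] N i) (g : N l →ₗ[A] N j), LinearMap.range f = m i →
        LinearMap.range g = m j → (∃ h : N j →ₗ[A] N i, f = h ∘ₗ g) → j = i := by
      rintro l i j f g hf hg ⟨h, rfl⟩
      refine hsurj j i h (surjective_of_le_map (hm j) (hmax j) (hm0 i) (hmax i) ?_)
      rw [← hf, LinearMap.range_comp, hg]
    rintro l l' i j f g hf hg rfl
    exact (hfac l i j f g).elim (fun h => (key l i j f g hf hg h).symm) (key l j i g f hg hf)
  have D : IsSerialDatum A (fun i => N i) τ α :=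
    { projective := hproj
      le_range := fun i X hX => (hα i).symm ▸ hmax i X hX
      range_ne_top := fun i => (hα i).symm ▸ hm i
      artinian := fun i => inferInstance
      generates := hgen
      eq_of_surjective := hsurj
      injective := fun i j h => heq _ _ i j (α i) (α j) (hα i) (hα j) h
      comm := fun i u => by
        rcases hfac _ _ _ (α i ∘ₗ u) (α i) with ⟨h, hh⟩ | ⟨h, hh⟩
        · exact ⟨h, hh.symm⟩
        · have hs : Surjective h := by
            refine surjective_of_le_map (hm i) (hmax i) (hm0 i) (hmax i) ?_
            conv_lhs => rw [← hα i, hh, LinearMap.range_comp]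
            refine Submodule.map_mono ?_
            rw [← hα i]
            exact LinearMap.range_comp_le_range u (α i)
          let e := LinearEquiv.ofBijective h
            ⟨IsNoetherian.injective_of_surjective_endomorphism h hs, hs⟩
          refine ⟨e.symm.toLinearMap, LinearMap.ext fun x => ?_⟩
          refine e.symm_apply_eq.2 ?_
          exact LinearMap.congr_fun hh x }
  refine ⟨I, hI, N, τ, α, D, fun i => ?_⟩
  by_contra! hlt
  refine hm0 i ?_
  rw [← hα i, ← serialRad_one (P := fun i => N i), D.serialRad_eq_bot_iff]
  omega

end NakayamaDatum

section Periodic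

variable {I : Type} {τ : I → I} {c : I → ℕ}

lemma SerialDeloops.eq_add_one_or_mem {i : I} (h : SerialDeloops τ c i 1) (hc0 : ∀ i, 0 < c i) :
    c i = c (τ i) + 1 ∨ τ i ∈ Set.range fun j => τ^[c j] j := by
  have hpos := hc0 i
  have h1 : serialSyz τ c (i, 1) = (τ i, c i - 1) := by simp [serialSyz]
  have hone : c i - 1 = 0 → τ i ∈ Set.range fun j => τ^[c j] j := fun h0 =>
    ⟨i, by simp [show c i = 1 by omega]⟩
  unfold SerialDeloops at h
  rw [iterate_one, h1] at h
  rcases h with h | h | ⟨⟨a, l⟩, hw, h⟩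
  · exact Or.inr (hone h)
  · left
    change c i - 1 = c (τ i) at h
    omega
  · right
    change l ≤ c a at hw
    have h2 := congrArg Prod.snd h
    rw [iterate_succ_apply', iterate_one] at h h2
    unfold serialSyz at h h2
    split_ifs at h h2 with h3 h4
    · exact hone (h2.symm.trans h3)
    · exact hone (h2.symm.trans h4)
    · have h6 : τ^[c a - l] (τ^[l] a) = τ i := congrArg Prod.fst h
      rw [← iterate_add_apply, Nat.sub_add_cancel hw] at h6
      exact ⟨a, h6⟩

/-- If all simple modules have delooping level at most one, then `i ↦ τ^[c i] i` permutes its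
image, and this image consists of the points where its lift to the line jumps. -/
lemma injOn_and_of_serialDeloops_one [Finite I] (hτ : Injective τ) (hc0 : ∀ i, 0 < c i)
    (hc : ∀ i, c i ≤ c (τ i) + 1) (h : ∀ i, SerialDeloops τ c i 1) :
    Set.InjOn (fun j => τ^[c j] j) (Set.range fun j => τ^[c j] j) ∧
      ∀ i, (τ i ∈ Set.range fun j => τ^[c j] j) → c i ≤ c (τ i) := by
  set π : I → I := fun j => τ^[c j] j with hπ
  have hsub : τ '' {i | c i ≤ c (τ i)} ⊆ Set.range π := by
    rintro _ ⟨i, hi, rfl⟩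
    refine ((h i).eq_add_one_or_mem hc0).resolve_left fun h1 => ?_
    change c i ≤ c (τ i) at hi
    omega
  have himg : Set.range π ⊆ π '' (τ '' {i | c i ≤ c (τ i)}) := by
    obtain ⟨b, hb⟩ := (Set.finite_range c).bddAbove
    have hb' : ∀ i, c i ≤ b := fun i => hb ⟨i, rfl⟩
    have key : ∀ n i, b ≤ c i + n → π i ∈ π '' (τ '' {i | c i ≤ c (τ i)}) := by
      intro n
      induction n with
      | zero =>
        intro i hi
        obtain ⟨j, rfl⟩ := Finite.surjective_of_injective hτ i
        exact ⟨_, ⟨j, (hb' j).trans hi, rfl⟩, rfl⟩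
      | succ n ih =>
        intro i hi
        obtain ⟨j, rfl⟩ := Finite.surjective_of_injective hτ i
        by_cases hj : c j ≤ c (τ j)
        · exact ⟨_, ⟨j, hj, rfl⟩, rfl⟩
        · have hcj : c j = c (τ j) + 1 := le_antisymm (hc j) (by omega)
          have hπj : π j = π (τ j) := by
            simp only [hπ, hcj, iterate_succ_apply]
          rw [← hπj]
          exact ih j (by omega)
    rintro _ ⟨i, rfl⟩
    exact key b i (Nat.le_add_left _ _)
  have hcard : (Set.range π).ncard ≤ (τ '' {i | c i ≤ c (τ i)}).ncard :=
    (Set.ncard_le_ncard himg (Set.toFinite _)).trans (Set.ncard_image_le (Set.toFinite _))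
  have heq := Set.eq_of_subset_of_ncard_le hsub hcard (Set.toFinite _)
  constructor
  · rw [← heq]
    refine Set.injOn_of_ncard_image_eq (le_antisymm (Set.ncard_image_le (Set.toFinite _)) ?_)
      (Set.toFinite _)
    rw [heq] at himg ⊢
    exact Set.ncard_le_ncard himg (Set.toFinite _)
  · intro i hi
    rw [← heq] at hi
    obtain ⟨j, hj, hij⟩ := hi
    exact hτ hij ▸ hj

lemma serialSyz_snd_ne_zero {w : I × ℕ} (h : (serialSyz τ c w).2 ≠ 0) :
    w.2 ≠ 0 ∧ w.2 < c w.1 ∧ serialSyz τ c w = (τ^[w.2] w.1, c w.1 - w.2) := by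
  unfold serialSyz at h ⊢
  split_ifs at h ⊢ with h0
  · exact absurd h0 h
  · refine ⟨h0, ?_, rfl⟩
    change c w.1 - w.2 ≠ 0 at h
    omega

lemma serialSyz_serialSyz_of_snd_ne_zero {w : I × ℕ}
    (h : (serialSyz τ c (serialSyz τ c w)).2 ≠ 0) :
    w.2 < c w.1 ∧ serialSyz τ c (serialSyz τ c w) =
      (τ^[c w.1] w.1, c (τ^[w.2] w.1) - (c w.1 - w.2)) := by
  obtain ⟨h1, h2, h3⟩ := serialSyz_snd_ne_zero h
  obtain ⟨h4, h5, h6⟩ := serialSyz_snd_ne_zero h1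
  refine ⟨h5, ?_⟩
  rw [h3, h6]
  change (τ^[c w.1 - w.2] (τ^[w.2] w.1), _) = _
  rw [← iterate_add_apply, Nat.sub_add_cancel h5.le]

lemma le_iterate_add (hc : ∀ i, c i ≤ c (τ i) + 1) (k : ℕ) (i : I) : c i ≤ c (τ^[k] i) + k := by
  induction k with
  | zero => simp
  | succ k ih =>
    have := hc (τ^[k] i)
    rw [iterate_succ_apply']
    omega

lemma serialSyz_ne_zero_of_serialDeloops_one [Finite I] (hτ : Injective τ) (hc0 : ∀ i, 0 < c i)
    (hc : ∀ i, c i ≤ c (τ i) + 1) (h : ∀ i, SerialDeloops τ c i 1) {w : I × ℕ}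
    (hw : (serialSyz τ c (serialSyz τ c w)).2 ≠ 0) :
    (serialSyz τ c (serialSyz τ c (serialSyz τ c w))).2 ≠ 0 := by
  obtain ⟨h1, h2⟩ := serialSyz_serialSyz_of_snd_ne_zero hw
  have h3 := le_iterate_add hc (c w.1 - w.2 - 1) (τ^[w.2] w.1)
  have h4 : τ (τ^[c w.1 - w.2 - 1] (τ^[w.2] w.1)) = τ^[c w.1] w.1 := by
    rw [← iterate_succ_apply' τ, ← iterate_add_apply]
    congr 2
    omega
  have h5 := (injOn_and_of_serialDeloops_one hτ hc0 hc h).2 (τ^[c w.1 - w.2 - 1] (τ^[w.2] w.1))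
    ⟨w.1, h4.symm⟩
  rw [h4] at h5
  rw [show serialSyz τ c (serialSyz τ c (serialSyz τ c w)) = _ from if_neg hw]
  rw [h2] at hw ⊢
  change c (τ^[w.2] w.1) - (c w.1 - w.2) ≠ 0 at hw
  change c (τ^[c w.1] w.1) - (c (τ^[w.2] w.1) - (c w.1 - w.2)) ≠ 0
  omega

lemma serialSyz_inj_of_serialDeloops_one [Finite I] (hτ : Injective τ) (hc0 : ∀ i, 0 < c i)
    (hc : ∀ i, c i ≤ c (τ i) + 1) (h : ∀ i, SerialDeloops τ c i 1) {w w' : I × ℕ}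
    (hw : (serialSyz τ c (serialSyz τ c w)).2 ≠ 0)
    (hw' : (serialSyz τ c (serialSyz τ c w')).2 ≠ 0)
    (heq : serialSyz τ c (serialSyz τ c (serialSyz τ c w)) =
      serialSyz τ c (serialSyz τ c (serialSyz τ c w'))) :
    serialSyz τ c (serialSyz τ c w) = serialSyz τ c (serialSyz τ c w') := by
  have key : ∀ {w : I × ℕ}, (serialSyz τ c (serialSyz τ c w)).2 ≠ 0 →
      ∃ e n, e ∈ (Set.range fun j => τ^[c j] j) ∧ n < c e ∧
        serialSyz τ c (serialSyz τ c w) = (e, n) ∧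
        serialSyz τ c (serialSyz τ c (serialSyz τ c w)) = (τ^[n] e, c e - n) := by
    intro w hw
    obtain ⟨h1, h2, h3⟩ := serialSyz_snd_ne_zero
      (serialSyz_ne_zero_of_serialDeloops_one hτ hc0 hc h hw)
    refine ⟨_, _, ⟨w.1, ?_⟩, h2, rfl, h3⟩
    rw [(serialSyz_serialSyz_of_snd_ne_zero hw).2]
  obtain ⟨e, n, he, hn, h1, h2⟩ := key hw
  obtain ⟨e', n', he', hn', h1', h2'⟩ := key hw'
  rw [h2, h2', Prod.mk.injEq] at heq
  obtain rfl : e = e' := by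
    refine (injOn_and_of_serialDeloops_one hτ hc0 hc h).1 he he' ?_
    change τ^[c e] e = τ^[c e'] e'
    rw [← Nat.sub_add_cancel hn.le, iterate_add_apply, heq.1, heq.2, ← iterate_add_apply,
      Nat.sub_add_cancel hn'.le]
  obtain rfl : n = n' := by omega
  rw [h1, h1']

end Periodic

section StableRank

variable {T : Type*} {L : AddMonoid.End (T →₀ ℤ)} {Y : Set T}

/-- If `L ^ 2` maps basis elements to `0` or to basis elements in `Y`, and `L` permutes part of the
basis in `Y` injectively, then the ranks of the images of a subgroup stabilize after two steps. -/
lemma finrank_map_pow_eq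
    (hL2 : ∀ x, L (L (Finsupp.single x 1)) = 0 ∨
      ∃ y ∈ Y, L (L (Finsupp.single x 1)) = Finsupp.single y 1)
    (g : T → T) (hg : ∀ y ∈ Y, L (Finsupp.single y 1) = Finsupp.single (g y) 1)
    (hgY : Set.MapsTo g Y Y) (hginj : Set.InjOn g Y) (G : AddSubgroup (T →₀ ℤ)) (j : ℕ) :
    Module.finrank ℤ (AddSubgroup.map (L ^ 2) G) =
      Module.finrank ℤ (AddSubgroup.map (L ^ (2 + j)) G) := by
  have hsingle : ∀ (x : T) (n : ℤ), Finsupp.single x n = n • Finsupp.single x (1 : ℤ) := by simp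
  have hmem : ∀ v : T →₀ ℤ, L (L v) ∈ Finsupp.supported ℤ ℤ Y := by
    intro v
    induction v using Finsupp.induction_linear with
    | zero => simp
    | add u v hu hv => rw [map_add, map_add]; exact add_mem hu hv
    | single x n =>
      rw [hsingle, map_zsmul, map_zsmul]
      refine Submodule.smul_mem _ _ ?_
      rcases hL2 x with h | ⟨y, hy, h⟩
      · rw [h]; exact zero_mem _
      · rw [h]; exact Finsupp.single_mem_supported ℤ 1 hy
  have hmap : ∀ v ∈ Finsupp.supported ℤ ℤ Y, L v = Finsupp.mapDomain g v := by
    intro v hv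
    conv_lhs => rw [← Finsupp.sum_single v]
    rw [Finsupp.mapDomain, Finsupp.sum, Finsupp.sum, map_sum]
    refine Finset.sum_congr rfl fun y hy => ?_
    rw [hsingle, map_zsmul, hg y (hv hy), ← hsingle]
  have hmaps : ∀ v ∈ Finsupp.supported ℤ ℤ Y, L v ∈ Finsupp.supported ℤ ℤ Y := by
    intro v hv
    rw [hmap v hv, Finsupp.mem_supported]
    intro z hz
    obtain ⟨y, hy, rfl⟩ := Finset.mem_image.1 (Finsupp.mapDomain_support hz)
    exact hgY (hv hy)
  have hinj : ∀ j, ∀ u ∈ Finsupp.supported ℤ ℤ Y, (L ^ j) u = 0 → u = 0 := by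
    intro j
    induction j with
    | zero => intro u _ h; simpa using h
    | succ j ih =>
      intro u hu h
      rw [pow_succ] at h
      have h1 := ih (L u) (hmaps u hu) h
      rw [hmap u hu] at h1
      exact Finsupp.mapDomain_injOn Y hginj hu (zero_mem (Finsupp.supported ℤ ℤ Y))
        (by rw [h1, Finsupp.mapDomain_zero])
  have hrange : ∀ v ∈ AddSubgroup.map (L ^ 2) G, v ∈ Finsupp.supported ℤ ℤ Y := by
    rintro _ ⟨v, -, rfl⟩
    exact hmem v
  have hcomp : AddSubgroup.map (L ^ j) (AddSubgroup.map (L ^ 2) G) =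
      AddSubgroup.map (L ^ (2 + j)) G := by
    rw [add_comm 2 j, pow_add]
    exact AddSubgroup.map_map G _ _
  rw [← hcomp]
  let φ := (AddMonoidHom.addSubgroupMap (L ^ j) (AddSubgroup.map (L ^ 2) G))
  refine LinearEquiv.finrank_eq (AddEquiv.ofBijective φ
    ⟨(injective_iff_map_eq_zero φ).2 fun u hu => ?_,
      AddMonoidHom.addSubgroupMap_surjective _ _⟩).toIntLinearEquiv
  exact Subtype.ext (hinj j u (hrange u u.2) (congrArg Subtype.val hu))

end StableRank

section Grothendieck

variable {A : Type} [Ring A]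

lemma decompClass_of_subsingleton (M : ModuleCat.{0} A) [Subsingleton M] :
    decompClass A M = 0 := by
  unfold decompClass
  split_ifs with h
  · obtain ⟨e⟩ := Classical.choose_spec h
    generalize Classical.choose h = f at e
    have hf : f = 0 := by
      ext x
      by_contra hx
      let t : Σ x : f.support, Fin (f x.1) :=
        ⟨⟨x, Finsupp.mem_support_iff.2 hx⟩, ⟨0, Nat.pos_of_ne_zero hx⟩⟩
      have : Nontrivial ((Quotient.out t.1.1).1 : ModuleCat A) := (Quotient.out t.1.1).2.2.1
      obtain ⟨y, hy⟩ := exists_ne (0 : ((Quotient.out t.1.1).1 : ModuleCat A))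
      apply hy
      apply DirectSum.of_injective (β := fun i : Σ x : f.support, Fin (f x.1) =>
        ((Quotient.out i.1.1).1 : ModuleCat A)) t
      exact e.symm.injective (Subsingleton.elim _ _)
    subst hf
    ext x
    simp
  · rfl

lemma isDecompositionOf_single {M : ModuleCat.{0} A} {q : IndecIso A} (e : M ≃ₗ[A] q.out.1) :
    IsDecompositionOf A (Finsupp.single q 1) M := by
  let T := Σ x : (Finsupp.single q 1 : IndecIso A →₀ ℕ).support,
    Fin ((Finsupp.single q 1 : IndecIso A →₀ ℕ) x.1)
  let U : T → ModuleCat.{0} A := fun i => (Quotient.out i.1.1).1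
  let t : T := ⟨⟨q, by simp⟩, ⟨0, by simp⟩⟩
  have ht : ∀ s : T, s = t := by
    rintro ⟨⟨x, hx⟩, k⟩
    obtain rfl : x = q := by simpa using Finsupp.support_single_subset hx
    have hk := k.2
    simp only [Finsupp.single_eq_same] at hk
    exact congrArg (Sigma.mk _) (Fin.ext (by simpa using hk))
  refine ⟨e.trans (LinearEquiv.ofBijective (DirectSum.lof A T (fun t => U t) t)
    ⟨DirectSum.of_injective (β := fun t => U t) t, fun x => ⟨x t, ?_⟩⟩)⟩
  refine DFinsupp.ext fun s => ?_
  rw [ht s]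
  exact DirectSum.of_eq_same (β := fun t => U t) t (x t)

lemma decompClass_of_equiv {M : ModuleCat.{0} A} (X : FGIndec A) (e : M ≃ₗ[A] X.1) :
    decompClass A M = Finsupp.single (Quotient.mk (indecSetoid A) X) 1 := by
  have hM : IndecomposableModule A X.1 := X.2.2
  have hex : ∃ f : IndecIso A →₀ ℕ, IsDecompositionOf A f M := by
    obtain ⟨e₀⟩ : Nonempty (((Quotient.mk (indecSetoid A) X).out.1 : ModuleCat A) ≃ₗ[A] X.1) :=
      Quotient.mk_out (s := indecSetoid A) X
    exact ⟨_, isDecompositionOf_single (e.trans e₀.symm)⟩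
  unfold decompClass
  rw [dif_pos hex]
  obtain ⟨e'⟩ := Classical.choose_spec hex
  generalize Classical.choose hex = f at e'
  let T := Σ x : f.support, Fin (f x.1)
  let U : T → ModuleCat.{0} A := fun i => (Quotient.out i.1.1).1
  have hnt : ∀ t, Nontrivial (U t) := fun t => (Quotient.out t.1.1).2.2.1
  have hbij : ∀ t, Bijective (DirectSum.component A T (fun t => U t) t ∘ₗ
      (e'.toLinearMap ∘ₗ e.symm.toLinearMap)) := fun t => by
    refine hM.bijective_of_retract (ι := (e.toLinearMap ∘ₗ e'.symm.toLinearMap) ∘ₗ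
      DirectSum.lof A T (fun t => U t) t) fun x => ?_
    simp only [LinearMap.comp_apply, LinearEquiv.coe_coe, LinearEquiv.symm_apply_apply,
      LinearEquiv.apply_symm_apply]
    exact DirectSum.component.lof_self (M := fun t => U t) A t x
  have hsub : ∀ t t' : T, t = t' := by
    intro t t'
    by_contra hne
    obtain ⟨y, hy⟩ := exists_ne (0 : U t')
    apply hy
    apply DirectSum.of_injective (β := fun t => U t) t'
    apply (e'.symm.trans e).injective
    apply (hbij t).1
    simp only [LinearMap.comp_apply, LinearEquiv.coe_coe, LinearEquiv.trans_apply,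
      LinearEquiv.symm_apply_apply, LinearEquiv.apply_symm_apply]
    exact (DirectSum.of_eq_of_ne (β := fun t => U t) t' t y hne).trans
      (DirectSum.of_eq_of_ne (β := fun t => U t) t' t 0 hne).symm
  have hclass : ∀ t : T, t.1.1 = Quotient.mk (indecSetoid A) X := fun t => by
    rw [← Quotient.out_eq t.1.1]
    exact Quotient.sound ⟨(LinearEquiv.ofBijective _ (hbij t)).symm⟩
  have hf : f = Finsupp.single (Quotient.mk (indecSetoid A) X) 1 := by
    obtain ⟨t⟩ : Nonempty T := by
      by_contra hT
      rw [not_nonempty_iff] at hT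
      have h1 : Subsingleton (DirectSum T fun t => U t) :=
        ⟨fun x y => DFinsupp.ext fun t => hT.elim t⟩
      have h2 : Subsingleton X.1 := (e.symm.trans e').injective.subsingleton
      exact not_subsingleton_iff_nontrivial.2 hM.1 h2
    rw [← hclass t]
    have hmem : ∀ x, f x ≠ 0 → x = t.1.1 := fun x hx =>
      congrArg (fun t : T => t.1.1)
        (hsub ⟨⟨x, Finsupp.mem_support_iff.2 hx⟩, ⟨0, Nat.pos_of_ne_zero hx⟩⟩ t)
    have hone : f t.1.1 ≤ 1 := by
      rw [← Fin.subsingleton_iff_le_one]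
      refine ⟨fun a b => ?_⟩
      exact eq_of_heq (Sigma.mk.inj (hsub ⟨t.1, a⟩ ⟨t.1, b⟩)).2
    have hpos := t.2.pos
    ext x
    by_cases hx : x = t.1.1
    · rw [hx, Finsupp.single_eq_same]
      omega
    · rw [Finsupp.single_eq_of_ne hx]
      exact not_imp_comm.1 (hmem x) hx
  subst hf
  simp

end Grothendieck

section PhiDim

lemma phiDim_le_of_forall {A : Type} [Ring A] {n : ℕ}
    (h : ∀ (G : AddSubgroup (K0Group A)) (j : ℕ),
      Module.finrank ℤ (AddSubgroup.map (syzygyEnd A ^ n) G) =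
        Module.finrank ℤ (AddSubgroup.map (syzygyEnd A ^ (n + j)) G)) :
    phiDim A ≤ n := by
  refine sSup_le ?_
  rintro _ ⟨M, -, rfl⟩
  exact sInf_le ⟨n, fun j _ => h _ j, rfl⟩

lemma syzygyEnd_single {A : Type} [Ring A] (x : IndecIso A) :
    syzygyEnd A (Finsupp.single x 1) = decompClass A (syzygyModule A x.out.1) := by
  exact (Finsupp.liftAddHom_apply_single _ x (1 : ℤ)).trans (by simp)

lemma nonempty_syzygyModule_equiv {A : Type} [Ring A] {M N M' : ModuleCat.{0} A}
    (h : IsSyzygyOf A N M') (e : M ≃ₗ[A] M') : Nonempty (syzygyModule A M ≃ₗ[A] N) := by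
  have hex : ∃ N : ModuleCat.{0} A, IsSyzygyOf A N M :=
    ⟨N, h.congr e.symm (LinearEquiv.refl A N)⟩
  unfold syzygyModule
  rw [dif_pos hex]
  exact (Classical.choose_spec hex).nonempty_equiv h e

variable {R : Type} [Ring R] {I : Type} {P : I → Type}
  [∀ i, AddCommGroup (P i)] [∀ i, Module R (P i)] {τ : I → I}
  {α : ∀ i, P (τ i) →ₗ[R] P i}

/-- If the delooping level is at most one, then the `φ`-dimension is at most two. -/
theorem IsSerialDatum.phiDim_le_two [Finite I] (D : IsSerialDatum R P τ α)
    (hdel : delAlg R ≤ 1) : phiDim R ≤ 2 := by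
  have hdel' : ∀ i, SerialDeloops τ D.length i 1 := (D.delAlg_le_iff 1).1 hdel
  set f := serialSyz τ D.length with hf
  have hrep : ∀ x : IndecIso R, ∃ w : I × ℕ, w.2 ≠ 0 ∧ w.2 ≤ D.length w.1 ∧
      Nonempty (x.out.1 ≃ₗ[R] serialQuot α w) := fun x =>
    D.exists_equiv_of_indecomposable x.out.2.1 x.out.2.2
  choose ω hω0 hω hωe using hrep
  have e : ∀ x, x.out.1 ≃ₗ[R] serialQuot α (ω x) := fun x => (hωe x).some
  have hωinj : Injective ω := fun x y hxy => by
    rw [← Quotient.out_eq x, ← Quotient.out_eq y]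
    exact Quotient.sound ⟨(e x).trans
      ((LinearEquiv.cast (R := R) (M := fun w => serialQuot α w) hxy).trans (e y).symm)⟩
  have hsyz : ∀ x, Nonempty (syzygyModule R x.out.1 ≃ₗ[R] serialQuot α (f (ω x))) := fun x =>
    nonempty_syzygyModule_equiv (D.isSyzygyOf_serialQuot (ω x) (hω x)) (e x)
  have hzero : ∀ x, (f (ω x)).2 = 0 → syzygyEnd R (Finsupp.single x 1) = 0 := by
    intro x hx
    obtain ⟨e'⟩ := hsyz x
    have h1 : f (ω x) = ((f (ω x)).1, 0) := Prod.ext rfl hx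
    rw [h1] at e'
    have := subsingleton_serialQuot (α := α) (f (ω x)).1
    have := e'.injective.subsingleton
    rw [syzygyEnd_single, decompClass_of_subsingleton]
  have hstep : ∀ x, ∃ y, (f (ω x)).2 ≠ 0 →
      ω y = f (ω x) ∧ syzygyEnd R (Finsupp.single x 1) = Finsupp.single y 1 := by
    intro x
    by_cases hx : (f (ω x)).2 = 0
    · exact ⟨x, fun h => absurd hx h⟩
    let X : FGIndec R := ⟨serialQuot α (f (ω x)), D.finite_serialQuot _,
      D.indecomposable_serialQuot hx⟩
    obtain ⟨e'⟩ := hsyz x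
    refine ⟨Quotient.mk (indecSetoid R) X, fun _ => ⟨?_, ?_⟩⟩
    · obtain ⟨e₀⟩ : Nonempty (((Quotient.mk (indecSetoid R) X).out.1 : ModuleCat R) ≃ₗ[R] X.1) :=
        Quotient.mk_out (s := indecSetoid R) X
      exact D.eq_of_equiv (hω _) (D.serialSyz_mem _ (hω x)) hx ((e _).symm.trans e₀)
    · rw [syzygyEnd_single]
      exact decompClass_of_equiv X e'
  choose g hg using hstep
  have hfix : ∀ w : I × ℕ, w.2 = 0 → f w = w := fun w hw => if_pos hw
  have hne : ∀ {w : I × ℕ}, (f w).2 ≠ 0 → w.2 ≠ 0 := fun h h0 => h (by rw [hfix _ h0, h0])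
  let Y : Set (IndecIso R) := {y | ∃ x, ω y = f (f (ω x))}
  have hff : ∀ {y x}, ω y = f (f (ω x)) → (f (f (ω x))).2 ≠ 0 := fun h => h ▸ hω0 _
  have hfff : ∀ {y x}, ω y = f (f (ω x)) → (f (ω y)).2 ≠ 0 := fun h => by
    rw [h]
    exact serialSyz_ne_zero_of_serialDeloops_one D.injective D.length_pos D.length_le_add_one
      hdel' (hff h)
  refine phiDim_le_of_forall fun G j => finrank_map_pow_eq (Y := Y) (fun x => ?_) g ?_ ?_ ?_ G j
  · by_cases hx : (f (ω x)).2 = 0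
    · left
      rw [hzero x hx, map_zero]
    · rw [(hg x hx).2]
      by_cases hx' : (f (ω (g x))).2 = 0
      · exact Or.inl (hzero _ hx')
      · refine Or.inr ⟨g (g x), ⟨x, ?_⟩, (hg _ hx').2⟩
        rw [(hg _ hx').1, (hg x hx).1]
  · rintro y ⟨x, hyx⟩
    exact (hg y (hfff hyx)).2
  · rintro y ⟨x, hyx⟩
    exact ⟨g x, by rw [(hg y (hfff hyx)).1, (hg x (hne (hff hyx))).1, hyx]⟩
  · rintro y ⟨x, hyx⟩ y' ⟨x', hyx'⟩ hgy
    apply hωinj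
    have h1 := congrArg ω hgy
    rw [(hg y (hfff hyx)).1, (hg y' (hfff hyx')).1, hyx, hyx'] at h1
    rw [hyx, hyx']
    exact serialSyz_inj_of_serialDeloops_one D.injective D.length_pos D.length_le_add_one hdel'
      (hff hyx) (hff hyx') h1

end PhiDim

/-- For a cyclic Nakayama algebra `Λ` with `φdim Λ ≥ 3`, the delooping
level satisfies `del Λ = del ε(Λ) + 2`, where `ε(Λ)` is the syzygy filtered algebra. -/
theorem del_eq_del_syzygyFiltered_add_two
    (A : Type) [Ring A] (hA : IsCyclicNakayama A) (hphi : 3 ≤ phiDim A)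
    (B : Type) [Ring B] (hB : IsSyzygyFilteredAlgebra A B) :
    delAlg A = delAlg B + 2 := by
  obtain ⟨I, _, N, τ, α, D, hlen⟩ := hA.exists_isSerialDatum
  have key := D.delAlg_le_add_two_iff hlen hB
  have hdel : 2 ≤ delAlg A := by
    by_contra! hlt
    have h1 := hphi.trans (D.phiDim_le_two (Order.le_of_lt_add_one hlt))
    exact absurd h1 (by decide)
  refine eq_of_forall_ge_iff fun n => ?_
  induction n with
  | top => simp
  | coe n =>
    obtain ⟨d, rfl⟩ | hn : (∃ d, n = d + 2) ∨ n < 2 := by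
      rcases lt_or_ge n 2 with h | h
      · exact Or.inr h
      · exact Or.inl ⟨n - 2, by omega⟩
    · rw [key]
      push_cast
      exact (ENat.add_le_add_iff_right (by decide)).symm
    · have h2 : (n : ℕ∞) < 2 := by exact_mod_cast hn
      exact iff_of_false (fun h => (h2.trans_le hdel).not_ge h)
        fun h => (h2.trans_le le_add_self).not_ge h

end
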